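/- There exists a constant C > 0 depending only on n, λ and Λ such that for every g ∈ M_{λ,Λ}, every solution u of the Ginzburg–Landau equation −Δ_g u = ε⁻²(1−|u|²)u on B₁, every x₀ ∈ B₁ and all 0 < σ ≤ ρ < 1 − |x₀|, the following two inequalities hold: (1) σ^{2−n} ∫_{B_σ(x₀)} e_ε(u) dvol_g ≤ C ρ^{2−n} ∫_{B_ρ(x₀)} e_ε(u) dvol_g; (2) ∫_{B_ρ(x₀)} |x − x₀|^{2−n} (1−|u(x)|²)²/ε² dvol_g ≤ C (1 − |x₀|)^{2−n} ∫_{B₁} e_ε(u) dvol_g. -/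

import Mathlib

open MeasureTheory Metric

noncomputable section

/-- `n`-dimensional Euclidean space. -/
abbrev Euc (n : ℕ) : Type := EuclideanSpace ℝ (Fin n)

/-- The real inner product of two complex numbers, viewing `ℂ ≅ ℝ²`. -/
def rdot (v w : ℂ) : ℝ := v.re * w.re + v.im * w.im

/-- The `i`-th partial derivative of a function on Euclidean space. -/
def pd {n : ℕ} (u : Euc n → ℂ) (i : Fin n) (x : Euc n) : ℂ :=
  fderiv ℝ u x (EuclideanSpace.single i 1)

/-- `√(det g)`. -/
def sqrtDet {n : ℕ} (g : Euc n → Matrix (Fin n) (Fin n) ℝ) (x : Euc n) : ℝ :=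
  Real.sqrt (g x).det

/-- `g^{ij} ∂_i u · ∂_j u`, the squared norm of the gradient of `u` with respect to `g`. -/
def gradSq {n : ℕ} (g : Euc n → Matrix (Fin n) (Fin n) ℝ) (u : Euc n → ℂ) (x : Euc n) : ℝ :=
  ∑ i, ∑ j, (g x)⁻¹ i j * rdot (pd u i x) (pd u j x)

/-- The Ginzburg–Landau energy density `e_ε(u)`. -/
def eDen {n : ℕ} (g : Euc n → Matrix (Fin n) (Fin n) ℝ) (ε : ℝ) (u : Euc n → ℂ)
    (x : Euc n) : ℝ :=
  gradSq g u x / 2 + (1 - ‖u x‖ ^ 2) ^ 2 / (4 * ε ^ 2)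

/-- The class `M_{λ,Λ}` of Lipschitz metrics on the unit ball: symmetric positive definite,
equal to the identity at `0`, Lipschitz components, and uniformly elliptic. -/
def MemM (n : ℕ) (lam Lam : ℝ) (g : Euc n → Matrix (Fin n) (Fin n) ℝ) : Prop :=
  g 0 = 1 ∧
  (∀ x ∈ ball (0 : Euc n) 1, (g x).IsSymm ∧ (g x).PosDef) ∧
  (∀ i j : Fin n,
    LipschitzOnWith (Real.toNNReal Lam) (fun x => g x i j) (ball (0 : Euc n) 1)) ∧
  (∀ x ∈ ball (0 : Euc n) 1, ∀ ξ : Fin n → ℝ,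
    lam * ∑ i, ξ i ^ 2 ≤ ∑ i, ∑ j, g x i j * ξ i * ξ j ∧
    ∑ i, ∑ j, g x i j * ξ i * ξ j ≤ lam⁻¹ * ∑ i, ξ i ^ 2)

/-- A weak solution `u ∈ W^{1,2}(B₁; ℂ)`, `|u| ≤ 1`, of the Ginzburg–Landau equation
`−Δ_g u = ε⁻²(1−|u|²)u` on the unit ball. -/
def IsGLSol (n : ℕ) (g : Euc n → Matrix (Fin n) (Fin n) ℝ) (ε : ℝ) (u : Euc n → ℂ) : Prop :=
  DifferentiableOn ℝ u (ball (0 : Euc n) 1) ∧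
  (∀ x ∈ ball (0 : Euc n) 1, ‖u x‖ ≤ 1) ∧
  IntegrableOn (fun x => eDen g ε u x * sqrtDet g x) (ball (0 : Euc n) 1) ∧
  ∀ ζ : Euc n → ℂ, ContDiff ℝ 1 ζ → tsupport ζ ⊆ ball (0 : Euc n) 1 →
    ∫ x in ball (0 : Euc n) 1,
      ((∑ i, ∑ j, (g x)⁻¹ i j * rdot (pd u i x) (pd ζ j x))
        - (1 - ‖u x‖ ^ 2) / ε ^ 2 * rdot (u x) (ζ x)) * sqrtDet g x = 0

open Filter Topology
open scoped ENNReal RealInnerProductSpace Convolution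

theorem tendsto_eLpNorm_translate_sub {n : ℕ} {Z : Type*} [NormedAddCommGroup Z]
    {k : Euc n → Z} (hk : MemLp k 2 volume) :
    Tendsto (fun z : Euc n => eLpNorm (fun x => k (z + x) - k x) 2 volume) (𝓝 0) (𝓝 0) := by
  have : Fact ((2:ℝ≥0∞) ≠ ∞) := ⟨by norm_num⟩
  have hc : Continuous (fun z : Euc n => (DomAddAct.mk z) +ᵥ (hk.toLp k)) := by
    have h1 : Continuous (fun z : Euc n => DomAddAct.mk z) := DomAddAct.continuous_mk
    exact h1.vadd continuous_const
  have h2 := (hc.tendsto 0)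
  rw [tendsto_iff_edist_tendsto_0] at h2
  refine h2.congr fun z => ?_
  rw [DomAddAct.mk_vadd_toLp, DomAddAct.mk_vadd_toLp, Lp.edist_toLp_toLp]
  congr 1
  ext x
  simp

theorem aestronglyMeasurable_clm_apply {α Z : Type*} [MeasurableSpace α] {μ : Measure α}
    [NormedAddCommGroup Z] [NormedSpace ℝ Z] {F : α → Z →L[ℝ] ℝ} {k : α → Z}
    (hF : AEStronglyMeasurable F μ) (hk : AEStronglyMeasurable k μ) :
    AEStronglyMeasurable (fun x => F x (k x)) μ :=
  (ContinuousLinearMap.id ℝ (Z →L[ℝ] ℝ)).aestronglyMeasurable_comp₂ hF hk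

theorem MemLp.integrable_clm_apply {α Z : Type*} [MeasurableSpace α] {μ : Measure α}
    [NormedAddCommGroup Z] [NormedSpace ℝ Z] {F : α → Z →L[ℝ] ℝ} {k : α → Z}
    (hF : MemLp F 2 μ) (hk : MemLp k 2 μ) : Integrable (fun x => F x (k x)) μ := by
  rw [← memLp_one_iff_integrable]
  exact MemLp.of_bilin (r := 1) (fun (f : Z →L[ℝ] ℝ) z => f z) 1 hF hk
    (aestronglyMeasurable_clm_apply hF.1 hk.1)
    (Eventually.of_forall fun x => by simpa using (F x).le_opNNNorm (k x))

theorem fderiv_convolution_eq {n : ℕ} {ψ : Euc n → ℝ} (hψ : ContDiff ℝ 1 ψ)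
    (hψc : HasCompactSupport ψ) {ζ : Euc n → ℂ} (hd : Differentiable ℝ ζ)
    (hi : LocallyIntegrable (fderiv ℝ ζ) volume) (x : Euc n) :
    fderiv ℝ (ψ ⋆[ContinuousLinearMap.lsmul ℝ ℝ, volume] ζ) x
      = ∫ t, ψ t • fderiv ℝ ζ (x - t) := by
  have hli : LocallyIntegrable ζ volume := hd.continuous.locallyIntegrable
  rw [(hψc.hasFDerivAt_convolution_left (ContinuousLinearMap.lsmul ℝ ℝ) hψ hli x).fderiv]
  have e1 : ∀ v, Integrable (fun t => (fderiv ℝ ψ t v) • ζ (x - t)) volume := fun v => by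
    have hc1 : Continuous fun t => fderiv ℝ ψ t v :=
      (hψ.continuous_fderiv one_ne_zero).clm_apply continuous_const
    refine Continuous.integrable_of_hasCompactSupport ?_ ?_
    · exact hc1.smul (hd.continuous.comp (by fun_prop))
    · exact (HasCompactSupport.fderiv_apply ℝ hψc v).smul_right
  have e2 : Integrable (fun t => ψ t • fderiv ℝ ζ (x - t)) volume :=
    hψc.convolutionExists_left (ContinuousLinearMap.lsmul ℝ ℝ) hψ.continuous hi x
  have e3 : Integrable (fun t => ψ t • ζ (x - t)) volume :=
    hψc.convolutionExists_left (ContinuousLinearMap.lsmul ℝ ℝ) hψ.continuous hli x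
  have e4 : Integrable (fun t => ((ContinuousLinearMap.lsmul ℝ ℝ).precompL (Euc n))
      (fderiv ℝ ψ t) (ζ (x - t))) volume :=
    (hψc.fderiv ℝ).convolutionExists_left _ (hψ.continuous_fderiv one_ne_zero) hli x
  ext v
  rw [MeasureTheory.convolution, ContinuousLinearMap.integral_apply e4,
    ContinuousLinearMap.integral_apply e2]
  have key := integral_bilinear_hasLineDerivAt_right_eq_neg_left_of_integrable (μ := volume)
    (f := ψ) (f' := fun t => fderiv ℝ ψ t v) (g := fun t => ζ (x - t))
    (g' := fun t => - fderiv ℝ ζ (x - t) v) (v := v) (B := ContinuousLinearMap.lsmul ℝ ℝ)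
    (e1 v) ?_ e3 ?_ ?_
  · simp only [ContinuousLinearMap.lsmul_apply, smul_neg, integral_neg, neg_inj] at key
    simp only [ContinuousLinearMap.precompL_apply, smul_apply]
    rw [key]; rfl
  · simpa using (e2.apply_continuousLinearMap v).neg
  · intro t _
    exact ((hψ.differentiable one_ne_zero) t).hasFDerivAt.hasLineDerivAt v
  · intro t _
    have h := (hd (x - t)).hasFDerivAt.comp t ((hasFDerivAt_id t).const_sub x)
    have h2 := h.hasLineDerivAt v
    simp at h2
    exact h2

theorem integral_clm_translate_swap {n : ℕ} {Z : Type*} [NormedAddCommGroup Z] [NormedSpace ℝ Z]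
    {F : Euc n → Z →L[ℝ] ℝ} (hF : MemLp F 2 volume) {k : Euc n → Z} (hk : MemLp k 2 volume)
    {ψ : Euc n → ℝ} (hψ0 : ∀ t, 0 ≤ ψ t) (hψi : Integrable ψ volume) :
    ∫ x, ∫ t, ψ t * F x (k (x - t)) = ∫ t, ψ t * ∫ x, F x (k (-t + x)) := by
  rw [integral_integral_swap]
  · refine integral_congr_ae (Eventually.of_forall fun t => ?_)
    simp only
    rw [← integral_const_mul]
    refine integral_congr_ae (Eventually.of_forall fun x => ?_)
    simp only [sub_eq_add_neg, add_comm]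
  · have hF2 : Integrable (fun x => ‖F x‖ ^ 2) volume := hF.integrable_norm_pow (by norm_num)
    have hk2 : Integrable (fun x => ‖k x‖ ^ 2) volume := hk.integrable_norm_pow (by norm_num)
    have i1 : Integrable (fun p : Euc n × Euc n => ‖F p.1‖ ^ 2 * ψ p.2) (volume.prod volume) :=
      hF2.mul_prod hψi
    have i2 : Integrable (fun p : Euc n × Euc n => ψ p.2 * ‖k (p.1 - p.2)‖ ^ 2)
        (volume.prod volume) :=
      hψi.convolution_integrand (ContinuousLinearMap.mul ℝ ℝ) hk2
    have i3 := i1.add i2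
    have hm : AEStronglyMeasurable (fun p : Euc n × Euc n => ψ p.2 * F p.1 (k (p.1 - p.2)))
        (volume.prod volume) := by
      refine AEStronglyMeasurable.mul hψi.1.comp_snd ?_
      have h1 : AEStronglyMeasurable (fun p : Euc n × Euc n => F p.1) (volume.prod volume) :=
        hF.1.comp_fst
      have h2 : AEStronglyMeasurable (fun p : Euc n × Euc n => k (p.1 - p.2))
          (volume.prod volume) :=
        hk.1.comp_quasiMeasurePreserving (quasiMeasurePreserving_sub volume volume)
      exact aestronglyMeasurable_clm_apply h1 h2
    refine i3.mono hm ?_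
    refine Eventually.of_forall fun p => ?_
    have hp : 0 ≤ ψ p.2 := hψ0 _
    simp only [Pi.add_apply]
    have h3 := (F p.1).le_opNorm (k (p.1 - p.2))
    have h4 : ‖F p.1‖ * ‖k (p.1 - p.2)‖ ≤ ‖F p.1‖ ^ 2 + ‖k (p.1 - p.2)‖ ^ 2 := by
      nlinarith [sq_nonneg (‖F p.1‖ - ‖k (p.1 - p.2)‖), sq_nonneg ‖F p.1‖,
        sq_nonneg ‖k (p.1 - p.2)‖]
    calc ‖ψ p.2 * F p.1 (k (p.1 - p.2))‖
        = ‖ψ p.2‖ * ‖F p.1 (k (p.1 - p.2))‖ := norm_mul _ _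
      _ ≤ ‖ψ p.2‖ * (‖F p.1‖ ^ 2 + ‖k (p.1 - p.2)‖ ^ 2) := by gcongr; linarith
      _ = ‖F p.1‖ ^ 2 * ψ p.2 + ψ p.2 * ‖k (p.1 - p.2)‖ ^ 2 := by
        rw [Real.norm_of_nonneg hp]; ring
      _ ≤ _ := le_abs_self _

theorem weak_form_extend {n : ℕ} {F : Euc n → ((Euc n →L[ℝ] ℂ) × ℂ) →L[ℝ] ℝ}
    (hF : MemLp F 2 volume) {U : Set (Euc n)} (hU : IsOpen U)
    (hweak : ∀ ζ : Euc n → ℂ, ContDiff ℝ 1 ζ → tsupport ζ ⊆ U →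
      HasCompactSupport ζ → ∫ x, F x (fderiv ℝ ζ x, ζ x) = 0)
    {ζ : Euc n → ℂ} (hd : Differentiable ℝ ζ) (hc : HasCompactSupport ζ)
    (hs : tsupport ζ ⊆ U) (h2 : MemLp (fderiv ℝ ζ) 2 volume) :
    ∫ x, F x (fderiv ℝ ζ x, ζ x) = 0 := by
  set k : Euc n → (Euc n →L[ℝ] ℂ) × ℂ := fun x => (fderiv ℝ ζ x, ζ x) with hk
  have hkm : MemLp k 2 volume :=
    MemLp.of_fst_snd ⟨h2, hd.continuous.memLp_of_hasCompactSupport hc⟩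
  have hli : LocallyIntegrable (fderiv ℝ ζ) volume := h2.locallyIntegrable (by norm_num)
  have htr : ∀ z, MemLp (fun x => k (z + x)) 2 volume := fun z =>
    hkm.comp_measurePreserving (measurePreserving_add_left volume z)
  set H : Euc n → ℝ := fun z => ∫ x, F x (k (z + x)) with hH
  have hcont : Tendsto H (𝓝 0) (𝓝 (H 0)) := by
    rw [tendsto_iff_edist_tendsto_0]
    have hb : ∀ z, edist (H z) (H 0) ≤
        eLpNorm F 2 volume * eLpNorm (fun x => k (z + x) - k x) 2 volume := by
      intro z
      rw [edist_eq_enorm_sub]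
      have : H z - H 0 = ∫ x, F x (k (z + x) - k x) := by
        simp only [hH, zero_add, map_sub]
        rw [integral_sub (MemLp.integrable_clm_apply hF (htr z))
          (MemLp.integrable_clm_apply hF hkm)]
      rw [this]
      refine (enorm_integral_le_lintegral_enorm _).trans ?_
      rw [← eLpNorm_one_eq_lintegral_enorm]
      have := eLpNorm_le_eLpNorm_mul_eLpNorm_of_nnnorm (p := 2) (q := 2) (r := 1) hF.1
        ((htr z).sub hkm).1 (fun (f : ((Euc n →L[ℝ] ℂ) × ℂ) →L[ℝ] ℝ) z => f z) 1
        (Eventually.of_forall fun x => by simpa using (F x).le_opNNNorm (k (z + x) - k x))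
      simp only [ENNReal.coe_one, one_mul] at this
      exact this
    refine tendsto_of_tendsto_of_tendsto_of_le_of_le tendsto_const_nhds ?_
      (fun z => zero_le) hb
    have := ENNReal.Tendsto.const_mul (tendsto_eLpNorm_translate_sub hkm)
      (Or.inr hF.2.ne)
    simpa using this
  have hH0 : H 0 = ∫ x, F x (fderiv ℝ ζ x, ζ x) := by simp [hH, hk]
  obtain ⟨δ, hδ, hδU⟩ := hc.isCompact.exists_cthickening_subset_open hU hs
  have hbump : ∀ φ : ContDiffBump (0 : Euc n), φ.rOut ≤ δ →
      ∫ t, φ.normed volume t * H (-t) = 0 := by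
    intro φ hφ
    set ψ := φ.normed volume with hψ
    have hψ1 : ContDiff ℝ 1 ψ := φ.contDiff_normed
    have hψc : HasCompactSupport ψ := φ.hasCompactSupport_normed
    have hψi : Integrable ψ volume := hψ1.continuous.integrable_of_hasCompactSupport hψc
    have hζ1 : ContDiff ℝ 1 (ψ ⋆[ContinuousLinearMap.lsmul ℝ ℝ, volume] ζ) :=
      hψc.contDiff_convolution_left (n := 1) _ hψ1 hd.continuous.locallyIntegrable
    have hcs : HasCompactSupport (ψ ⋆[ContinuousLinearMap.lsmul ℝ ℝ, volume] ζ) :=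
      hψc.convolution _ hc
    have hsub : tsupport (ψ ⋆[ContinuousLinearMap.lsmul ℝ ℝ, volume] ζ) ⊆ U := by
      refine subset_trans ?_ hδU
      refine closure_minimal ?_ isClosed_cthickening
      refine (support_convolution_subset _).trans ?_
      rintro _ ⟨a, ha, b, hb, rfl⟩
      refine mem_cthickening_of_dist_le _ b _ _ (subset_tsupport _ hb) ?_
      rw [hψ, φ.support_normed_eq] at ha
      have : dist a 0 < φ.rOut := ha
      simpa [dist_eq_norm] using (by simpa [dist_eq_norm] using this.le.trans hφ : ‖a‖ ≤ δ)
    have h0 := hweak _ hζ1 hsub hcs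
    have e1 : ∀ x, Integrable (fun t => ψ t • fderiv ℝ ζ (x - t)) volume := fun x =>
      hψc.convolutionExists_left (ContinuousLinearMap.lsmul ℝ ℝ) hψ1.continuous hli x
    have e2 : ∀ x, Integrable (fun t => ψ t • ζ (x - t)) volume := fun x =>
      hψc.convolutionExists_left (ContinuousLinearMap.lsmul ℝ ℝ) hψ1.continuous
        hd.continuous.locallyIntegrable x
    have e3 : ∀ x, Integrable (fun t => ψ t • k (x - t)) volume := fun x =>
      (e1 x).prodMk (e2 x)
    have e4 : ∀ x, F x (fderiv ℝ (ψ ⋆[ContinuousLinearMap.lsmul ℝ ℝ, volume] ζ) x,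
        (ψ ⋆[ContinuousLinearMap.lsmul ℝ ℝ, volume] ζ) x) = ∫ t, ψ t * F x (k (x - t)) := by
      intro x
      rw [fderiv_convolution_eq hψ1 hψc hd hli]
      have : (∫ t, ψ t • fderiv ℝ ζ (x - t),
          (ψ ⋆[ContinuousLinearMap.lsmul ℝ ℝ, volume] ζ) x) = ∫ t, ψ t • k (x - t) := by
        exact (integral_pair (e1 x) (e2 x)).symm
      rw [this, ← ContinuousLinearMap.integral_comp_comm _ (e3 x)]
      simp
    rw [integral_congr_ae (Eventually.of_forall e4)] at h0
    rw [integral_clm_translate_swap hF hkm (fun t => φ.nonneg_normed t) hψi] at h0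
    exact h0
  rw [← hH0]
  by_contra hne
  have hpos : 0 < |H 0| / 2 := by positivity
  obtain ⟨r, hr, hball⟩ := Metric.tendsto_nhds_nhds.1 hcont (|H 0| / 2) hpos
  let φ : ContDiffBump (0 : Euc n) :=
    ⟨min r δ / 2, min r δ, by positivity, by have : 0 < min r δ := by positivity
                                             linarith⟩
  have hz := hbump φ (min_le_right _ _)
  have hHm : AEStronglyMeasurable H volume := by
    have : AEStronglyMeasurable (fun p : Euc n × Euc n => F p.2 (k (p.1 + p.2)))
        (volume.prod volume) := by
      have h1 : AEStronglyMeasurable (fun p : Euc n × Euc n => F p.2) (volume.prod volume) :=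
        hF.1.comp_snd
      have h2 : AEStronglyMeasurable (fun p : Euc n × Euc n => k (p.1 + p.2))
          (volume.prod volume) :=
        hkm.1.comp_quasiMeasurePreserving (quasiMeasurePreserving_add volume volume)
      exact aestronglyMeasurable_clm_apply h1 h2
    exact this.integral_prod_right'
  have hd2 := φ.dist_normed_convolution_le (μ := volume) (g := H) (x₀ := 0) (ε := |H 0| / 2)
    hHm (fun x hx => (hball (lt_of_lt_of_le hx (min_le_left _ _))).le)
  have : ((φ.normed volume ⋆[ContinuousLinearMap.lsmul ℝ ℝ, volume] H) 0) = 0 := by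
    rw [← hz]; simp [MeasureTheory.convolution]
  rw [this, Real.dist_eq, zero_sub, abs_neg] at hd2
  have : 0 < |H 0| := abs_pos.2 hne
  linarith

/-- The gradient vector of the `k`-component of a derivative `D`. -/
def gvec {n : ℕ} (D : Euc n →L[ℝ] ℂ) (k : ℂ) : Euc n := ContinuousLinearMap.adjoint D k

/-- The bilinear form on derivatives of complex-valued maps induced by an operator `S`. -/
def qform {n : ℕ} (S : Euc n →L[ℝ] Euc n) (D D' : Euc n →L[ℝ] ℂ) : ℝ :=
  ⟪S (gvec D 1), gvec D' 1⟫ + ⟪S (gvec D Complex.I), gvec D' Complex.I⟫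

theorem norm_gvec_le {n : ℕ} (D : Euc n →L[ℝ] ℂ) {k : ℂ} (hk : ‖k‖ = 1) : ‖gvec D k‖ ≤ ‖D‖ := by
  have := (ContinuousLinearMap.adjoint D).le_opNorm k
  rwa [hk, mul_one, LinearIsometryEquiv.norm_map] at this

theorem gvec_add {n : ℕ} (D D' : Euc n →L[ℝ] ℂ) (k : ℂ) :
    gvec (D + D') k = gvec D k + gvec D' k := by simp [gvec]

theorem gvec_comp {n : ℕ} (D : Euc n →L[ℝ] ℂ) (T : Euc n →L[ℝ] Euc n) (k : ℂ) :
    gvec (D.comp T) k = ContinuousLinearMap.adjoint T (gvec D k) := by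
  simp [gvec, ContinuousLinearMap.adjoint_comp]

theorem inner_gvec_one {n : ℕ} (D : Euc n →L[ℝ] ℂ) (h : Euc n) : ⟪h, gvec D 1⟫ = (D h).re := by
  rw [gvec, ContinuousLinearMap.adjoint_inner_right, Complex.inner]; simp

theorem inner_gvec_I {n : ℕ} (D : Euc n →L[ℝ] ℂ) (h : Euc n) :
    ⟪h, gvec D Complex.I⟫ = (D h).im := by
  rw [gvec, ContinuousLinearMap.adjoint_inner_right, Complex.inner]; simp

theorem norm_sq_le_gvec {n : ℕ} (D : Euc n →L[ℝ] ℂ) :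
    ‖D‖ ^ 2 ≤ ‖gvec D 1‖ ^ 2 + ‖gvec D Complex.I‖ ^ 2 := by
  have h : ‖D‖ ≤ Real.sqrt (‖gvec D 1‖ ^ 2 + ‖gvec D Complex.I‖ ^ 2) := by
    refine D.opNorm_le_bound (Real.sqrt_nonneg _) fun x => ?_
    have h1 : |(D x).re| ≤ ‖x‖ * ‖gvec D 1‖ := by
      rw [← inner_gvec_one]; exact abs_real_inner_le_norm _ _
    have h2 : |(D x).im| ≤ ‖x‖ * ‖gvec D Complex.I‖ := by
      rw [← inner_gvec_I]; exact abs_real_inner_le_norm _ _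
    have h3 : ‖D x‖ ^ 2 ≤ (‖gvec D 1‖ ^ 2 + ‖gvec D Complex.I‖ ^ 2) * ‖x‖ ^ 2 := by
      rw [← Complex.normSq_eq_norm_sq, Complex.normSq_apply]
      have h4 := mul_self_le_mul_self (abs_nonneg _) h1
      have h5 := mul_self_le_mul_self (abs_nonneg _) h2
      rw [abs_mul_abs_self] at h4 h5
      nlinarith
    rw [← Real.sqrt_sq (norm_nonneg x), ← Real.sqrt_mul (by positivity)]
    exact Real.le_sqrt_of_sq_le h3
  calc ‖D‖ ^ 2 ≤ Real.sqrt (‖gvec D 1‖ ^ 2 + ‖gvec D Complex.I‖ ^ 2) ^ 2 := by gcongr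
    _ = _ := Real.sq_sqrt (by positivity)

theorem abs_qform_le {n : ℕ} (S : Euc n →L[ℝ] Euc n) (D D' : Euc n →L[ℝ] ℂ) :
    |qform S D D'| ≤ 2 * ‖S‖ * ‖D‖ * ‖D'‖ := by
  have h : ∀ k : ℂ, ‖k‖ = 1 → |⟪S (gvec D k), gvec D' k⟫| ≤ ‖S‖ * ‖D‖ * ‖D'‖ := fun k hk => by
    refine (abs_real_inner_le_norm _ _).trans ?_
    have h1 := S.le_opNorm (gvec D k)
    have h2 := norm_gvec_le D hk
    have h3 := norm_gvec_le D' hk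
    calc _ ≤ (‖S‖ * ‖gvec D k‖) * ‖gvec D' k‖ := by gcongr
      _ ≤ _ := by gcongr
  have := h 1 (by simp)
  have := h Complex.I (by simp)
  refine (abs_add_le _ _).trans ?_
  linarith

/-- `qform S D` as a continuous linear functional. -/
def qformL {n : ℕ} (S : Euc n →L[ℝ] Euc n) (D : Euc n →L[ℝ] ℂ) : (Euc n →L[ℝ] ℂ) →L[ℝ] ℝ :=
  Complex.reCLM.comp (ContinuousLinearMap.apply ℝ ℂ (S (gvec D 1))) +
    Complex.imCLM.comp (ContinuousLinearMap.apply ℝ ℂ (S (gvec D Complex.I)))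

theorem qformL_apply {n : ℕ} (S : Euc n →L[ℝ] Euc n) (D D' : Euc n →L[ℝ] ℂ) :
    qformL S D D' = qform S D D' := by
  simp [qformL, qform, inner_gvec_one, inner_gvec_I]

theorem continuous_gvec {n : ℕ} (k : ℂ) : Continuous fun D : Euc n →L[ℝ] ℂ => gvec D k :=
  (ContinuousLinearMap.adjoint.continuous).clm_apply continuous_const

theorem continuous_qformL {n : ℕ} :
    Continuous fun p : (Euc n →L[ℝ] Euc n) × (Euc n →L[ℝ] ℂ) => qformL p.1 p.2 := by
  have h : ∀ k : ℂ, Continuous fun p : (Euc n →L[ℝ] Euc n) × (Euc n →L[ℝ] ℂ) =>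
      p.1 (gvec p.2 k) := fun k =>
    continuous_fst.clm_apply ((continuous_gvec k).comp continuous_snd)
  have h1 : Continuous fun p : (Euc n →L[ℝ] Euc n) × (Euc n →L[ℝ] ℂ) =>
      Complex.reCLM.comp (ContinuousLinearMap.apply ℝ ℂ (p.1 (gvec p.2 1))) :=
    continuous_const.clm_comp ((ContinuousLinearMap.apply ℝ ℂ).continuous.comp (h 1))
  have h2 : Continuous fun p : (Euc n →L[ℝ] Euc n) × (Euc n →L[ℝ] ℂ) =>
      Complex.imCLM.comp (ContinuousLinearMap.apply ℝ ℂ (p.1 (gvec p.2 Complex.I))) :=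
    continuous_const.clm_comp ((ContinuousLinearMap.apply ℝ ℂ).continuous.comp (h _))
  exact h1.add h2

theorem continuous_qform_self {n : ℕ} :
    Continuous fun p : (Euc n →L[ℝ] Euc n) × (Euc n →L[ℝ] ℂ) => qform p.1 p.2 p.2 := by
  simp_rw [← qformL_apply]
  exact continuous_qformL.clm_apply continuous_snd

theorem norm_qformL_le {n : ℕ} (S : Euc n →L[ℝ] Euc n) (D : Euc n →L[ℝ] ℂ) :
    ‖qformL S D‖ ≤ 2 * ‖S‖ * ‖D‖ := by
  refine ContinuousLinearMap.opNorm_le_bound _ (by positivity) fun D' => ?_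
  rw [qformL_apply]; exact abs_qform_le _ _ _

theorem qform_add_self {n : ℕ} {S : Euc n →L[ℝ] Euc n} (hS : ∀ p q, ⟪S p, q⟫ = ⟪p, S q⟫)
    (D D' : Euc n →L[ℝ] ℂ) :
    qform S (D + D') (D + D') = qform S D D + 2 * qform S D D' + qform S D' D' := by
  have h : ∀ k, ⟪S (gvec D' k), gvec D k⟫ = ⟪S (gvec D k), gvec D' k⟫ := fun k => by
    rw [hS, real_inner_comm]
  simp only [qform, gvec_add, map_add, inner_add_left, inner_add_right, h]
  ring

/-- Uniformly elliptic Lipschitz coefficients `a`, `w` on the unit ball. -/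
structure Coeffs (n : ℕ) (c K L : ℝ) (a : Euc n → (Euc n →L[ℝ] Euc n)) (w : Euc n → ℝ) :
    Prop where
  c_pos : 0 < c
  K_nonneg : 0 ≤ K
  L_nonneg : 0 ≤ L
  symm : ∀ x ∈ ball (0 : Euc n) 1, ∀ p q, ⟪a x p, q⟫ = ⟪p, a x q⟫
  coer : ∀ x ∈ ball (0 : Euc n) 1, ∀ p, c * ‖p‖ ^ 2 ≤ ⟪a x p, p⟫
  bdd : ∀ x ∈ ball (0 : Euc n) 1, ‖a x‖ ≤ K
  lip : ∀ x ∈ ball (0 : Euc n) 1, ∀ y ∈ ball (0 : Euc n) 1, ‖a x - a y‖ ≤ L * ‖x - y‖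
  w_nonneg : ∀ x ∈ ball (0 : Euc n) 1, 0 ≤ w x
  w_bdd : ∀ x ∈ ball (0 : Euc n) 1, w x ≤ K
  w_lip : ∀ x ∈ ball (0 : Euc n) 1, ∀ y ∈ ball (0 : Euc n) 1, |w x - w y| ≤ L * ‖x - y‖

/-- A finite-energy weak solution of the equation with coefficients `a`, `w`. -/
structure WeakSol (n : ℕ) (ε : ℝ) (a : Euc n → (Euc n →L[ℝ] Euc n)) (w : Euc n → ℝ)
    (u : Euc n → ℂ) : Prop where
  diff : DifferentiableOn ℝ u (ball 0 1)
  le_one : ∀ x ∈ ball (0 : Euc n) 1, ‖u x‖ ≤ 1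
  grad : IntegrableOn (fun x => ‖fderiv ℝ u x‖ ^ 2) (ball 0 1)
  weak : ∀ ζ : Euc n → ℂ, ContDiff ℝ 1 ζ → tsupport ζ ⊆ ball 0 1 →
    ∫ x in ball (0 : Euc n) 1, (qform (a x) (fderiv ℝ u x) (fderiv ℝ ζ x)
      - (1 - ‖u x‖ ^ 2) / ε ^ 2 * w x * ⟪u x, ζ x⟫) = 0

/-- The energy density with coefficients `S`, `ω`, of a jet `(D, z)`. -/
def en {n : ℕ} (ε : ℝ) (S : Euc n →L[ℝ] Euc n) (ω : ℝ) (D : Euc n →L[ℝ] ℂ) (z : ℂ) : ℝ :=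
  qform S D D / 2 + ω * ((1 - ‖z‖ ^ 2) ^ 2 / (4 * ε ^ 2))

section
variable {n : ℕ} {c K L ε : ℝ} {a : Euc n → (Euc n →L[ℝ] Euc n)} {w : Euc n → ℝ} {u v : Euc n → ℂ}

theorem Coeffs.continuousOn_a (ha : Coeffs n c K L a w) : ContinuousOn a (ball 0 1) :=
  (LipschitzOnWith.of_dist_le_mul (K := ⟨L, ha.L_nonneg⟩) fun x hx y hy => by
    rw [dist_eq_norm, dist_eq_norm]; exact ha.lip x hx y hy).continuousOn

theorem Coeffs.continuousOn_w (ha : Coeffs n c K L a w) : ContinuousOn w (ball 0 1) :=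
  (LipschitzOnWith.of_dist_le_mul (K := ⟨L, ha.L_nonneg⟩) fun x hx y hy => by
    rw [dist_eq_norm, dist_eq_norm]; exact ha.w_lip x hx y hy).continuousOn

theorem Coeffs.aesm_a (ha : Coeffs n c K L a w) :
    AEStronglyMeasurable a (volume.restrict (ball 0 1)) :=
  ha.continuousOn_a.aestronglyMeasurable measurableSet_ball

theorem Coeffs.aesm_w (ha : Coeffs n c K L a w) :
    AEStronglyMeasurable w (volume.restrict (ball 0 1)) :=
  ha.continuousOn_w.aestronglyMeasurable measurableSet_ball

theorem Coeffs.qform_nonneg (ha : Coeffs n c K L a w) {x : Euc n} (hx : x ∈ ball (0 : Euc n) 1)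
    (D : Euc n →L[ℝ] ℂ) : c * ‖D‖ ^ 2 ≤ qform (a x) D D := by
  have h1 := ha.coer x hx (gvec D 1)
  have h2 := ha.coer x hx (gvec D Complex.I)
  have h3 := mul_le_mul_of_nonneg_left (norm_sq_le_gvec D) ha.c_pos.le
  unfold qform; linarith

theorem aesm_fderiv {n : ℕ} (v : Euc n → ℂ) (μ : Measure (Euc n)) :
    AEStronglyMeasurable (fderiv ℝ v) μ :=
  (measurable_fderiv ℝ v).aestronglyMeasurable

theorem Coeffs.en_nonneg (ha : Coeffs n c K L a w) {x : Euc n} (hx : x ∈ ball (0 : Euc n) 1)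
    (D : Euc n →L[ℝ] ℂ) (z : ℂ) : 0 ≤ en ε (a x) (w x) D z := by
  have h1 := ha.qform_nonneg hx D
  have h2 := ha.w_nonneg x hx
  have h3 := ha.c_pos
  have : 0 ≤ qform (a x) D D := le_trans (by positivity) h1
  unfold en; positivity

theorem Coeffs.integrableOn_en (ha : Coeffs n c K L a w)
    (hvd : DifferentiableOn ℝ v (ball 0 1)) (hv1 : ∀ x ∈ ball (0 : Euc n) 1, ‖v x‖ ≤ 1)
    (hvg : IntegrableOn (fun x => ‖fderiv ℝ v x‖ ^ 2) (ball 0 1)) :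
    IntegrableOn (fun x => en ε (a x) (w x) (fderiv ℝ v x) (v x)) (ball 0 1) := by
  have hvm : AEStronglyMeasurable v (volume.restrict (ball 0 1)) :=
    hvd.continuousOn.aestronglyMeasurable measurableSet_ball
  have hfin : volume (ball (0 : Euc n) 1) ≠ ⊤ := measure_ball_lt_top.ne
  refine Integrable.add ?_ ?_
  · refine Integrable.mono' (hvg.const_mul K) ?_ ?_
    · have : AEStronglyMeasurable (fun x => (a x, fderiv ℝ v x)) (volume.restrict (ball 0 1)) :=
        ha.aesm_a.prodMk (aesm_fderiv v _)
      have h2 := continuous_qform_self.comp_aestronglyMeasurable this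
      exact h2.mul_const _
    · filter_upwards [ae_restrict_mem measurableSet_ball] with x hx
      have h1 := abs_qform_le (a x) (fderiv ℝ v x) (fderiv ℝ v x)
      have h2 := ha.bdd x hx
      rw [Real.norm_eq_abs, abs_div, abs_two]
      have : 2 * ‖a x‖ * ‖fderiv ℝ v x‖ * ‖fderiv ℝ v x‖ ≤ 2 * (K * ‖fderiv ℝ v x‖ ^ 2) := by
        have := mul_le_mul_of_nonneg_right h2 (sq_nonneg ‖fderiv ℝ v x‖)
        nlinarith
      linarith
  · refine Integrable.mono' (integrableOn_const (C := K * (1 / (4 * ε ^ 2))) hfin) ?_ ?_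
    · refine ha.aesm_w.mul ?_
      have hc : Continuous fun z : ℂ => (1 - ‖z‖ ^ 2) ^ 2 / (4 * ε ^ 2) := by fun_prop
      exact hc.comp_aestronglyMeasurable hvm
    · filter_upwards [ae_restrict_mem measurableSet_ball] with x hx
      have h1 := hv1 x hx
      have h2 := ha.w_bdd x hx
      have h3 := ha.w_nonneg x hx
      have h5 : ‖v x‖ ^ 2 ≤ 1 := by nlinarith [norm_nonneg (v x)]
      have h4 : (1 - ‖v x‖ ^ 2) ^ 2 ≤ 1 := by nlinarith [sq_nonneg ‖v x‖]
      rw [Real.norm_of_nonneg (by positivity)]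
      have := ha.K_nonneg
      gcongr

end

section
variable {n : ℕ} {c K L ε : ℝ} {a : Euc n → (Euc n →L[ℝ] Euc n)} {w : Euc n → ℝ} {u v : Euc n → ℂ}

theorem norm_sub_mul_sq_le {z : ℂ} (hz : ‖z‖ ≤ 1) : 0 ≤ 1 - ‖z‖ ^ 2 ∧ 1 - ‖z‖ ^ 2 ≤ 1 := by
  constructor <;> nlinarith [norm_nonneg z, sq_nonneg ‖z‖]

/-- The functional of the jet of a test map given by the weak equation. -/
def jetFun {n : ℕ} (ε : ℝ) (a : Euc n → (Euc n →L[ℝ] Euc n)) (w : Euc n → ℝ) (u : Euc n → ℂ)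
    (x : Euc n) : ((Euc n →L[ℝ] ℂ) × ℂ) →L[ℝ] ℝ :=
  (qformL (a x) (fderiv ℝ u x)).comp (ContinuousLinearMap.fst ℝ _ _)
    + ((-((1 - ‖u x‖ ^ 2) / ε ^ 2 * w x)) • innerSL ℝ (u x)).comp (ContinuousLinearMap.snd ℝ _ _)

theorem jetFun_apply (x : Euc n) (D : Euc n →L[ℝ] ℂ) (z : ℂ) :
    jetFun ε a w u x (D, z) = qform (a x) (fderiv ℝ u x) D
      - (1 - ‖u x‖ ^ 2) / ε ^ 2 * w x * ⟪u x, z⟫ := by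
  simp [jetFun, qformL_apply, sub_eq_add_neg]

theorem MemLp.clm_jet {α Y Z : Type*} [MeasurableSpace α] {μ : Measure α}
    [NormedAddCommGroup Y] [NormedSpace ℝ Y] [NormedAddCommGroup Z] [NormedSpace ℝ Z]
    {F : α → Y →L[ℝ] ℝ} {G : α → Z →L[ℝ] ℝ} (hF : MemLp F 2 μ) (hG : MemLp G 2 μ) :
    MemLp (fun x => (F x).comp (ContinuousLinearMap.fst ℝ Y Z)
      + (G x).comp (ContinuousLinearMap.snd ℝ Y Z)) 2 μ := by
  have h1 := ((ContinuousLinearMap.compL ℝ (Y × Z) Y ℝ).flip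
    (ContinuousLinearMap.fst ℝ Y Z)).comp_memLp' hF
  have h2 := ((ContinuousLinearMap.compL ℝ (Y × Z) Z ℝ).flip
    (ContinuousLinearMap.snd ℝ Y Z)).comp_memLp' hG
  exact h1.add h2

theorem MemLp.clm_of_bound {α Z : Type*} [MeasurableSpace α] {μ : Measure α}
    [NormedAddCommGroup Z] [NormedSpace ℝ Z] {F : α → Z →L[ℝ] ℝ} {b : α → ℝ}
    (hF : AEStronglyMeasurable F μ) (hb : MemLp b 2 μ) (h : ∀ᵐ x ∂μ, ‖F x‖ ≤ b x) :
    MemLp F 2 μ :=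
  hb.mono hF (h.mono fun _ hx => hx.trans (le_abs_self _))

theorem MemLp.clm_of_restrict_indicator {α Z : Type*} [MeasurableSpace α] {μ : Measure α}
    [NormedAddCommGroup Z] [NormedSpace ℝ Z] {F : α → Z →L[ℝ] ℝ} {s : Set α}
    (hs : MeasurableSet s) (hF : MemLp F 2 (μ.restrict s)) : MemLp (s.indicator F) 2 μ := by
  have h1 : MemLp (s.indicator fun x => ‖F x‖) 2 μ := (memLp_indicator_iff_restrict hs).2 hF.norm
  have h2 : AEStronglyMeasurable (s.indicator F) μ :=
    (aestronglyMeasurable_indicator_iff hs).2 hF.1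
  refine MemLp.clm_of_bound h2 h1 (Eventually.of_forall fun x => ?_)
  by_cases hx : x ∈ s
  · rw [Set.indicator_of_mem hx, Set.indicator_of_mem hx]
  · rw [Set.indicator_of_notMem hx, Set.indicator_of_notMem hx, norm_zero]

theorem MemLp.of_restrict_indicator {α Z : Type*} [MeasurableSpace α] {μ : Measure α}
    [NormedAddCommGroup Z] {F : α → Z} {s : Set α} (hs : MeasurableSet s)
    (hF : MemLp F 2 (μ.restrict s)) : MemLp (s.indicator F) 2 μ :=
  (memLp_indicator_iff_restrict hs).2 hF

theorem integral_clm_indicator {α Z : Type*} [MeasurableSpace α] {μ : Measure α}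
    [NormedAddCommGroup Z] [NormedSpace ℝ Z] {F : α → Z →L[ℝ] ℝ} {s : Set α}
    (hs : MeasurableSet s) (k : α → Z) :
    ∫ x, s.indicator F x (k x) ∂μ = ∫ x in s, F x (k x) ∂μ := by
  rw [← integral_indicator hs]
  refine integral_congr_ae (Eventually.of_forall fun x => ?_)
  by_cases hx : x ∈ s <;> simp [hx]

theorem continuous_smul_innerSL :
    Continuous fun p : ℝ × ℂ => p.1 • (innerSL ℝ p.2 : ℂ →L[ℝ] ℝ) := by
  have h : Continuous fun p : ℝ × ℂ => (innerSL ℝ p.2 : ℂ →L[ℝ] ℝ) :=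
    (innerSL ℝ).continuous.comp continuous_snd
  exact continuous_fst.smul h

theorem aesm_smul_innerSL {α : Type*} [MeasurableSpace α] {μ : Measure α} {s : α → ℝ} {z : α → ℂ}
    (hs : AEStronglyMeasurable s μ) (hz : AEStronglyMeasurable z μ) :
    AEStronglyMeasurable (fun x => s x • (innerSL ℝ (z x) : ℂ →L[ℝ] ℝ)) μ :=
  continuous_smul_innerSL.comp_aestronglyMeasurable (hs.prodMk hz)

theorem aesm_qformL {α : Type*} [MeasurableSpace α] {μ : Measure α} {n : ℕ}
    {S : α → Euc n →L[ℝ] Euc n} {D : α → Euc n →L[ℝ] ℂ}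
    (hS : AEStronglyMeasurable S μ) (hD : AEStronglyMeasurable D μ) :
    AEStronglyMeasurable (fun x => qformL (S x) (D x)) μ := by
  have h : AEStronglyMeasurable (fun x => (S x, D x)) μ := hS.prodMk hD
  have h2 := continuous_qformL.comp_aestronglyMeasurable h
  exact h2

theorem WeakSol.memLp_jetFun (ha : Coeffs n c K L a w) (hu : WeakSol n ε a w u) :
    MemLp (jetFun ε a w u) 2 (volume.restrict (ball 0 1)) := by
  have hum : AEStronglyMeasurable u (volume.restrict (ball 0 1)) :=
    hu.diff.continuousOn.aestronglyMeasurable measurableSet_ball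
  have hg2 : MemLp (fun x => ‖fderiv ℝ u x‖) 2 (volume.restrict (ball 0 1)) := by
    rw [memLp_two_iff_integrable_sq (aesm_fderiv u _).norm]
    exact hu.grad
  have : IsFiniteMeasure (volume.restrict (ball (0 : Euc n) 1)) :=
    ⟨by rw [Measure.restrict_apply_univ]; exact measure_ball_lt_top⟩
  have hF : MemLp (fun x => qformL (a x) (fderiv ℝ u x)) 2 (volume.restrict (ball 0 1)) := by
    refine MemLp.clm_of_bound (aesm_qformL ha.aesm_a (aesm_fderiv u _))
      (hg2.const_mul (2 * K)) ?_
    filter_upwards [ae_restrict_mem measurableSet_ball] with x hx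
    have hK := ha.K_nonneg
    have h2 := ha.bdd x hx
    exact (norm_qformL_le (a x) (fderiv ℝ u x)).trans (by gcongr)
  have hG : MemLp (fun x => (-((1 - ‖u x‖ ^ 2) / ε ^ 2 * w x)) • innerSL ℝ (u x)) 2
      (volume.restrict (ball 0 1)) := by
    refine MemLp.clm_of_bound ?_ (memLp_const (K / ε ^ 2)) ?_
    · have hc : Continuous fun z : ℂ => (1 - ‖z‖ ^ 2) / ε ^ 2 := by fun_prop
      exact aesm_smul_innerSL ((hc.comp_aestronglyMeasurable hum).mul ha.aesm_w).neg hum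
    · filter_upwards [ae_restrict_mem measurableSet_ball] with x hx
      have hK := ha.K_nonneg
      obtain ⟨h3, h4⟩ := norm_sub_mul_sq_le (hu.le_one x hx)
      have h5 := ha.w_nonneg x hx
      have h6 := ha.w_bdd x hx
      rw [norm_smul, norm_neg, Real.norm_of_nonneg (by positivity), innerSL_apply_norm]
      calc _ ≤ (1 / ε ^ 2 * K) * 1 := by gcongr; exact hu.le_one x hx
        _ = _ := by ring
  exact MemLp.clm_jet hF hG

theorem WeakSol.weak_rough (ha : Coeffs n c K L a w) (hu : WeakSol n ε a w u)
    {ζ : Euc n → ℂ} (hd : Differentiable ℝ ζ) (hc : HasCompactSupport ζ)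
    (hs : tsupport ζ ⊆ ball 0 1) (h2 : MemLp (fderiv ℝ ζ) 2 volume) :
    ∫ x in ball 0 1, jetFun ε a w u x (fderiv ℝ ζ x, ζ x) = 0 := by
  rw [← integral_clm_indicator measurableSet_ball]
  refine weak_form_extend (MemLp.clm_of_restrict_indicator measurableSet_ball (hu.memLp_jetFun ha))
    isOpen_ball (fun ζ h1 h2 _ => ?_) hd hc hs h2
  rw [integral_clm_indicator measurableSet_ball]
  simp_rw [jetFun_apply]
  exact hu.weak ζ h1 h2

theorem en_sub_ge (hε : 0 < ε) {S : Euc n →L[ℝ] Euc n} (hS : ∀ p q, ⟪S p, q⟫ = ⟪p, S q⟫)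
    (hS0 : ∀ D : Euc n →L[ℝ] ℂ, 0 ≤ qform S D D) {ω : ℝ} (hω : 0 ≤ ω) (hωK : ω ≤ K)
    (D D' : Euc n →L[ℝ] ℂ) {z z' : ℂ} (hz : ‖z‖ ≤ 1) :
    en ε S ω D z + (qform S D (D' - D) - (1 - ‖z‖ ^ 2) / ε ^ 2 * ω * ⟪z, z' - z⟫)
      ≤ en ε S ω D' z' + K / (2 * ε ^ 2) * ‖z' - z‖ ^ 2 := by
  have h1 : qform S D' D' = qform S D D + 2 * qform S D (D' - D) + qform S (D' - D) (D' - D) := by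
    rw [← qform_add_self hS]; simp
  have h2 := hS0 (D' - D)
  have h3 : ‖z'‖ ^ 2 = ‖z‖ ^ 2 + 2 * ⟪z, z' - z⟫ + ‖z' - z‖ ^ 2 := by
    have := norm_add_sq_real z (z' - z)
    simpa using this
  obtain ⟨h4, h5⟩ := norm_sub_mul_sq_le hz
  set s := 1 - ‖z‖ ^ 2 with hs
  set d := ‖z' - z‖ ^ 2 with hd
  set i := ⟪z, z' - z⟫ with hi
  have hd0 : 0 ≤ d := sq_nonneg _
  have h6 : 1 - ‖z'‖ ^ 2 = s - 2 * i - d := by rw [h3]; ring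
  unfold en
  rw [h6, ← hs, h1]
  have h7 : ω * ((s - 2 * i - d) ^ 2 / (4 * ε ^ 2)) + K / (2 * ε ^ 2) * d
      - ω * (s ^ 2 / (4 * ε ^ 2)) + s / ε ^ 2 * ω * i
      = (ω * (2 * i + d) ^ 2 + 2 * (K - ω * s) * d) / (4 * ε ^ 2) := by
    field_simp; ring
  have h8 : 0 ≤ (ω * (2 * i + d) ^ 2 + 2 * (K - ω * s) * d) / (4 * ε ^ 2) := by
    have : 0 ≤ K - ω * s := by nlinarith
    positivity
  linarith

/-- Solutions minimise the energy up to a quadratic error. -/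
theorem WeakSol.energy_le (hε : 0 < ε) (ha : Coeffs n c K L a w) (hu : WeakSol n ε a w u)
    (hvd : DifferentiableOn ℝ v (ball 0 1)) (hv1 : ∀ x ∈ ball (0 : Euc n) 1, ‖v x‖ ≤ 1)
    (hvg : IntegrableOn (fun x => ‖fderiv ℝ v x‖ ^ 2) (ball 0 1))
    {Ω : Set (Euc n)} (hΩ : IsCompact Ω) (hΩB : Ω ⊆ ball 0 1) (huv : ∀ x ∉ Ω, v x = u x) :
    ∫ x in ball 0 1, en ε (a x) (w x) (fderiv ℝ u x) (u x)
      ≤ (∫ x in ball 0 1, en ε (a x) (w x) (fderiv ℝ v x) (v x))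
        + K / (2 * ε ^ 2) * ∫ x in ball 0 1, ‖v x - u x‖ ^ 2 := by
  set ζ : Euc n → ℂ := fun x => v x - u x with hζ
  have hts : tsupport ζ ⊆ Ω := by
    refine closure_minimal (fun x hx => ?_) hΩ.isClosed
    by_contra h
    exact hx (by simp [hζ, huv x h])
  have hc : HasCompactSupport ζ := hΩ.of_isClosed_subset (isClosed_tsupport _) hts
  have hdB : ∀ x ∈ ball (0 : Euc n) 1, DifferentiableAt ℝ u x ∧ DifferentiableAt ℝ v x :=
    fun x hx => ⟨hu.diff.differentiableAt (isOpen_ball.mem_nhds hx),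
      hvd.differentiableAt (isOpen_ball.mem_nhds hx)⟩
  have hd : Differentiable ℝ ζ := by
    intro x
    by_cases hx : x ∈ ball (0 : Euc n) 1
    · exact (hdB x hx).2.sub (hdB x hx).1
    · have h0 : x ∉ tsupport ζ := fun h => hx (hΩB (hts h))
      exact (differentiableAt_const (0 : ℂ)).congr_of_eventuallyEq
        (notMem_tsupport_iff_eventuallyEq.1 h0)
  have hfd : ∀ x ∈ ball (0 : Euc n) 1, fderiv ℝ ζ x = fderiv ℝ v x - fderiv ℝ u x :=
    fun x hx => fderiv_sub (hdB x hx).2 (hdB x hx).1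
  have hL : ∀ {f : Euc n → ℂ}, IntegrableOn (fun x => ‖fderiv ℝ f x‖ ^ 2) (ball 0 1) →
      MemLp (fderiv ℝ f) 2 (volume.restrict (ball 0 1)) := fun {f} hf => by
    rw [← memLp_norm_iff (aesm_fderiv f _), memLp_two_iff_integrable_sq (aesm_fderiv f _).norm]
    exact hf
  have h2B : MemLp (fderiv ℝ ζ) 2 (volume.restrict (ball 0 1)) := by
    refine ((hL hvg).sub (hL hu.grad)).ae_eq ?_
    filter_upwards [ae_restrict_mem measurableSet_ball] with x hx
    rw [hfd x hx]; rfl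
  have h2 : MemLp (fderiv ℝ ζ) 2 volume := by
    have h3 := MemLp.of_restrict_indicator measurableSet_ball h2B
    rwa [Set.indicator_eq_self.2 ((support_fderiv_subset ℝ).trans (hts.trans hΩB))] at h3
  have h0 := hu.weak_rough ha hd hc (hts.trans hΩB) h2
  have iu := ha.integrableOn_en (ε := ε) hu.diff hu.le_one hu.grad
  have iv := ha.integrableOn_en (ε := ε) hvd hv1 hvg
  have iz : IntegrableOn (fun x => ‖v x - u x‖ ^ 2) (ball 0 1) := by
    have : Continuous fun x => ‖ζ x‖ ^ 2 := by have := hd.continuous; fun_prop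
    refine (this.integrable_of_hasCompactSupport ?_).integrableOn
    exact hc.norm.comp_left (g := fun t : ℝ => t ^ 2) (by simp)
  have ij : IntegrableOn (fun x => jetFun ε a w u x (fderiv ℝ ζ x, ζ x)) (ball 0 1) := by
    refine MemLp.integrable_clm_apply (hu.memLp_jetFun ha) ?_
    exact MemLp.of_fst_snd ⟨h2.restrict _,
      (hd.continuous.memLp_of_hasCompactSupport hc).restrict _⟩
  have e1 : ∫ x in ball 0 1, en ε (a x) (w x) (fderiv ℝ u x) (u x)
      = ∫ x in ball 0 1, (en ε (a x) (w x) (fderiv ℝ u x) (u x)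
        + jetFun ε a w u x (fderiv ℝ ζ x, ζ x)) := by
    rw [integral_add iu ij, h0, add_zero]
  rw [e1, ← integral_const_mul, ← integral_add iv (iz.const_mul _)]
  refine setIntegral_mono_on (iu.add ij) (iv.add (iz.const_mul _)) measurableSet_ball
    fun x hx => ?_
  simp only [jetFun_apply, hfd x hx]
  exact en_sub_ge hε (ha.symm x hx) (fun D => le_trans
    (mul_nonneg ha.c_pos.le (sq_nonneg _)) (ha.qform_nonneg hx D))
    (ha.w_nonneg x hx) (ha.w_bdd x hx) _ _ (hu.le_one x hx)

end

theorem contDiff_clm_det (n : ℕ) :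
    ContDiff ℝ 1 fun f : Euc n →L[ℝ] Euc n => f.det := by
  have h : (fun f : Euc n →L[ℝ] Euc n => f.det) = fun f =>
      ∑ σ : Equiv.Perm (Fin n), Equiv.Perm.sign σ •
        ∏ i, (f (EuclideanSpace.single i 1)) (σ i) := by
    funext f
    rw [ContinuousLinearMap.det, ← LinearMap.det_toMatrix (EuclideanSpace.basisFun (Fin n) ℝ).toBasis,
      Matrix.det_apply]
    refine Finset.sum_congr rfl fun σ _ => ?_
    simp [LinearMap.toMatrix_apply]
  rw [h]
  refine ContDiff.sum fun σ _ => ?_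
  refine ContDiff.const_smul _ (contDiff_prod fun i _ => ?_)
  exact ((EuclideanSpace.proj (𝕜 := ℝ) (σ i)).contDiff).comp
    ((ContinuousLinearMap.apply ℝ (Euc n) (EuclideanSpace.single i (1 : ℝ))).contDiff)

/-- The trace of an endomorphism of Euclidean space. -/
def tr {n : ℕ} (f : Euc n →L[ℝ] Euc n) : ℝ := LinearMap.trace ℝ _ (f : Euc n →ₗ[ℝ] Euc n)

theorem tr_eq_sum {n : ℕ} (f : Euc n →L[ℝ] Euc n) :
    tr f = ∑ i, (f (EuclideanSpace.single i 1)) i := by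
  rw [tr, LinearMap.trace_eq_matrix_trace ℝ (EuclideanSpace.basisFun (Fin n) ℝ).toBasis]
  simp [Matrix.trace, LinearMap.toMatrix_apply]

theorem tr_sub {n : ℕ} (f g : Euc n →L[ℝ] Euc n) : tr (f - g) = tr f - tr g := by
  simp [tr_eq_sum, Finset.sum_sub_distrib]

theorem abs_tr_le {n : ℕ} (f : Euc n →L[ℝ] Euc n) : |tr f| ≤ n * ‖f‖ := by
  rw [tr_eq_sum]
  refine (Finset.abs_sum_le_sum_abs _ _).trans ?_
  refine (Finset.sum_le_sum (g := fun _ => ‖f‖) fun i _ => ?_).trans (by simp)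
  have h1 := PiLp.norm_apply_le (f (EuclideanSpace.single i 1)) i
  have h2 := f.le_opNorm (EuclideanSpace.single i 1)
  simp at h1 h2
  exact h1.trans h2

theorem hasFDerivAt_clm_det (n : ℕ) : ∃ F : (Euc n →L[ℝ] Euc n) →L[ℝ] ℝ, (∀ H, F H = tr H) ∧
    HasFDerivAt (fun f : Euc n →L[ℝ] Euc n => f.det) F 1 := by
  have h := ((contDiff_clm_det n).differentiable one_ne_zero (1 : Euc n →L[ℝ] Euc n)).hasFDerivAt
  refine ⟨_, fun H => ?_, h⟩
  have h1 : HasDerivAt (fun t : ℝ => (1 : Euc n →L[ℝ] Euc n) + t • H) H 0 := by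
    simpa using ((hasDerivAt_id (0 : ℝ)).smul_const H).const_add 1
  have h2 : HasDerivAt (fun t : ℝ => ((1 : Euc n →L[ℝ] Euc n) + t • H).det)
      (fderiv ℝ (fun f : Euc n →L[ℝ] Euc n => f.det) 1 H) 0 := by
    have h' : HasFDerivAt (fun f : Euc n →L[ℝ] Euc n => f.det)
      (fderiv ℝ (fun f : Euc n →L[ℝ] Euc n => f.det) 1)
      ((1 : Euc n →L[ℝ] Euc n) + (0 : ℝ) • H) := by
      have e : (1 : Euc n →L[ℝ] Euc n) + (0 : ℝ) • H = 1 := by ext1 z; simp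
      have h0 : ∀ y : Euc n →L[ℝ] Euc n, y = 1 → HasFDerivAt (fun f : Euc n →L[ℝ] Euc n => f.det)
          (fderiv ℝ (fun f : Euc n →L[ℝ] Euc n => f.det) 1) y := by rintro _ rfl; exact h
      exact h0 _ e
    exact h'.comp_hasDerivAt (0 : ℝ) h1
  set b := (EuclideanSpace.basisFun (Fin n) ℝ).toBasis
  set A := LinearMap.toMatrix b b (H : Euc n →ₗ[ℝ] Euc n)
  have h3 : ∀ t : ℝ, ((1 : Euc n →L[ℝ] Euc n) + t • H).det = (1 + t • A).det := fun t => by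
    rw [ContinuousLinearMap.det, ← LinearMap.det_toMatrix b]
    congr 1
    have : (((1 : Euc n →L[ℝ] Euc n) + t • H : Euc n →L[ℝ] Euc n) : Euc n →ₗ[ℝ] Euc n)
      = LinearMap.id + t • (H : Euc n →ₗ[ℝ] Euc n) := rfl
    rw [this, map_add, map_smul, LinearMap.toMatrix_id]
  have h4 : (fun t : ℝ => ((1 : Euc n →L[ℝ] Euc n) + t • H).det) =
      fun t => 1 + A.trace * t +
        ((1 + (Polynomial.X : Polynomial ℝ) • A.map Polynomial.C).det.divX.divX).eval t * t ^ 2 := by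
    funext t
    rw [h3, Matrix.det_one_add_smul]
  rw [h4] at h2
  set p := (1 + (Polynomial.X : Polynomial ℝ) • A.map Polynomial.C).det.divX.divX
  have h5 := ((((hasDerivAt_id (0 : ℝ)).const_mul A.trace).const_add 1)).add
    ((p.hasDerivAt 0).mul (hasDerivAt_pow 2 (0 : ℝ)))
  have h6 := h2.unique h5
  rw [h6, tr, LinearMap.trace_eq_matrix_trace ℝ b]
  simp [A]

theorem det_scalar_aux {t k m η d τ τ' : ℝ} (ht : 0 < t) (e2 : t ≤ 1)
    (e3 : t * (2 * (k + m)) ≤ 1)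
    (e4 : t * (2 * (((k + m) + k + η) * (k + m) + k + (k + m) + 1)) ≤ η)
    (hm : 0 ≤ m) (hm4 : m ≤ η / 4) (hk : 0 ≤ k) (hη : 0 < η)
    (h1 : -(t * m) ≤ d - 1 - t * τ) (h2 : d - 1 - t * τ ≤ t * m) (h3 : -k ≤ τ) (h4 : τ ≤ k)
    (h5 : -(k * t) ≤ τ' - τ) (h6 : τ' - τ ≤ k * t) :
    1 / 2 ≤ d ∧ 1 ≤ d * (1 - t * τ' + t * η) := by
  obtain ⟨α, rfl⟩ : ∃ α, d = 1 + t * α := ⟨(d - 1) / t, by field_simp; ring⟩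
  have a1 : τ - m ≤ α := by
    have : t * (τ - m) ≤ t * α := by linarith
    exact le_of_mul_le_mul_left this ht
  have a2 : α ≤ τ + m := by
    have : t * α ≤ t * (τ + m) := by linarith
    exact le_of_mul_le_mul_left this ht
  set T := k + m with hT
  have hT0 : 0 ≤ T := by positivity
  have a3 : |α| ≤ T := abs_le.2 ⟨by linarith, by linarith⟩
  have a4 : t * |α| ≤ t * T := mul_le_mul_of_nonneg_left a3 ht.le
  have a5 : -(t * T) ≤ t * α := by
    have := mul_le_mul_of_nonneg_left (abs_le.1 a3).1 ht.le
    linarith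
  refine ⟨by linarith, ?_⟩
  obtain ⟨β, hβ⟩ : ∃ β, β = -τ' + η := ⟨_, rfl⟩
  have hkt : k * t ≤ k := mul_le_of_le_one_right hk e2
  have hβ1 : |β| ≤ T + k + η := abs_le.2 ⟨by linarith, by linarith⟩
  have hab : |α * β| ≤ T * (T + k + η) := by rw [abs_mul]; gcongr
  have hab' : -(t * (T * (T + k + η))) ≤ t * (α * β) := by
    have := mul_le_mul_of_nonneg_left (abs_le.1 hab).1 ht.le
    linarith
  have hsum : 0 ≤ α + β + t * (α * β) := by
    have h7 : η - m - k * t ≤ α + β := by linarith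
    have h8 : 0 ≤ t * (T + 1) := by positivity
    have h9 : t * (2 * ((T + k + η) * T + k + T + 1))
      = 2 * (t * (T * (T + k + η))) + 2 * (k * t) + 2 * (t * (T + 1)) := by ring
    linarith
  have h10 : (1 + t * α) * (1 - t * τ' + t * η) = 1 + t * (α + β + t * (α * β)) := by
    rw [hβ]; ring
  rw [h10]
  have := mul_nonneg ht.le hsum
  linarith

/-- Quantitative first-order expansion of the determinant near the identity. -/
theorem det_one_add_lower (n : ℕ) {K η : ℝ} (hK : 0 ≤ K) (hη : 0 < η) :
    ∃ t₀ > 0, ∀ t, 0 < t → t ≤ t₀ → ∀ M M' : Euc n →L[ℝ] Euc n, ‖M‖ ≤ K → ‖M' - M‖ ≤ K * t →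
      1 / 2 ≤ (1 + t • M).det ∧ 1 ≤ (1 + t • M).det * (1 - t * tr M' + t * η) := by
  obtain ⟨F, hF, hd⟩ := hasFDerivAt_clm_det n
  set κ := min 1 (η / 4) / (K + 1) with hκ
  have hm : 0 < min 1 (η / 4) := lt_min one_pos (by positivity)
  have hκ0 : 0 < κ := by positivity
  have hl := hd.isLittleO.def hκ0
  rw [Metric.eventually_nhds_iff] at hl
  obtain ⟨δ, hδ, hl⟩ := hl
  set T := n * K + min 1 (η / 4) with hT
  have hT0 : 0 < T := by positivity
  set Q := (T + n * K + η) * T + n * K + T with hQ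
  have hQ0 : 0 < Q := by positivity
  refine ⟨min (δ / (2 * (K + 1))) (min (min 1 (1 / (2 * T))) (η / (2 * (Q + 1)))), by positivity, ?_⟩
  intro t ht htt M M' hM hM'
  have e1 : t ≤ δ / (2 * (K + 1)) := htt.trans (min_le_left _ _)
  have e2 : t ≤ 1 := htt.trans ((min_le_right _ _).trans ((min_le_left _ _).trans (min_le_left _ _)))
  have e3 : t ≤ 1 / (2 * T) :=
    htt.trans ((min_le_right _ _).trans ((min_le_left _ _).trans (min_le_right _ _)))
  have e4 : t ≤ η / (2 * (Q + 1)) := htt.trans ((min_le_right _ _).trans (min_le_right _ _))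
  rw [le_div_iff₀ (by positivity)] at e1 e3 e4
  have hn : ‖t • M‖ ≤ t * K := by
    rw [norm_smul, Real.norm_of_nonneg ht.le]; gcongr
  have h1 := hl (y := 1 + t • M) (by
    rw [dist_eq_norm, add_sub_cancel_left]
    nlinarith)
  simp only [add_sub_cancel_left] at h1
  have hdet1 : (1 : Euc n →L[ℝ] Euc n).det = 1 := by
    simp [ContinuousLinearMap.det]
  rw [hdet1, map_smul, hF, Real.norm_eq_abs, smul_eq_mul] at h1
  have h2 : κ * ‖t • M‖ ≤ t * min 1 (η / 4) := by
    calc κ * ‖t • M‖ ≤ κ * (t * (K + 1)) := by gcongr; nlinarith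
      _ = t * min 1 (η / 4) := by rw [hκ]; field_simp
  have h3 := abs_le.1 (h1.trans h2)
  have hτ : |tr M| ≤ n * K := (abs_tr_le M).trans (by gcongr)
  have hτ' : |tr M' - tr M| ≤ n * K * t := by
    rw [← tr_sub]; exact (abs_tr_le _).trans (by rw [mul_assoc]; gcongr)
  have h5 := abs_le.1 hτ
  have h6 := abs_le.1 hτ'
  have hm4 : min 1 (η / 4) ≤ η / 4 := min_le_right _ _
  exact det_scalar_aux ht e2 e3 e4 hm.le (min_le_right _ _) (by positivity) hη h3.1 h3.2 h5.1 h5.2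
    h6.1 h6.2

theorem enorm_sub_le_lintegral_of_hasDerivAt {f f' : ℝ → ℂ} {t : ℝ} (ht : 0 ≤ t)
    (hd : ∀ s ∈ Set.Icc 0 t, HasDerivAt f (f' s) s)
    (hm : AEStronglyMeasurable f' (volume.restrict (Set.Ioc 0 t))) :
    ‖f t - f 0‖ₑ ≤ ∫⁻ s in Set.Ioc 0 t, ‖f' s‖ₑ := by
  by_cases h : ∫⁻ s in Set.Ioc 0 t, ‖f' s‖ₑ = ⊤
  · rw [h]; exact le_top
  · have hi : IntegrableOn f' (Set.Ioc 0 t) := ⟨hm, lt_top_iff_ne_top.2 h⟩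
    have hi' : IntervalIntegrable f' volume 0 t :=
      (intervalIntegrable_iff_integrableOn_Ioc_of_le ht).2 hi
    rw [← intervalIntegral.integral_eq_sub_of_hasDerivAt
      (fun s hs => hd s (by rwa [Set.uIcc_of_le ht] at hs)) hi',
      intervalIntegral.integral_of_le ht]
    exact enorm_integral_le_lintegral_enorm _

theorem sq_lintegral_le {α : Type*} [MeasurableSpace α] (μ : Measure α) {f : α → ℝ≥0∞}
    (hf : AEMeasurable f μ) : (∫⁻ x, f x ∂μ) ^ 2 ≤ μ Set.univ * ∫⁻ x, f x ^ 2 ∂μ := by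
  have h := ENNReal.lintegral_mul_le_Lp_mul_Lq μ Real.HolderConjugate.two_two
    (f := fun _ => 1) (g := f) aemeasurable_const hf
  simp only [Pi.mul_apply, one_mul, ENNReal.one_rpow, lintegral_one] at h
  calc (∫⁻ x, f x ∂μ) ^ 2
      ≤ (μ Set.univ ^ (1 / 2 : ℝ) * (∫⁻ x, f x ^ (2 : ℝ) ∂μ) ^ (1 / 2 : ℝ)) ^ 2 := by gcongr
    _ = _ := by
      rw [mul_pow, ← ENNReal.rpow_natCast, ← ENNReal.rpow_natCast, ← ENNReal.rpow_mul,
        ← ENNReal.rpow_mul]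
      norm_num

/-- A compactly supported vector field in the unit ball with bounded Lipschitz derivative. -/
structure Fld (n : ℕ) (K : ℝ) (X : Euc n → Euc n) (Ω : Set (Euc n)) : Prop where
  one_le : 1 ≤ K
  diff : Differentiable ℝ X
  bdd : ∀ x, ‖X x‖ ≤ K
  dbdd : ∀ x, ‖fderiv ℝ X x‖ ≤ K
  dlip : ∀ x y, ‖fderiv ℝ X x - fderiv ℝ X y‖ ≤ K * ‖x - y‖
  cpt : IsCompact Ω
  sub : Ω ⊆ ball 0 1
  zero : ∀ x ∉ Ω, X x = 0

section
variable {n : ℕ} {K t : ℝ} {X : Euc n → Euc n} {Ω : Set (Euc n)} {u : Euc n → ℂ}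

theorem Fld.lip (h : Fld n K X Ω) (x y : Euc n) : ‖X x - X y‖ ≤ K * ‖x - y‖ :=
  convex_univ.norm_image_sub_le_of_norm_fderiv_le (𝕜 := ℝ) (fun z _ => h.diff z)
    (fun z _ => h.dbdd z) (Set.mem_univ y) (Set.mem_univ x)

theorem Fld.hasFDerivAt (h : Fld n K X Ω) (t : ℝ) (x : Euc n) :
    HasFDerivAt (fun x => x + t • X x) (1 + t • fderiv ℝ X x) x :=
  (hasFDerivAt_id x).add ((h.diff x).hasFDerivAt.const_smul t)

theorem Fld.bijective (h : Fld n K X Ω) (ht : 0 ≤ t) (htK : t * K < 1) :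
    Function.Bijective fun x => x + t • X x := by
  have hK := h.one_le
  have ha : ApproximatesLinearOn (fun x => x + t • X x)
      ((ContinuousLinearEquiv.refl ℝ (Euc n) : Euc n ≃L[ℝ] Euc n) : Euc n →L[ℝ] Euc n)
      Set.univ (t * K).toNNReal := by
    intro x _ y _
    have e : x + t • X x - (y + t • X y) - (x - y) = t • (X x - X y) := by
      rw [smul_sub]; abel
    simp only [ContinuousLinearEquiv.coe_coe, ContinuousLinearEquiv.coe_refl', id]
    rw [e, norm_smul, Real.norm_of_nonneg ht,
      Real.coe_toNNReal _ (by positivity), mul_assoc]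
    exact mul_le_mul_of_nonneg_left (h.lip x y) ht
  have hc : Subsingleton (Euc n) ∨ (t * K).toNNReal <
      ‖((ContinuousLinearEquiv.refl ℝ (Euc n)).symm : Euc n →L[ℝ] Euc n)‖₊⁻¹ := by
    rcases subsingleton_or_nontrivial (Euc n) with h' | h'
    · exact Or.inl h'
    · right
      have : ‖((ContinuousLinearEquiv.refl ℝ (Euc n)).symm : Euc n →L[ℝ] Euc n)‖₊ = 1 := by
        rw [← NNReal.coe_inj, coe_nnnorm, ContinuousLinearEquiv.refl_symm,
          ContinuousLinearEquiv.coe_refl]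
        exact ContinuousLinearMap.norm_id
      rw [this, inv_one]
      exact Real.toNNReal_lt_one.2 htK
  exact ⟨Set.injOn_univ.1 (ha.injOn hc), ha.surjective hc⟩

theorem Fld.mem_ball (h : Fld n K X Ω) (ht : 0 ≤ t) (htK : t * K < 1) {x : Euc n} :
    x + t • X x ∈ ball (0 : Euc n) 1 ↔ x ∈ ball (0 : Euc n) 1 := by
  have h0 : ∀ {y}, y ∉ ball (0 : Euc n) 1 → y + t • X y = y := fun {y} hy => by
    rw [h.zero y fun h' => hy (h.sub h'), smul_zero, add_zero]
  constructor
  · intro h1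
    by_contra h2
    rw [h0 h2] at h1
    exact h2 h1
  · intro h1
    by_contra h2
    have h3 : x + t • X x = x := (h.bijective ht htK).1 (h0 h2)
    rw [h3] at h2
    exact h2 h1

theorem Fld.image_ball (h : Fld n K X Ω) (ht : 0 ≤ t) (htK : t * K < 1) :
    (fun x => x + t • X x) '' ball (0 : Euc n) 1 = ball 0 1 := by
  ext y
  constructor
  · rintro ⟨x, hx, rfl⟩
    exact (h.mem_ball ht htK).2 hx
  · intro hy
    obtain ⟨x, rfl⟩ := (h.bijective ht htK).2 y
    exact ⟨x, (h.mem_ball ht htK).1 hy, rfl⟩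

theorem Fld.lintegral_comp (h : Fld n K X Ω) (ht : 0 ≤ t) (htK : t * K < 1) (g : Euc n → ℝ≥0∞) :
    ∫⁻ x in ball 0 1, ENNReal.ofReal |(1 + t • fderiv ℝ X x).det| * g (x + t • X x)
      = ∫⁻ x in ball 0 1, g x := by
  have := lintegral_image_eq_lintegral_abs_det_fderiv_mul volume
    (measurableSet_ball (x := (0 : Euc n)) (ε := 1))
    (fun x _ => (h.hasFDerivAt t x).hasFDerivWithinAt) (h.bijective ht htK).1.injOn g
  rw [h.image_ball ht htK] at this
  exact this.symm

theorem Fld.integral_comp (h : Fld n K X Ω) (ht : 0 ≤ t) (htK : t * K < 1) (g : Euc n → ℝ) :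
    ∫ x in ball 0 1, |(1 + t • fderiv ℝ X x).det| * g (x + t • X x)
      = ∫ x in ball 0 1, g x := by
  have := integral_image_eq_integral_abs_det_fderiv_smul volume
    (measurableSet_ball (x := (0 : Euc n)) (ε := 1))
    (fun x _ => (h.hasFDerivAt t x).hasFDerivWithinAt) (h.bijective ht htK).1.injOn g
  rw [h.image_ball ht htK] at this
  exact this.symm

theorem Fld.integrableOn_comp (h : Fld n K X Ω) (ht : 0 ≤ t) (htK : t * K < 1) {g : Euc n → ℝ}
    (hg : IntegrableOn g (ball 0 1)) :
    IntegrableOn (fun x => |(1 + t • fderiv ℝ X x).det| * g (x + t • X x)) (ball 0 1) := by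
  have := (integrableOn_image_iff_integrableOn_abs_det_fderiv_smul volume
    (measurableSet_ball (x := (0 : Euc n)) (ε := 1))
    (fun x _ => (h.hasFDerivAt t x).hasFDerivWithinAt) (h.bijective ht htK).1.injOn g).1
  rw [h.image_ball ht htK] at this
  exact this hg

/-- The displacement of a `W^{1,2}` map along a short flow is of linear order in `L²`. -/
theorem Fld.lintegral_disp_le (h : Fld n K X Ω) (ht : 0 < t) (htK : t * K < 1)
    (hdet : ∀ s, 0 < s → s ≤ t → ∀ x, 1 / 2 ≤ (1 + s • fderiv ℝ X x).det)
    (hu : DifferentiableOn ℝ u (ball 0 1)) :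
    ∫⁻ x in ball 0 1, ‖u (x + t • X x) - u x‖ₑ ^ 2
      ≤ ENNReal.ofReal (2 * K ^ 2 * t ^ 2) * ∫⁻ x in ball 0 1, ‖fderiv ℝ u x‖ₑ ^ 2 := by
  have hK := h.one_le
  have hsK : ∀ s, s ≤ t → s * K < 1 := fun s hs =>
    (mul_le_mul_of_nonneg_right hs (by linarith)).trans_lt htK
  have hmeas : Measurable fun p : Euc n × ℝ => ‖fderiv ℝ u (p.1 + p.2 • X p.1)‖ₑ ^ 2 := by
    have hX := h.diff.continuous
    have hc : Continuous fun p : Euc n × ℝ => p.1 + p.2 • X p.1 := by fun_prop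
    exact ((measurable_fderiv ℝ u).comp hc.measurable).enorm.pow_const 2
  have hpt : ∀ x ∈ ball (0 : Euc n) 1, ‖u (x + t • X x) - u x‖ₑ ^ 2 ≤
      ENNReal.ofReal (K ^ 2 * t) * ∫⁻ s in Set.Ioc 0 t, ‖fderiv ℝ u (x + s • X x)‖ₑ ^ 2 := by
    intro x hx
    have hc : Continuous fun s : ℝ => x + s • X x := by fun_prop
    have hms : Measurable fun s : ℝ => fderiv ℝ u (x + s • X x) :=
      (measurable_fderiv ℝ u).comp hc.measurable
    have h1 := enorm_sub_le_lintegral_of_hasDerivAt (f := fun s => u (x + s • X x))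
      (f' := fun s => fderiv ℝ u (x + s • X x) (X x)) ht.le (fun s hs => by
        have hd := (hu.differentiableAt (isOpen_ball.mem_nhds
          ((h.mem_ball hs.1 (hsK s hs.2)).2 hx))).hasFDerivAt
        have hl : HasDerivAt (fun s : ℝ => x + s • X x) (X x) s := by
          simpa using ((hasDerivAt_id s).smul_const (X x)).const_add x
        exact hd.comp_hasDerivAt s hl)
      (((ContinuousLinearMap.apply ℝ ℂ (X x)).measurable.comp hms).aestronglyMeasurable)
    simp only [zero_smul, add_zero] at h1
    calc ‖u (x + t • X x) - u x‖ₑ ^ 2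
        ≤ (∫⁻ s in Set.Ioc 0 t, ‖fderiv ℝ u (x + s • X x) (X x)‖ₑ) ^ 2 := by gcongr
      _ ≤ (∫⁻ s in Set.Ioc 0 t, ENNReal.ofReal K * ‖fderiv ℝ u (x + s • X x)‖ₑ) ^ 2 := by
          gcongr with s
          calc _ ≤ ‖fderiv ℝ u (x + s • X x)‖ₑ * ‖X x‖ₑ := ContinuousLinearMap.le_opENorm _ _
            _ ≤ ‖fderiv ℝ u (x + s • X x)‖ₑ * ENNReal.ofReal K := by
              gcongr
              rw [← ofReal_norm]
              exact ENNReal.ofReal_le_ofReal (h.bdd x)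
            _ = _ := mul_comm _ _
      _ = ENNReal.ofReal (K ^ 2) * (∫⁻ s in Set.Ioc 0 t, ‖fderiv ℝ u (x + s • X x)‖ₑ) ^ 2 := by
          rw [lintegral_const_mul _ hms.enorm, mul_pow, ENNReal.ofReal_pow (by linarith)]
      _ ≤ ENNReal.ofReal (K ^ 2) * (ENNReal.ofReal t *
            ∫⁻ s in Set.Ioc 0 t, ‖fderiv ℝ u (x + s • X x)‖ₑ ^ 2) := by
          gcongr
          have := sq_lintegral_le (volume.restrict (Set.Ioc 0 t)) hms.enorm.aemeasurable
          simpa using this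
      _ = _ := by rw [← mul_assoc, ← ENNReal.ofReal_mul (by positivity)]
  have hin : ∀ s ∈ Set.Ioc 0 t, ∫⁻ x in ball 0 1, ‖fderiv ℝ u (x + s • X x)‖ₑ ^ 2
      ≤ 2 * ∫⁻ x in ball 0 1, ‖fderiv ℝ u x‖ₑ ^ 2 := by
    intro s hs
    rw [← h.lintegral_comp hs.1.le (hsK s hs.2) (fun x => ‖fderiv ℝ u x‖ₑ ^ 2),
      ← lintegral_const_mul' _ _ (by simp)]
    refine lintegral_mono fun x => ?_
    have h1 : (1 : ℝ≥0∞) ≤ 2 * ENNReal.ofReal |(1 + s • fderiv ℝ X x).det| := by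
      have := hdet s hs.1 hs.2 x
      rw [abs_of_nonneg (by linarith)]
      calc (1 : ℝ≥0∞) = ENNReal.ofReal 2 * ENNReal.ofReal (1 / 2) := by
            rw [← ENNReal.ofReal_mul (by norm_num)]; norm_num
        _ ≤ 2 * ENNReal.ofReal (1 + s • fderiv ℝ X x).det := by
            rw [ENNReal.ofReal_ofNat]
            gcongr
    calc _ = 1 * ‖fderiv ℝ u (x + s • X x)‖ₑ ^ 2 := (one_mul _).symm
      _ ≤ _ := by rw [← mul_assoc]; gcongr
  calc ∫⁻ x in ball 0 1, ‖u (x + t • X x) - u x‖ₑ ^ 2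
      ≤ ∫⁻ x in ball 0 1, ENNReal.ofReal (K ^ 2 * t) *
          ∫⁻ s in Set.Ioc 0 t, ‖fderiv ℝ u (x + s • X x)‖ₑ ^ 2 :=
        setLIntegral_mono' measurableSet_ball hpt
    _ = ENNReal.ofReal (K ^ 2 * t) * ∫⁻ s in Set.Ioc 0 t,
          ∫⁻ x in ball 0 1, ‖fderiv ℝ u (x + s • X x)‖ₑ ^ 2 := by
        rw [lintegral_const_mul' _ _ (by simp)]
        congr 1
        exact lintegral_lintegral_swap hmeas.aemeasurable
    _ ≤ ENNReal.ofReal (K ^ 2 * t) * ∫⁻ s in Set.Ioc 0 t,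
          2 * ∫⁻ x in ball 0 1, ‖fderiv ℝ u x‖ₑ ^ 2 := by
        refine mul_le_mul_right ?_ _
        exact setLIntegral_mono' measurableSet_Ioc hin
    _ = _ := by
        have e : ENNReal.ofReal (2 * K ^ 2 * t ^ 2)
            = ENNReal.ofReal (K ^ 2 * t) * (2 * ENNReal.ofReal t) := by
          rw [← ENNReal.ofReal_ofNat, ← ENNReal.ofReal_mul (by norm_num),
            ← ENNReal.ofReal_mul (by positivity)]
          congr 1
          ring
        rw [setLIntegral_const, Real.volume_Ioc, sub_zero, e]
        ring

theorem Fld.integral_disp_le (h : Fld n K X Ω) (ht : 0 < t) (htK : t * K < 1)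
    (hdet : ∀ s, 0 < s → s ≤ t → ∀ x, 1 / 2 ≤ (1 + s • fderiv ℝ X x).det)
    (hu : DifferentiableOn ℝ u (ball 0 1))
    (hg : IntegrableOn (fun x => ‖fderiv ℝ u x‖ ^ 2) (ball 0 1)) :
    ∫ x in ball 0 1, ‖u (x + t • X x) - u x‖ ^ 2
      ≤ 2 * K ^ 2 * t ^ 2 * ∫ x in ball 0 1, ‖fderiv ℝ u x‖ ^ 2 := by
  have h1 := h.lintegral_disp_le ht htK hdet hu
  have e : ∀ {α F : Type} [NormedAddCommGroup F] (f : α → F), (fun x => ENNReal.ofReal (‖f x‖ ^ 2))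
      = fun x => ‖f x‖ₑ ^ 2 := fun f => by
    funext x
    rw [ENNReal.ofReal_pow (norm_nonneg _), ofReal_norm]
  have h2 : ENNReal.ofReal (∫ x in ball 0 1, ‖fderiv ℝ u x‖ ^ 2)
      = ∫⁻ x in ball 0 1, ‖fderiv ℝ u x‖ₑ ^ 2 := by
    rw [ofReal_integral_eq_lintegral_ofReal hg (Eventually.of_forall fun x => sq_nonneg _), e]
  have hX := h.diff.continuous
  have hm : AEStronglyMeasurable (fun x => ‖u (x + t • X x) - u x‖ ^ 2)
      (volume.restrict (ball 0 1)) := by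
    refine ContinuousOn.aestronglyMeasurable ?_ measurableSet_ball
    have hc : ContinuousOn (fun x : Euc n => x + t • X x) (ball 0 1) := by fun_prop
    exact ((hu.continuousOn.comp hc fun x hx => (h.mem_ball ht.le htK).2 hx).sub
      hu.continuousOn).norm.pow 2
  rw [integral_eq_lintegral_of_nonneg_ae (Eventually.of_forall fun x => sq_nonneg _) hm, e]
  refine ENNReal.toReal_le_of_le_ofReal (by positivity) (h1.trans ?_)
  rw [← h2, ← ENNReal.ofReal_mul (by positivity)]

end

theorem qform_sub_left {n : ℕ} (S S' : Euc n →L[ℝ] Euc n) (D D' : Euc n →L[ℝ] ℂ) :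
    qform (S - S') D D' = qform S D D' - qform S' D D' := by
  simp only [qform, sub_apply, inner_sub_left]; ring

theorem qform_sub_right {n : ℕ} (S : Euc n →L[ℝ] Euc n) (D D' D'' : Euc n →L[ℝ] ℂ) :
    qform S D (D' - D'') = qform S D D' - qform S D D'' := by
  simp only [← qformL_apply, map_sub]

theorem qform_smul_right {n : ℕ} (S : Euc n →L[ℝ] Euc n) (t : ℝ) (D D' : Euc n →L[ℝ] ℂ) :
    qform S D (t • D') = t * qform S D D' := by
  simp only [← qformL_apply, map_smul, smul_eq_mul]

theorem nonneg_of_forall_perturbation {I E Q : ℝ} (hE : 0 ≤ E) (hQ : 0 ≤ Q)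
    (h : ∀ η, 0 < η → η ≤ 1 → ∃ t₀ > 0, ∀ t, 0 < t → t ≤ t₀ →
      0 ≤ t * (I + η * E) + t ^ 2 * Q) : 0 ≤ I := by
  by_contra hI
  push Not at hI
  obtain ⟨t₀, ht₀, h⟩ := h (min 1 (-I / (4 * (E + 1))))
    (lt_min one_pos (div_pos (by linarith) (by positivity))) (min_le_left _ _)
  have hq : 0 < -I / (4 * (Q + 1)) := div_pos (by linarith) (by positivity)
  have h1 := h (min t₀ (-I / (4 * (Q + 1)))) (lt_min ht₀ hq) (min_le_left _ _)
  have ht : 0 < min t₀ (-I / (4 * (Q + 1))) := lt_min ht₀ hq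
  have e1 := min_le_right 1 (-I / (4 * (E + 1)))
  have e2 := min_le_right t₀ (-I / (4 * (Q + 1)))
  rw [le_div_iff₀ (by positivity)] at e1 e2
  set η := min 1 (-I / (4 * (E + 1)))
  set t := min t₀ (-I / (4 * (Q + 1)))
  have hη : 0 < η := lt_min one_pos (div_pos (by linarith) (by positivity))
  have : t * (I + η * E) + t ^ 2 * Q = t * (I + η * E + t * Q) := by ring
  rw [this] at h1
  have h2 := nonneg_of_mul_nonneg_right h1 ht
  nlinarith

/-- Variation of the energy density under composition with the perturbed identity. -/
theorem en_comp_le {n : ℕ} {κ K L t ε ω ω' r r' : ℝ} {S S' M M' : Euc n →L[ℝ] Euc n}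
    (ht : 0 ≤ t) (hK : 0 ≤ K) (hL : 0 ≤ L)
    (hsym : ∀ p q, ⟪S p, q⟫ = ⟪p, S q⟫) (hS : ‖S‖ ≤ κ) (hS' : ‖S'‖ ≤ κ)
    (hSS : ‖S - S'‖ ≤ L * (t * r)) (hωω : |ω - ω'| ≤ L * (t * r)) (hM : ‖M‖ ≤ K)
    (hMM : ‖M - M'‖ ≤ K ^ 2 * t) (hr : r ≤ K) (hrr : r ≤ r' + K ^ 2 * t)
    (D : Euc n →L[ℝ] ℂ) (z : ℂ) :
    en ε S ω (D.comp (1 + t • M)) z ≤ en ε S' ω' D z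
      + t * (qform S' D (D.comp M') + L * r' * ‖D‖ ^ 2
        + L * r' * ((1 - ‖z‖ ^ 2) ^ 2 / (4 * ε ^ 2)))
      + t ^ 2 * ((3 * L * K ^ 2 + 3 * κ * K ^ 2) * (‖D‖ ^ 2 + (1 - ‖z‖ ^ 2) ^ 2 / (4 * ε ^ 2))) := by
  have hκ : 0 ≤ κ := (norm_nonneg _).trans hS
  set W := (1 - ‖z‖ ^ 2) ^ 2 / (4 * ε ^ 2) with hW
  have hW0 : 0 ≤ W := by positivity
  set d := ‖D‖ with hd
  have hd0 : 0 ≤ d := norm_nonneg D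
  have e0 : D.comp (1 + t • M) = D + t • D.comp M := by
    ext v; simp
  have hDM : ‖D.comp M‖ ≤ d * K :=
    (ContinuousLinearMap.opNorm_comp_le _ _).trans (by gcongr)
  have hDM' : ‖D.comp (M - M')‖ ≤ d * (K ^ 2 * t) :=
    (ContinuousLinearMap.opNorm_comp_le _ _).trans (by gcongr)
  have b1 : qform S D D - qform S' D D ≤ 2 * (L * (t * r)) * d * d := by
    rw [← qform_sub_left]
    refine (le_abs_self _).trans ((abs_qform_le _ _ _).trans ?_)
    gcongr
  have b2 : qform S D (D.comp M) - qform S' D (D.comp M) ≤ 2 * (L * (t * K)) * d * (d * K) := by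
    rw [← qform_sub_left]
    refine (le_abs_self _).trans ((abs_qform_le _ _ _).trans ?_)
    have : ‖S - S'‖ ≤ L * (t * K) := hSS.trans (by gcongr)
    gcongr
  have b3 : qform S' D (D.comp M) - qform S' D (D.comp M') ≤ 2 * κ * d * (d * (K ^ 2 * t)) := by
    rw [← qform_sub_right, ← ContinuousLinearMap.comp_sub]
    refine (le_abs_self _).trans ((abs_qform_le _ _ _).trans ?_)
    gcongr
  have b4 : qform S (D.comp M) (D.comp M) ≤ 2 * κ * (d * K) * (d * K) := by
    refine (le_abs_self _).trans ((abs_qform_le _ _ _).trans ?_)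
    gcongr
  have b5 : (ω - ω') * W ≤ L * (t * r) * W :=
    mul_le_mul_of_nonneg_right ((le_abs_self _).trans hωω) hW0
  have e4 : qform S (t • D.comp M) (t • D.comp M) = t ^ 2 * qform S (D.comp M) (D.comp M) := by
    rw [qform_smul_right]
    have : ∀ D' : Euc n →L[ℝ] ℂ, qform S (t • D') D' = t * qform S D' D' := fun D' => by
      simp only [qform, gvec, map_smul, smul_apply, real_inner_smul_left]; ring
    rw [this]; ring
  unfold en
  rw [e0, qform_add_self hsym, qform_smul_right, e4, ← hW]
  have c2 := mul_le_mul_of_nonneg_left (add_le_add b2 b3) ht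
  have c4 := mul_le_mul_of_nonneg_left b4 (sq_nonneg t)
  have c6 : L * (t * r) * (d ^ 2 + W) ≤ L * (t * (r' + K ^ 2 * t)) * (d ^ 2 + W) := by gcongr
  have c7 : 0 ≤ t ^ 2 * (L * K ^ 2 + κ * K ^ 2) * W := by positivity
  have c8 : 0 ≤ t ^ 2 * (L * K ^ 2 * W + κ * K ^ 2 * W * 2) := by positivity
  nlinarith

/-- The integrand of the inner variation of the energy along `X`, up to the error made by freezing
Lipschitz coefficients. -/
def varDen {n : ℕ} (ε L : ℝ) (a : Euc n → (Euc n →L[ℝ] Euc n)) (X : Euc n → Euc n)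
    (u : Euc n → ℂ) (y : Euc n) : ℝ :=
  qform (a y) (fderiv ℝ u y) ((fderiv ℝ u y).comp (fderiv ℝ X y))
    + L * ‖X y‖ * ‖fderiv ℝ u y‖ ^ 2 + L * ‖X y‖ * ((1 - ‖u y‖ ^ 2) ^ 2 / (4 * ε ^ 2))

section
variable {n : ℕ} {c κ K L ε : ℝ} {a : Euc n → (Euc n →L[ℝ] Euc n)} {w : Euc n → ℝ}
  {X : Euc n → Euc n} {Ω : Set (Euc n)} {u : Euc n → ℂ}

theorem WeakSol.integrableOn_pot (hu : WeakSol n ε a w u) :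
    IntegrableOn (fun x => (1 - ‖u x‖ ^ 2) ^ 2 / (4 * ε ^ 2)) (ball 0 1) := by
  have hum : AEStronglyMeasurable u (volume.restrict (ball 0 1)) :=
    hu.diff.continuousOn.aestronglyMeasurable measurableSet_ball
  refine Integrable.mono' (integrableOn_const (C := 1 / (4 * ε ^ 2)) measure_ball_lt_top.ne) ?_ ?_
  · have hc : Continuous fun z : ℂ => (1 - ‖z‖ ^ 2) ^ 2 / (4 * ε ^ 2) := by fun_prop
    exact hc.comp_aestronglyMeasurable hum
  · filter_upwards [ae_restrict_mem measurableSet_ball] with x hx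
    obtain ⟨h1, h2⟩ := norm_sub_mul_sq_le (hu.le_one x hx)
    rw [Real.norm_of_nonneg (by positivity)]
    gcongr
    nlinarith

theorem abs_varDen_le (ha : Coeffs n c κ L a w) (hX : Fld n K X Ω) {y : Euc n}
    (hy : y ∈ ball (0 : Euc n) 1) :
    |varDen ε L a X u y| ≤
      (2 * κ * K + L * K) * (‖fderiv ℝ u y‖ ^ 2 + (1 - ‖u y‖ ^ 2) ^ 2 / (4 * ε ^ 2)) := by
  have hκ := ha.K_nonneg
  have hL := ha.L_nonneg
  have hK := hX.one_le
  have h1 := hX.bdd y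
  set d := ‖fderiv ℝ u y‖ with hd
  have hd0 : 0 ≤ d := norm_nonneg _
  set W := (1 - ‖u y‖ ^ 2) ^ 2 / (4 * ε ^ 2) with hW
  have hW0 : 0 ≤ W := by positivity
  have h2 : |qform (a y) (fderiv ℝ u y) ((fderiv ℝ u y).comp (fderiv ℝ X y))|
      ≤ 2 * κ * d * (d * K) := by
    refine (abs_qform_le _ _ _).trans ?_
    have h3 : ‖(fderiv ℝ u y).comp (fderiv ℝ X y)‖ ≤ d * K :=
      (ContinuousLinearMap.opNorm_comp_le _ _).trans (by have := hX.dbdd y; gcongr)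
    have := ha.bdd y hy
    gcongr
  have h3 : L * ‖X y‖ * (d ^ 2 + W) ≤ L * K * (d ^ 2 + W) := by gcongr
  have h4 : 0 ≤ L * ‖X y‖ * d ^ 2 := by positivity
  have h5 : 0 ≤ L * ‖X y‖ * W := by positivity
  have h6 : 0 ≤ 2 * κ * K * W := by positivity
  rw [abs_le] at h2 ⊢
  unfold varDen
  rw [← hd, ← hW]
  constructor <;> nlinarith

theorem WeakSol.integrableOn_varDen (ha : Coeffs n c κ L a w) (hu : WeakSol n ε a w u)
    (hX : Fld n K X Ω) : IntegrableOn (varDen ε L a X u) (ball 0 1) := by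
  refine Integrable.mono' ((hu.grad.add hu.integrableOn_pot).const_mul (2 * κ * K + L * K)) ?_ ?_
  · have hum : AEStronglyMeasurable u (volume.restrict (ball 0 1)) :=
      hu.diff.continuousOn.aestronglyMeasurable measurableSet_ball
    have hXm : AEStronglyMeasurable (fun y => L * ‖X y‖) (volume.restrict (ball 0 1)) := by
      have := hX.diff.continuous
      have : Continuous fun y => L * ‖X y‖ := by fun_prop
      exact this.aestronglyMeasurable
    have hDX : Continuous (fderiv ℝ X) :=
      (LipschitzWith.of_dist_le_mul (K := K.toNNReal) fun x y => by
        rw [dist_eq_norm, dist_eq_norm, Real.coe_toNNReal _ (by linarith [hX.one_le])]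
        exact hX.dlip x y).continuous
    have hcomp : AEStronglyMeasurable (fun y => (fderiv ℝ u y).comp (fderiv ℝ X y))
        (volume.restrict (ball 0 1)) := by
      have hp : AEStronglyMeasurable (fun y => (fderiv ℝ u y, fderiv ℝ X y))
        (volume.restrict (ball 0 1)) := (aesm_fderiv u _).prodMk hDX.aestronglyMeasurable
      have hc : Continuous fun p : (Euc n →L[ℝ] ℂ) × (Euc n →L[ℝ] Euc n) => p.1.comp p.2 :=
        continuous_fst.clm_comp continuous_snd
      have h2 := hc.comp_aestronglyMeasurable hp
      exact h2
    have h1 : AEStronglyMeasurable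
        (fun y => qform (a y) (fderiv ℝ u y) ((fderiv ℝ u y).comp (fderiv ℝ X y)))
        (volume.restrict (ball 0 1)) := by
      simp_rw [← qformL_apply]
      exact aestronglyMeasurable_clm_apply (aesm_qformL ha.aesm_a (aesm_fderiv u _)) hcomp
    have h2 : AEStronglyMeasurable (fun y => ‖fderiv ℝ u y‖ ^ 2) (volume.restrict (ball 0 1)) :=
      hu.grad.aestronglyMeasurable
    exact (h1.add (hXm.mul h2)).add (hXm.mul hu.integrableOn_pot.aestronglyMeasurable)
  · filter_upwards [ae_restrict_mem measurableSet_ball] with y hy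
    exact abs_varDen_le ha hX hy

end

theorem le_mul_of_one_le_mul {e h0 h1 P t τ η J c₁ c₂ T : ℝ} (he : 0 ≤ e) (hP : 0 ≤ P)
    (hle : e ≤ h0 + t * h1 + t ^ 2 * (c₂ * P)) (h1P : |h1| ≤ c₁ * P) (hτ : |τ| ≤ T)
    (hη : 0 ≤ η) (hη1 : η ≤ 1) (ht : 0 ≤ t) (ht1 : t ≤ 1) (hJ : 0 ≤ J) (hc₂ : 0 ≤ c₂)
    (hJ1 : 1 ≤ J * (1 - t * τ + t * η)) :
    e ≤ J * (h0 + t * (h1 - τ * h0 + η * h0) +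
      t ^ 2 * (((T + 1) * c₁ + (T + 2) * c₂) * P)) := by
  set R := h0 + t * h1 + t ^ 2 * (c₂ * P) with hR
  have hR0 : 0 ≤ R := he.trans hle
  have h2 : e ≤ J * ((1 - t * τ + t * η) * R) := by
    rw [← mul_assoc]
    exact hle.trans (le_mul_of_one_le_left hR0 hJ1)
  refine h2.trans (mul_le_mul_of_nonneg_left ?_ hJ)
  have hθ : |η - τ| ≤ T + 1 := by
    rw [abs_le] at hτ ⊢; constructor <;> linarith [hτ.1, hτ.2]
  have hT : 0 ≤ T := (abs_nonneg _).trans hτ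
  have e1 : (η - τ) * h1 ≤ (T + 1) * (c₁ * P) := by
    refine (le_abs_self _).trans ?_
    rw [abs_mul]
    exact mul_le_mul hθ h1P (abs_nonneg _) (by linarith)
  have e2 : t * (η - τ) * (c₂ * P) ≤ (T + 1) * (c₂ * P) := by
    refine mul_le_mul_of_nonneg_right ?_ (by positivity)
    have := (le_abs_self (η - τ)).trans hθ
    nlinarith
  have e3 : (1 - t * τ + t * η) * R = h0 + t * (h1 - τ * h0 + η * h0)
      + t ^ 2 * (c₂ * P + (η - τ) * h1 + t * (η - τ) * (c₂ * P)) := by rw [hR]; ring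
  rw [e3]
  have e4 := mul_le_mul_of_nonneg_left (add_le_add e1 e2) (sq_nonneg t)
  nlinarith

theorem integral_expansion {α : Type*} [MeasurableSpace α] {μ : Measure α} {f g p : α → ℝ}
    (hf : Integrable f μ) (hg : Integrable g μ) (hp : Integrable p μ) (t η k : ℝ) :
    ∫ y, (f y + t * (g y + η * f y) + t ^ 2 * (k * p y)) ∂μ
      = (∫ y, f y ∂μ) + t * ((∫ y, g y ∂μ) + η * ∫ y, f y ∂μ) + t ^ 2 * (k * ∫ y, p y ∂μ) := by
  have h1 : Integrable (fun y => g y + η * f y) μ := hg.add (hf.const_mul η)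
  have h2 : Integrable (fun y => t * (g y + η * f y)) μ := h1.const_mul t
  have h3 : Integrable (fun y => f y + t * (g y + η * f y)) μ := hf.add h2
  rw [integral_add h3 ((hp.const_mul k).const_mul (t ^ 2)), integral_add hf h2,
    integral_const_mul, integral_add hg (hf.const_mul η)]
  simp only [integral_const_mul]

section
variable {n : ℕ} {c κ K L ε t : ℝ} {a : Euc n → (Euc n →L[ℝ] Euc n)} {w : Euc n → ℝ}
  {X : Euc n → Euc n} {Ω : Set (Euc n)} {u : Euc n → ℂ}

theorem fderiv_comp_perturb (hX : Fld n K X Ω) (hu : DifferentiableOn ℝ u (ball 0 1))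
    (ht : 0 ≤ t) (htK : t * K < 1) {x : Euc n} (hx : x ∈ ball (0 : Euc n) 1) :
    HasFDerivAt (fun x => u (x + t • X x))
      ((fderiv ℝ u (x + t • X x)).comp (1 + t • fderiv ℝ X x)) x := by
  have h1 := (hX.mem_ball ht htK).2 hx
  exact ((hu.differentiableAt (isOpen_ball.mem_nhds h1)).hasFDerivAt).comp x (hX.hasFDerivAt t x)

theorem integrableOn_fderiv_comp_perturb (hX : Fld n K X Ω)
    (hu : DifferentiableOn ℝ u (ball 0 1))
    (hg : IntegrableOn (fun x => ‖fderiv ℝ u x‖ ^ 2) (ball 0 1))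
    (ht : 0 ≤ t) (htK : t * K < 1)
    (hdet : ∀ x, 1 / 2 ≤ (1 + t • fderiv ℝ X x).det) :
    IntegrableOn (fun x => ‖fderiv ℝ (fun x => u (x + t • X x)) x‖ ^ 2) (ball 0 1) := by
  refine Integrable.mono' ((hX.integrableOn_comp ht htK hg).const_mul 8) ?_ ?_
  · exact ((aesm_fderiv _ _).norm).pow 2
  · filter_upwards [ae_restrict_mem measurableSet_ball] with x hx
    rw [(fderiv_comp_perturb hX hu ht htK hx).fderiv, Real.norm_of_nonneg (by positivity)]
    have h1 : ‖(1 : Euc n →L[ℝ] Euc n) + t • fderiv ℝ X x‖ ≤ 2 := by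
      refine (norm_add_le _ _).trans ?_
      have h2 : ‖(1 : Euc n →L[ℝ] Euc n)‖ ≤ 1 := ContinuousLinearMap.norm_id_le
      have h3 : ‖t • fderiv ℝ X x‖ ≤ 1 := by
        rw [norm_smul, Real.norm_of_nonneg ht]
        exact (mul_le_mul_of_nonneg_left (hX.dbdd x) ht).trans htK.le
      linarith
    have h2 : ‖(fderiv ℝ u (x + t • X x)).comp (1 + t • fderiv ℝ X x)‖ ≤
        ‖fderiv ℝ u (x + t • X x)‖ * 2 :=
      (ContinuousLinearMap.opNorm_comp_le _ _).trans (by gcongr)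
    have h3 := (hdet x).trans (le_abs_self _)
    calc _ ≤ (‖fderiv ℝ u (x + t • X x)‖ * 2) ^ 2 := by gcongr
      _ = 8 * (1 / 2 * ‖fderiv ℝ u (x + t • X x)‖ ^ 2) := by ring
      _ ≤ _ := by gcongr

theorem WeakSol.integrableOn_tr_mul_en (ha : Coeffs n c κ L a w) (hu : WeakSol n ε a w u)
    (hX : Fld n K X Ω) :
    IntegrableOn (fun y => tr (fderiv ℝ X y) * en ε (a y) (w y) (fderiv ℝ u y) (u y))
      (ball 0 1) := by
  have hDX : Continuous (fderiv ℝ X) :=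
    (LipschitzWith.of_dist_le_mul (K := K.toNNReal) fun x y => by
      rw [dist_eq_norm, dist_eq_norm, Real.coe_toNNReal _ (by linarith [hX.one_le])]
      exact hX.dlip x y).continuous
  have hi0 := ha.integrableOn_en (ε := ε) hu.diff hu.le_one hu.grad
  have htc : Continuous fun y => tr (fderiv ℝ X y) := by
    simp_rw [tr_eq_sum]
    refine continuous_finsetSum _ fun i _ => ?_
    have h2 : Continuous fun y => fderiv ℝ X y (EuclideanSpace.single i 1) :=
      hDX.clm_apply continuous_const
    exact (EuclideanSpace.proj (𝕜 := ℝ) i).continuous.comp h2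
  refine Integrable.mono' (hi0.norm.const_mul (n * K))
    (htc.aestronglyMeasurable.mul hi0.aestronglyMeasurable) (ae_of_all _ fun y => ?_)
  rw [norm_mul, Real.norm_eq_abs]
  have := hX.dbdd y
  exact mul_le_mul_of_nonneg_right ((abs_tr_le _).trans (by gcongr)) (norm_nonneg _)

/-- The inner variation inequality for weak solutions. -/
theorem WeakSol.inner_variation (hε : 0 < ε) (ha : Coeffs n c κ L a w) (hu : WeakSol n ε a w u)
    (hX : Fld n K X Ω) :
    0 ≤ ∫ y in ball 0 1, (varDen ε L a X u y
      - tr (fderiv ℝ X y) * en ε (a y) (w y) (fderiv ℝ u y) (u y)) := by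
  have hK := hX.one_le
  have hκ := ha.K_nonneg
  have hL := ha.L_nonneg
  set B : Set (Euc n) := ball 0 1 with hB
  set h0 : Euc n → ℝ := fun y => en ε (a y) (w y) (fderiv ℝ u y) (u y) with hh0
  set h1 : Euc n → ℝ := varDen ε L a X u with hh1
  set P : Euc n → ℝ := fun y => ‖fderiv ℝ u y‖ ^ 2 + (1 - ‖u y‖ ^ 2) ^ 2 / (4 * ε ^ 2) with hP
  set T : ℝ := n * K with hT
  set c₁ := 2 * κ * K + L * K with hc₁
  set c₂ := 3 * L * K ^ 2 + 3 * κ * K ^ 2 with hc₂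
  set K₃ := (T + 1) * c₁ + (T + 2) * c₂ with hK₃
  have hP0 : ∀ y, 0 ≤ P y := fun y => by positivity
  have hPi : IntegrableOn P B := hu.grad.add hu.integrableOn_pot
  have hi0 : IntegrableOn h0 B := ha.integrableOn_en hu.diff hu.le_one hu.grad
  have hi1 : IntegrableOn h1 B := hu.integrableOn_varDen ha hX
  have htr : ∀ y, |tr (fderiv ℝ X y)| ≤ T := fun y =>
    (abs_tr_le _).trans (by have := hX.dbdd y; rw [hT]; gcongr)
  have hiτ : IntegrableOn (fun y => tr (fderiv ℝ X y) * h0 y) B :=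
    hu.integrableOn_tr_mul_en ha hX
  have hE : 0 ≤ ∫ y in B, h0 y := setIntegral_nonneg measurableSet_ball fun y hy =>
    ha.en_nonneg hy _ _
  have hT0 : 0 ≤ T := by positivity
  have hc₁0 : 0 ≤ c₁ := by positivity
  have hc₂0 : 0 ≤ c₂ := by positivity
  have hK₃0 : 0 ≤ K₃ := by positivity
  have hPI : 0 ≤ ∫ y in B, P y := setIntegral_nonneg measurableSet_ball fun y _ => hP0 y
  have hGI : 0 ≤ ∫ y in B, ‖fderiv ℝ u y‖ ^ 2 :=
    setIntegral_nonneg measurableSet_ball fun y _ => by positivity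
  refine nonneg_of_forall_perturbation hE
    (Q := K₃ * (∫ y in B, P y) + κ / (2 * ε ^ 2) * (2 * K ^ 2 * ∫ y in B, ‖fderiv ℝ u y‖ ^ 2))
    (by positivity) fun η hη hη1 => ?_
  obtain ⟨t₀, ht₀, hdet⟩ := det_one_add_lower n (K := K ^ 2) (by positivity) hη
  refine ⟨min t₀ (min 1 (1 / (2 * K))), by positivity, fun t ht htt => ?_⟩
  have ht1 : t ≤ t₀ := htt.trans (min_le_left _ _)
  have ht2 : t ≤ 1 := htt.trans ((min_le_right _ _).trans (min_le_left _ _))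
  have ht3 : t ≤ 1 / (2 * K) := htt.trans ((min_le_right _ _).trans (min_le_right _ _))
  have htK : t * K < 1 := by
    rw [le_div_iff₀ (by positivity)] at ht3; linarith
  have hbd : ∀ x, ‖fderiv ℝ X x‖ ≤ K ^ 2 := fun x => (hX.dbdd x).trans (by nlinarith)
  have hdet' : ∀ s, 0 < s → s ≤ t → ∀ x, 1 / 2 ≤ (1 + s • fderiv ℝ X x).det :=
    fun s hs hst x => (hdet s hs (hst.trans ht1) _ (fderiv ℝ X x) (hbd x)
      (by rw [sub_self, norm_zero]; positivity)).1
  have hdisp : ∀ x, ‖x + t • X x - x‖ ≤ t * ‖X x‖ := fun x => by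
    rw [add_sub_cancel_left, norm_smul, Real.norm_of_nonneg ht.le]
  have hMM : ∀ x, ‖fderiv ℝ X (x + t • X x) - fderiv ℝ X x‖ ≤ K ^ 2 * t := fun x => by
    refine (hX.dlip _ _).trans ?_
    have h2 := (hdisp x).trans (mul_le_mul_of_nonneg_left (hX.bdd x) ht.le)
    calc _ ≤ K * (t * K) := by gcongr
      _ = _ := by ring
  have hvg := integrableOn_fderiv_comp_perturb hX hu.diff hu.grad ht.le htK
    (hdet' t ht le_rfl)
  have hvd : DifferentiableOn ℝ (fun x => u (x + t • X x)) B := fun x hx =>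
    (fderiv_comp_perturb hX hu.diff ht.le htK hx).differentiableAt.differentiableWithinAt
  have hv1 : ∀ x ∈ B, ‖u (x + t • X x)‖ ≤ 1 := fun x hx =>
    hu.le_one _ ((hX.mem_ball ht.le htK).2 hx)
  have hen := hu.energy_le hε ha hvd hv1 hvg hX.cpt hX.sub fun x hx => by
    simp only [hX.zero x hx, smul_zero, add_zero]
  have hdi := hX.integral_disp_le ht htK hdet' hu.diff hu.grad
  set G : Euc n → ℝ := fun y => h0 y + t * (h1 y - tr (fderiv ℝ X y) * h0 y + η * h0 y)
    + t ^ 2 * (K₃ * P y) with hG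
  have hGi : IntegrableOn G B :=
    (hi0.add (((hi1.sub hiτ).add (hi0.const_mul η)).const_mul t)).add
      ((hPi.const_mul K₃).const_mul (t ^ 2))
  have hGint : ∫ y in B, G y = (∫ y in B, h0 y)
      + t * ((∫ y in B, (h1 y - tr (fderiv ℝ X y) * h0 y)) + η * ∫ y in B, h0 y)
      + t ^ 2 * (K₃ * ∫ y in B, P y) := by
    exact integral_expansion hi0 (hi1.sub hiτ) hPi t η K₃
  have hpt : ∀ x ∈ B, en ε (a x) (w x) (fderiv ℝ (fun x => u (x + t • X x)) x) (u (x + t • X x))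
      ≤ |(1 + t • fderiv ℝ X x).det| * G (x + t • X x) := fun x hx => by
    have hy : x + t • X x ∈ B := (hX.mem_ball ht.le htK).2 hx
    have hd := hdet t ht ht1 (fderiv ℝ X x) (fderiv ℝ X (x + t • X x)) (hbd x) (hMM x)
    rw [(fderiv_comp_perturb hX hu.diff ht.le htK hx).fderiv, abs_of_nonneg (by linarith [hd.1])]
    have hdi' : ‖x - (x + t • X x)‖ ≤ t * ‖X x‖ := by rw [norm_sub_rev]; exact hdisp x
    refine le_mul_of_one_le_mul (ha.en_nonneg hx _ _) (hP0 _) ?_ (abs_varDen_le ha hX hy) (htr _)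
      hη.le hη1 ht.le ht2 (by linarith [hd.1]) hc₂0 hd.2
    refine en_comp_le ht.le (by linarith) hL (ha.symm x hx) (ha.bdd x hx) (ha.bdd _ hy)
      ((ha.lip x hx _ hy).trans (mul_le_mul_of_nonneg_left hdi' hL))
      ((ha.w_lip x hx _ hy).trans (mul_le_mul_of_nonneg_left hdi' hL))
      (hX.dbdd x) (by rw [norm_sub_rev]; exact hMM x) (hX.bdd x) ?_ _ _
    have h5 := hX.lip x (x + t • X x)
    have h6 : ‖X x‖ ≤ ‖X (x + t • X x)‖ + ‖X x - X (x + t • X x)‖ := by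
      have := norm_add_le (X (x + t • X x)) (X x - X (x + t • X x))
      rwa [add_sub_cancel] at this
    have h7 := mul_le_mul_of_nonneg_left (hX.bdd x) ht.le
    have h8 : K * ‖x - (x + t • X x)‖ ≤ K * (t * K) := by
      gcongr; exact hdi'.trans h7
    nlinarith
  have hmono : ∫ x in B, en ε (a x) (w x) (fderiv ℝ (fun x => u (x + t • X x)) x)
      (u (x + t • X x)) ≤ ∫ y in B, G y := by
    rw [← hX.integral_comp ht.le htK G]
    exact setIntegral_mono_on (ha.integrableOn_en hvd hv1 hvg)
      (hX.integrableOn_comp ht.le htK hGi) measurableSet_ball hpt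
  rw [hGint] at hmono
  have h9 := mul_le_mul_of_nonneg_left hdi (show 0 ≤ κ / (2 * ε ^ 2) by positivity)
  have h10 : (∫ y in B, h0 y) ≤ _ := hen.trans (add_le_add hmono h9)
  linarith

end

theorem Fld.exists_of_contDiff {n : ℕ} {X : Euc n → Euc n} {Ω : Set (Euc n)}
    (hX : ContDiff ℝ 2 X) (hΩ : IsCompact Ω) (hsub : Ω ⊆ ball 0 1) (hzero : ∀ x ∉ Ω, X x = 0) :
    ∃ K, Fld n K X Ω := by
  have hc : HasCompactSupport X := HasCompactSupport.intro hΩ hzero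
  obtain ⟨C₁, h₁⟩ := hc.exists_bound_of_continuous hX.continuous
  obtain ⟨C₂, h₂⟩ := (hc.fderiv ℝ).exists_bound_of_continuous (hX.continuous_fderiv (by norm_num))
  obtain ⟨C₃, h₃⟩ := ContDiff.lipschitzWith_of_hasCompactSupport (hc.fderiv ℝ)
    (hX.fderiv_right (m := 1) (by norm_num)) one_ne_zero
  refine ⟨max 1 (max C₁ (max C₂ C₃)), le_max_left _ _, hX.differentiable (by norm_num),
    fun x => (h₁ x).trans ?_, fun x => (h₂ x).trans ?_, fun x y => ?_, hΩ, hsub, hzero⟩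
  · exact (le_max_left _ _).trans (le_max_right _ _)
  · exact (le_max_left _ _).trans ((le_max_right _ _).trans (le_max_right _ _))
  · have := h₃.dist_le_mul x y
    rw [dist_eq_norm, dist_eq_norm] at this
    refine this.trans (mul_le_mul_of_nonneg_right ?_ (norm_nonneg _))
    exact (le_max_right _ _).trans ((le_max_right _ _).trans (le_max_right _ _))

/-- The derivative of the radial field `N(Q) ξ`, where `Q = ⟪A ξ, ξ⟫`. -/
def radD {n : ℕ} (A : Euc n →L[ℝ] Euc n) (N N' : ℝ) (ξ : Euc n) : Euc n →L[ℝ] Euc n :=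
  N • 1 + (2 * N') • (innerSL ℝ (A ξ)).smulRight ξ

theorem radD_apply {n : ℕ} (A : Euc n →L[ℝ] Euc n) (N N' : ℝ) (ξ h : Euc n) :
    radD A N N' ξ h = N • h + (2 * N' * ⟪A ξ, h⟫) • ξ := by
  simp [radD, smul_smul]

theorem tr_radD {n : ℕ} (A : Euc n →L[ℝ] Euc n) (N N' : ℝ) (ξ : Euc n) :
    tr (radD A N N' ξ) = n * N + 2 * N' * ⟪A ξ, ξ⟫ := by
  rw [tr_eq_sum]
  simp only [radD_apply, PiLp.add_apply, PiLp.smul_apply, smul_eq_mul, Finset.sum_add_distrib,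
    PiLp.single_apply, if_true, mul_one, EuclideanSpace.inner_single_right]
  simp only [Finset.sum_const, Finset.card_univ, Fintype.card_fin, nsmul_eq_mul, PiLp.inner_apply,
    Finset.mul_sum]
  congr 1
  refine Finset.sum_congr rfl fun i _ => ?_
  simp; ring

/-- The quadratic form of `A` centred at `x₀`. -/
def quad {n : ℕ} (A : Euc n →L[ℝ] Euc n) (x₀ x : Euc n) : ℝ := ⟪A (x - x₀), x - x₀⟫

theorem contDiff_quad {n : ℕ} (A : Euc n →L[ℝ] Euc n) (x₀ : Euc n) :
    ContDiff ℝ 2 (quad A x₀) := by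
  unfold quad
  have h : ContDiff ℝ 2 fun x : Euc n => x - x₀ := contDiff_id.sub contDiff_const
  exact (A.contDiff.comp h).inner ℝ h

theorem hasFDerivAt_quad {n : ℕ} {A : Euc n →L[ℝ] Euc n} (hA : ∀ p q, ⟪A p, q⟫ = ⟪p, A q⟫)
    (x₀ x : Euc n) : HasFDerivAt (quad A x₀) ((2 : ℝ) • innerSL ℝ (A (x - x₀))) x := by
  have h1 : HasFDerivAt (fun x : Euc n => x - x₀) (ContinuousLinearMap.id ℝ (Euc n)) x :=
    (hasFDerivAt_id x).sub_const x₀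
  have h2 := (A.hasFDerivAt.comp x h1).inner ℝ h1
  refine h2.congr_fderiv ?_
  ext h
  simp only [ContinuousLinearMap.comp_apply, ContinuousLinearMap.prod_apply,
    fderivInnerCLM_apply, smul_apply, innerSL_apply_apply, smul_eq_mul,
    ContinuousLinearMap.id_apply, Function.comp]
  rw [hA h, real_inner_comm h]
  ring

theorem hasFDerivAt_radial {n : ℕ} {A : Euc n →L[ℝ] Euc n} (hA : ∀ p q, ⟪A p, q⟫ = ⟪p, A q⟫)
    {x₀ x : Euc n} {N : ℝ → ℝ} (hN : DifferentiableAt ℝ N (quad A x₀ x)) :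
    HasFDerivAt (fun x => N (quad A x₀ x) • (x - x₀))
      (radD A (N (quad A x₀ x)) (deriv N (quad A x₀ x)) (x - x₀)) x := by
  have h1 : HasFDerivAt (fun x : Euc n => x - x₀) (ContinuousLinearMap.id ℝ (Euc n)) x :=
    (hasFDerivAt_id x).sub_const x₀
  have h2 := (hN.hasDerivAt.comp_hasFDerivAt x (hasFDerivAt_quad hA x₀ x)).smul h1
  refine h2.congr_fderiv ?_
  ext1 h
  simp only [radD_apply, add_apply, smul_apply, ContinuousLinearMap.smulRight_apply,
    ContinuousLinearMap.id_apply, innerSL_apply_apply, smul_eq_mul, Function.comp]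
  congr 2
  ring

theorem inner_gvec {n : ℕ} (D : Euc n →L[ℝ] ℂ) (T : Euc n →L[ℝ] Euc n) (h : Euc n) (k : ℂ) :
    ⟪h, gvec (D.comp T) k⟫ = ⟪T h, gvec D k⟫ := by
  rw [gvec_comp, ContinuousLinearMap.adjoint_inner_right]

theorem inner_radD_le {n : ℕ} {A S S₀ : Euc n →L[ℝ] Euc n} {N N' ω₀ r β : ℝ} {ξ p : Euc n}
    (hS : ∀ p q, ⟪S p, q⟫ = ⟪p, S q⟫) (hS₀ : ∀ h, S₀ (A h) = ω₀ • h)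
    (hω₀ : 0 ≤ ω₀) (hSS : ‖S - S₀‖ ≤ r) (hAβ : ‖A‖ ≤ β) (hN' : N' ≤ 0) :
    ⟪radD A N N' ξ (S p), p⟫ ≤ N * ⟪S p, p⟫ + 2 * |N'| * (r * β * ‖ξ‖ ^ 2 * ‖p‖ ^ 2) := by
  rw [radD_apply, inner_add_left, real_inner_smul_left, real_inner_smul_left]
  have e1 : ⟪A ξ, S p⟫ = ω₀ * ⟪ξ, p⟫ + ⟪(S - S₀) (A ξ), p⟫ := by
    rw [← hS, sub_apply, inner_sub_left, hS₀, real_inner_smul_left]; ring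
  have e2 : |⟪(S - S₀) (A ξ), p⟫ * ⟪ξ, p⟫| ≤ r * β * ‖ξ‖ ^ 2 * ‖p‖ ^ 2 := by
    rw [abs_mul]
    have h1 := abs_real_inner_le_norm ((S - S₀) (A ξ)) p
    have h2 := abs_real_inner_le_norm ξ p
    have h3 : ‖(S - S₀) (A ξ)‖ ≤ r * (β * ‖ξ‖) := by
      refine ((S - S₀).le_opNorm _).trans ?_
      have h4 : ‖A ξ‖ ≤ β * ‖ξ‖ := (A.le_opNorm _).trans (by gcongr)
      have := (norm_nonneg _).trans hSS
      gcongr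
    calc _ ≤ (r * (β * ‖ξ‖) * ‖p‖) * (‖ξ‖ * ‖p‖) := by
          refine mul_le_mul (h1.trans ?_) h2 (abs_nonneg _) ?_
          · gcongr
          · exact (abs_nonneg _).trans (h1.trans (by gcongr))
      _ = _ := by ring
  rw [e1, abs_of_nonpos hN']
  have h5 := mul_nonneg (neg_nonneg.2 hN') (mul_nonneg hω₀ (sq_nonneg ⟪ξ, p⟫))
  have h6 := mul_le_mul_of_nonneg_left ((neg_abs_le _).trans' (neg_le_neg e2)) (neg_nonneg.2 hN')
  nlinarith

theorem qform_radD_le {n : ℕ} {A S S₀ : Euc n →L[ℝ] Euc n} {N N' ω₀ r β : ℝ} {ξ : Euc n}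
    (hS : ∀ p q, ⟪S p, q⟫ = ⟪p, S q⟫) (hS₀ : ∀ h, S₀ (A h) = ω₀ • h)
    (hω₀ : 0 ≤ ω₀) (hSS : ‖S - S₀‖ ≤ r) (hAβ : ‖A‖ ≤ β) (hN' : N' ≤ 0) (D : Euc n →L[ℝ] ℂ) :
    qform S D (D.comp (radD A N N' ξ)) ≤
      N * qform S D D + 4 * |N'| * (r * β * ‖ξ‖ ^ 2 * ‖D‖ ^ 2) := by
  have h : ∀ k : ℂ, ‖k‖ = 1 → ⟪S (gvec D k), gvec (D.comp (radD A N N' ξ)) k⟫ ≤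
      N * ⟪S (gvec D k), gvec D k⟫ + 2 * |N'| * (r * β * ‖ξ‖ ^ 2 * ‖D‖ ^ 2) := fun k hk => by
    rw [inner_gvec]
    refine (inner_radD_le hS hS₀ hω₀ hSS hAβ hN').trans ?_
    have := norm_gvec_le D hk
    have := (norm_nonneg _).trans hSS
    have := (norm_nonneg _).trans hAβ
    gcongr
  have h1 := h 1 (by simp)
  have h2 := h Complex.I (by simp)
  unfold qform
  linarith

section
variable {n : ℕ} {c κ K L ε β ρ : ℝ} {a : Euc n → (Euc n →L[ℝ] Euc n)} {w : Euc n → ℝ}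
  {A : Euc n →L[ℝ] Euc n} {x₀ : Euc n} {u : Euc n → ℂ} {N : ℝ → ℝ}

/-- The operator `A` is adapted to the coefficients at the point `x₀`. -/
structure AdaptedAt (n : ℕ) (c β : ℝ) (a : Euc n → (Euc n →L[ℝ] Euc n)) (w : Euc n → ℝ)
    (A : Euc n →L[ℝ] Euc n) (x₀ : Euc n) : Prop where
  mem : x₀ ∈ ball (0 : Euc n) 1
  w_lower : ∀ x ∈ ball (0 : Euc n) 1, c ≤ w x
  symm : ∀ p q, ⟪A p, q⟫ = ⟪p, A q⟫
  inv : ∀ h, a x₀ (A h) = w x₀ • h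
  one_le : 1 ≤ β
  bdd : ‖A‖ ≤ β
  lower : ∀ h, ‖h‖ ^ 2 ≤ β ^ 2 * ⟪A h, h⟫

theorem AdaptedAt.quad_nonneg (hA : AdaptedAt n c β a w A x₀) (x : Euc n) : 0 ≤ quad A x₀ x := by
  have h1 := hA.lower (x - x₀)
  have := hA.one_le
  exact nonneg_of_mul_nonneg_right (h1.trans' (sq_nonneg _)) (by positivity)

theorem AdaptedAt.norm_le (hA : AdaptedAt n c β a w A x₀) (x : Euc n) :
    ‖x - x₀‖ ≤ β * Real.sqrt (quad A x₀ x) := by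
  have h1 := hA.lower (x - x₀)
  have hβ := hA.one_le
  have h2 := hA.quad_nonneg x
  refine le_of_sq_le_sq ?_ (by positivity)
  rw [mul_pow, Real.sq_sqrt h2]; exact h1

theorem Coeffs.le_en (ha : Coeffs n c κ L a w) (hw : ∀ x ∈ ball (0 : Euc n) 1, c ≤ w x)
    {x : Euc n} (hx : x ∈ ball (0 : Euc n) 1) (D : Euc n →L[ℝ] ℂ) (z : ℂ) :
    ‖D‖ ^ 2 + (1 - ‖z‖ ^ 2) ^ 2 / (4 * ε ^ 2) ≤ 2 / c * en ε (a x) (w x) D z := by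
  have h1 := ha.qform_nonneg hx D
  have h2 := mul_le_mul_of_nonneg_right (hw x hx)
    (show 0 ≤ (1 - ‖z‖ ^ 2) ^ 2 / (4 * ε ^ 2) by positivity)
  have h3 := ha.c_pos
  have h4 : 0 ≤ c * ((1 - ‖z‖ ^ 2) ^ 2 / (4 * ε ^ 2)) := by positivity
  rw [div_mul_eq_mul_div, le_div_iff₀ h3]
  unfold en
  nlinarith

theorem varDen_radial_le (ha : Coeffs n c κ L a w) (hA : AdaptedAt n c β a w A x₀)
    {y : Euc n} (hy : y ∈ ball (0 : Euc n) 1) (hNd : DifferentiableAt ℝ N (quad A x₀ y))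
    (hN0 : 0 ≤ N (quad A x₀ y)) (hN' : deriv N (quad A x₀ y) ≤ 0) :
    varDen ε L a (fun x => N (quad A x₀ x) • (x - x₀)) u y
      - tr (fderiv ℝ (fun x => N (quad A x₀ x) • (x - x₀)) y)
        * en ε (a y) (w y) (fderiv ℝ u y) (u y) ≤
    -((((n - 2) * N (quad A x₀ y) + 2 * quad A x₀ y * deriv N (quad A x₀ y))
      - 8 * L * β ^ 4 / c * Real.sqrt (quad A x₀ y) *
        (N (quad A x₀ y) + quad A x₀ y * |deriv N (quad A x₀ y)|))
      * en ε (a y) (w y) (fderiv ℝ u y) (u y)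
      + 2 * N (quad A x₀ y) * (w y * ((1 - ‖u y‖ ^ 2) ^ 2 / (4 * ε ^ 2)))) := by
  have hL := ha.L_nonneg
  have hβ := hA.one_le
  have hc := ha.c_pos
  rw [varDen, (hasFDerivAt_radial hA.symm hNd).fderiv, tr_radD]
  have hq := hA.quad_nonneg y
  have hξ := hA.norm_le y
  have hξ2 := hA.lower (y - x₀)
  change _ ≤ β ^ 2 * quad A x₀ y at hξ2
  change _ - (n * N (quad A x₀ y) + 2 * deriv N (quad A x₀ y) * quad A x₀ y) * _ ≤ _
  have h1 := qform_radD_le (N := N (quad A x₀ y)) (ξ := y - x₀) (ha.symm y hy) hA.inv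
    (ha.w_nonneg x₀ hA.mem) (ha.lip y hy x₀ hA.mem) hA.bdd hN' (fderiv ℝ u y)
  have h2 := ha.le_en (ε := ε) hA.w_lower hy (fderiv ℝ u y) (u y)
  have h3 := ha.en_nonneg (ε := ε) hy (fderiv ℝ u y) (u y)
  set q := quad A x₀ y
  set E := en ε (a y) (w y) (fderiv ℝ u y) (u y) with hE
  set W := (1 - ‖u y‖ ^ 2) ^ 2 / (4 * ε ^ 2) with hW
  have hW0 : 0 ≤ W := by positivity
  set d := ‖fderiv ℝ u y‖ with hd
  set s := Real.sqrt q
  have hs : 0 ≤ s := Real.sqrt_nonneg _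
  set ξ := y - x₀
  rw [norm_smul, Real.norm_of_nonneg hN0]
  have h4 : 4 * |deriv N q| * (L * ‖ξ‖ * β * ‖ξ‖ ^ 2 * d ^ 2) ≤
      4 * |deriv N q| * (L * (β * s) * β * (β ^ 2 * q) * (d ^ 2 + W)) := by
    gcongr
    linarith
  have h5 : L * (N q * ‖ξ‖) * d ^ 2 + L * (N q * ‖ξ‖) * W ≤
      L * (N q * (β * s)) * (d ^ 2 + W) := by
    rw [← mul_add]; gcongr
  have h5' : L * (N q * (β * s)) * (d ^ 2 + W) ≤ 4 * L * β ^ 4 * s * N q * (d ^ 2 + W) := by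
    have hb : β ≤ 4 * β ^ 4 := by nlinarith [one_le_pow₀ hβ (n := 3)]
    have := mul_le_mul_of_nonneg_left hb (show 0 ≤ L * N q * s * (d ^ 2 + W) by positivity)
    linarith
  have h6 : 4 * L * β ^ 4 * s * (N q + q * |deriv N q|) * (d ^ 2 + W) ≤
      4 * L * β ^ 4 * s * (N q + q * |deriv N q|) * (2 / c * E) := by gcongr
  have h7 : 4 * L * β ^ 4 * s * (N q + q * |deriv N q|) * (2 / c * E) =
      8 * L * β ^ 4 / c * s * (N q + q * |deriv N q|) * E := by ring
  have h8 : qform (a y) (fderiv ℝ u y) (fderiv ℝ u y) = 2 * E - 2 * (w y * W) := by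
    rw [hE, en]; ring
  rw [h8] at h1
  nlinarith

/-- The weighted monotonicity inequality for radial weights. -/
theorem WeakSol.radial_inequality (hε : 0 < ε) (ha : Coeffs n c κ L a w)
    (hA : AdaptedAt n c β a w A x₀) (hu : WeakSol n ε a w u)
    (hNc : ∀ q, 0 ≤ q → ContDiffAt ℝ 2 N q) (hN0 : ∀ q, 0 ≤ q → 0 ≤ N q)
    (hN' : ∀ q, 0 ≤ q → deriv N q ≤ 0) (hNz : ∀ q, ρ ^ 2 ≤ q → N q = 0) (hρ : 0 ≤ ρ)
    (hρB : β * ρ < 1 - ‖x₀‖) {H : Euc n → ℝ} (hHi : IntegrableOn H (ball 0 1))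
    (hH : ∀ y ∈ ball (0 : Euc n) 1, H y ≤
      ((((n - 2) * N (quad A x₀ y) + 2 * quad A x₀ y * deriv N (quad A x₀ y))
        - 8 * L * β ^ 4 / c * Real.sqrt (quad A x₀ y) *
          (N (quad A x₀ y) + quad A x₀ y * |deriv N (quad A x₀ y)|))
        * en ε (a y) (w y) (fderiv ℝ u y) (u y)
        + 2 * N (quad A x₀ y) * (w y * ((1 - ‖u y‖ ^ 2) ^ 2 / (4 * ε ^ 2))))) :
    ∫ y in ball 0 1, H y ≤ 0 := by
  have hβ := hA.one_le
  have hQc : Continuous (quad A x₀) := (contDiff_quad A x₀).continuous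
  have hsub : {x | quad A x₀ x ≤ ρ ^ 2} ⊆ closedBall x₀ (β * ρ) := fun x hx => by
    rw [mem_closedBall, dist_eq_norm]
    refine (hA.norm_le x).trans ?_
    gcongr
    exact Real.sqrt_le_iff.2 ⟨hρ, hx⟩
  have hX : ContDiff ℝ 2 fun x => N (quad A x₀ x) • (x - x₀) := by
    have h1 : ContDiff ℝ 2 fun x : Euc n => x - x₀ := contDiff_id.sub contDiff_const
    have h2 : ContDiff ℝ 2 fun x => N (quad A x₀ x) := contDiff_iff_contDiffAt.2 fun x =>
      (hNc _ (hA.quad_nonneg x)).comp x (contDiff_quad A x₀).contDiffAt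
    exact h2.smul h1
  obtain ⟨K, hK⟩ := Fld.exists_of_contDiff hX
    ((isCompact_closedBall x₀ (β * ρ)).of_isClosed_subset (isClosed_le hQc continuous_const) hsub)
    (fun x hx => by
      have h1 := hsub hx
      rw [mem_closedBall, dist_eq_norm] at h1
      rw [mem_ball_zero_iff]
      have := norm_add_le (x - x₀) x₀
      rw [sub_add_cancel] at this
      linarith)
    (fun x hx => by
      rw [Set.mem_ofPred_eq, not_le] at hx
      simp only [hNz _ hx.le, zero_smul])
  have h1 := hu.inner_variation hε ha hK
  have h2 := setIntegral_mono_on ((hu.integrableOn_varDen ha hK).sub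
    (hu.integrableOn_tr_mul_en ha hK)) hHi.neg measurableSet_ball fun y hy =>
      (varDen_radial_le (u := u) ha hA hy
        ((hNc _ (hA.quad_nonneg y)).differentiableAt (by norm_num))
        (hN0 _ (hA.quad_nonneg y)) (hN' _ (hA.quad_nonneg y))).trans (neg_le_neg (hH y hy))
  have h3 := h1.trans h2
  simp only [Pi.neg_apply] at h3
  rw [integral_neg] at h3
  linarith

end

theorem exists_cutoff : ∃ (χ : ℝ → ℝ) (M : ℝ), 0 < M ∧ ContDiff ℝ 2 χ ∧ (∀ z, 0 ≤ χ z) ∧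
    (∀ z ≤ 1 / 4, χ z = 1 ∧ deriv χ z = 0) ∧ (∀ z, 1 ≤ z → χ z = 0 ∧ deriv χ z = 0) ∧
    ∀ z, deriv χ z ≤ 0 ∧ |deriv χ z| ≤ M := by
  set χ : ℝ → ℝ := fun z => Real.smoothTransition ((1 - z) * (4 / 3)) with hχ
  have hcd : ContDiff ℝ 2 χ :=
    (Real.smoothTransition.contDiff (n := 2)).comp (f := fun z : ℝ => (1 - z) * (4 / 3))
      (by fun_prop)
  have hanti : Antitone χ := fun x y hxy => Real.smoothTransition.monotone (by linarith)
  have h0 : ∀ z, 0 ≤ χ z := fun z => Real.smoothTransition.nonneg _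
  have h1 : ∀ z ≤ 1 / 4, χ z = 1 := fun z hz =>
    Real.smoothTransition.one_of_one_le (by linarith)
  have h2 : ∀ z, 1 ≤ z → χ z = 0 := fun z hz =>
    Real.smoothTransition.zero_of_nonpos (by linarith)
  have h3 : ∀ z ≤ 1 / 4, deriv χ z = 0 := fun z hz =>
    IsLocalMax.deriv_eq_zero (Eventually.of_forall fun y => by
      rw [h1 z hz]; exact Real.smoothTransition.le_one _)
  have h4 : ∀ z, 1 ≤ z → deriv χ z = 0 := fun z hz =>
    IsLocalMin.deriv_eq_zero (Eventually.of_forall fun y => by rw [h2 z hz]; exact h0 y)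
  obtain ⟨M, hM⟩ := (isCompact_Icc (a := (0 : ℝ)) (b := 1)).exists_bound_of_continuousOn
    (hcd.continuous_deriv (by norm_num)).continuousOn
  refine ⟨χ, max M 1, by positivity, hcd, h0, fun z hz => ⟨h1 z hz, h3 z hz⟩,
    fun z hz => ⟨h2 z hz, h4 z hz⟩, fun z => ⟨hanti.deriv_nonpos, ?_⟩⟩
  rcases le_total z (1 / 4) with hz | hz
  · rw [h3 z hz, abs_zero]; positivity
  rcases le_total 1 z with hz' | hz'
  · rw [h4 z hz', abs_zero]; positivity
  exact (hM z ⟨by linarith, hz'⟩).trans (le_max_left _ _)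

theorem weight_core {p q σ ρ s r X C₁ b b' e : ℝ} (hp : p ≤ -1 / 2) (hq : 0 ≤ q) (hs : s = σ ^ 2 + q)
    (hr : 0 ≤ r) (hX : 0 ≤ X) (hρ : 0 < ρ) (hC₁ : 0 ≤ C₁)
    (hsmall : 2 * C₁ * (1 - p) * ρ ≤ 1) (he : 0 ≤ e) (her : e ≤ r) (heρ : e ≤ ρ)
    (hb : b = s * X + ρ⁻¹ * (s * r * X)) (hb' : b' = p * X + ρ⁻¹ * ((p + 1 / 2) * (r * X))) :
    0 ≤ b ∧ b' ≤ 0 ∧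
      -2 * p * σ ^ 2 * X ≤ (-2 * p * b + 2 * q * b') - C₁ * e * (b + q * |b'|) := by
  have hρ' : 0 < ρ⁻¹ := inv_pos.2 hρ
  have hs0 : 0 ≤ s := by rw [hs]; positivity
  have hb0 : 0 ≤ b := by rw [hb]; positivity
  have hY : 0 ≤ ρ⁻¹ * (r * X) := by positivity
  have hb'0 : b' ≤ 0 := by
    have h1 : p * X ≤ 0 := mul_nonpos_of_nonpos_of_nonneg (by linarith) hX
    have h2 : (p + 1 / 2) * (ρ⁻¹ * (r * X)) ≤ 0 :=
      mul_nonpos_of_nonpos_of_nonneg (by linarith) hY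
    rw [hb']; linarith
  refine ⟨hb0, hb'0, ?_⟩
  rw [abs_of_nonpos hb'0]
  have hqs : q ≤ s := by rw [hs]; nlinarith
  have e1 : b + q * -b' ≤ (1 - p) * (s * X + ρ⁻¹ * (s * r * X)) := by
    have h1 : q * (-p * X) ≤ s * (-p * X) :=
      mul_le_mul_of_nonneg_right hqs (mul_nonneg (by linarith) hX)
    have h2 : q * (-(p + 1 / 2) * (ρ⁻¹ * (r * X))) ≤ s * (-(p + 1 / 2) * (ρ⁻¹ * (r * X))) :=
      mul_le_mul_of_nonneg_right hqs (mul_nonneg (by linarith) hY)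
    have h3 : 0 ≤ s * (ρ⁻¹ * (r * X)) := by positivity
    rw [hb, hb']; linarith
  have e2 : e * (s * X + ρ⁻¹ * (s * r * X)) ≤ 2 * ρ * (s * (ρ⁻¹ * (r * X))) := by
    have h1 : e * (s * X) ≤ r * (s * X) := mul_le_mul_of_nonneg_right her (by positivity)
    have h2 : e * (ρ⁻¹ * (s * r * X)) ≤ ρ * (ρ⁻¹ * (s * r * X)) :=
      mul_le_mul_of_nonneg_right heρ (by positivity)
    have h3 : ρ * (s * (ρ⁻¹ * (r * X))) = r * (s * X) := by field_simp
    linarith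
  have e3 : C₁ * e * (b + q * -b') ≤ s * (ρ⁻¹ * (r * X)) := by
    have h4 : 0 ≤ s * (ρ⁻¹ * (r * X)) := by positivity
    calc C₁ * e * (b + q * -b') ≤ C₁ * e * ((1 - p) * (s * X + ρ⁻¹ * (s * r * X))) := by gcongr
      _ = C₁ * (1 - p) * (e * (s * X + ρ⁻¹ * (s * r * X))) := by ring
      _ ≤ C₁ * (1 - p) * (2 * ρ * (s * (ρ⁻¹ * (r * X)))) := by
        have : 0 ≤ 1 - p := by linarith
        gcongr
      _ = (2 * C₁ * (1 - p) * ρ) * (s * (ρ⁻¹ * (r * X))) := by ring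
      _ ≤ 1 * (s * (ρ⁻¹ * (r * X))) := by gcongr
      _ = _ := one_mul _
  have e4 : -2 * p * b + 2 * q * b' =
      -2 * p * σ ^ 2 * X + s * (ρ⁻¹ * (r * X)) + (-2 * p - 1) * σ ^ 2 * (ρ⁻¹ * (r * X)) := by
    rw [hb, hb', hs]; ring
  have e5 : 0 ≤ (-2 * p - 1) * σ ^ 2 * (ρ⁻¹ * (r * X)) :=
    mul_nonneg (mul_nonneg (by linarith) (sq_nonneg _)) hY
  linarith

theorem rpow_weight_le {p s ρ : ℝ} (hp : p ≤ -1 / 2) (hρ : 0 < ρ) (hs : ρ ^ 2 / 4 ≤ s) :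
    s ^ p + ρ⁻¹ * s ^ (p + 1 / 2) ≤ 2 * 2 ^ (-2 * p) * ρ ^ (2 * p) := by
  have h0 : (0 : ℝ) < ρ ^ 2 / 4 := by positivity
  have e : ρ ^ 2 / 4 = (ρ / 2) ^ (2 : ℝ) := by rw [Real.rpow_two]; ring
  have h1 : s ^ p ≤ (ρ / 2) ^ (2 * p) := by
    refine (Real.rpow_le_rpow_of_nonpos h0 hs (by linarith)).trans_eq ?_
    rw [e, ← Real.rpow_mul (by positivity)]
  have h2 : s ^ (p + 1 / 2) ≤ (ρ / 2) ^ (2 * p) * (ρ / 2) := by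
    refine (Real.rpow_le_rpow_of_nonpos h0 hs (by linarith)).trans_eq ?_
    rw [e, ← Real.rpow_mul (by positivity), mul_add, Real.rpow_add (by positivity)]
    norm_num
  have h3 : (ρ / 2) ^ (2 * p) = 2 ^ (-2 * p) * ρ ^ (2 * p) := by
    rw [Real.div_rpow hρ.le (by norm_num), neg_mul, Real.rpow_neg (by norm_num), div_eq_mul_inv,
      mul_comm]
  have h4 : ρ⁻¹ * s ^ (p + 1 / 2) ≤ (ρ / 2) ^ (2 * p) / 2 := by
    calc _ ≤ ρ⁻¹ * ((ρ / 2) ^ (2 * p) * (ρ / 2)) := by gcongr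
      _ = _ := by field_simp
  have h5 : 0 ≤ (ρ / 2) ^ (2 * p) := by positivity
  rw [mul_assoc, ← h3]
  linarith

/-- Existence of radial weights for the monotonicity inequality. -/
theorem exists_weight {p : ℝ} (hp : p ≤ -1 / 2) : ∃ C₂ > 0, ∀ C₁ ρ σ : ℝ, 0 ≤ C₁ → 0 < ρ → 0 < σ →
    2 * C₁ * (1 - p) * ρ ≤ 1 → ∃ N : ℝ → ℝ, (∀ q, 0 ≤ q → ContDiffAt ℝ 2 N q) ∧
      (∀ q, 0 ≤ q → 0 ≤ N q) ∧ (∀ q, 0 ≤ q → deriv N q ≤ 0) ∧ (∀ q, ρ ^ 2 ≤ q → N q = 0) ∧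
      (∀ q, 0 ≤ q → q ≤ ρ ^ 2 / 4 → (σ ^ 2 + q) ^ p ≤ N q ∧
        -2 * p * σ ^ 2 * (σ ^ 2 + q) ^ (p - 1) ≤ (-2 * p * N q + 2 * q * deriv N q)
          - C₁ * Real.sqrt q * (N q + q * |deriv N q|)) ∧
      (∀ q, 0 ≤ q → q ≤ ρ ^ 2 → -(C₂ * ρ ^ (2 * p)) ≤ (-2 * p * N q + 2 * q * deriv N q)
          - C₁ * Real.sqrt q * (N q + q * |deriv N q|)) ∧
      (∀ q, ρ ^ 2 ≤ q → (-2 * p * N q + 2 * q * deriv N q)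
          - C₁ * Real.sqrt q * (N q + q * |deriv N q|) = 0) := by
  obtain ⟨χ, M, hM, hχc, hχ0, hχ1, hχz, hχ'⟩ := exists_cutoff
  refine ⟨3 * M * (2 * 2 ^ (-2 * p)), by positivity, fun C₁ ρ σ hC₁ hρ hσ hsmall => ?_⟩
  set b : ℝ → ℝ := fun q => (σ ^ 2 + q) ^ p + ρ⁻¹ * (σ ^ 2 + q) ^ (p + 1 / 2) with hb
  set b' : ℝ → ℝ := fun q => p * (σ ^ 2 + q) ^ (p - 1)
    + ρ⁻¹ * ((p + 1 / 2) * (σ ^ 2 + q) ^ (p + 1 / 2 - 1)) with hb'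
  have hs : ∀ q, 0 ≤ q → 0 < σ ^ 2 + q := fun q hq => by positivity
  have hsd : ∀ q, HasDerivAt (fun q => σ ^ 2 + q) 1 q := fun q =>
    (hasDerivAt_id q).const_add _
  have hbd : ∀ q, 0 ≤ q → HasDerivAt b (b' q) q := fun q hq => by
    have h1 := (hsd q).rpow_const (p := p) (Or.inl (hs q hq).ne')
    have h2 := (hsd q).rpow_const (p := p + 1 / 2) (Or.inl (hs q hq).ne')
    have h3 := h1.add (h2.const_mul ρ⁻¹)
    refine h3.congr_deriv ?_
    simp only [hb', one_mul]
  have hbc : ∀ q, 0 ≤ q → ContDiffAt ℝ 2 b q := fun q hq => by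
    have h0 : ContDiffAt ℝ 2 (fun q : ℝ => σ ^ 2 + q) q := contDiffAt_const.add contDiffAt_id
    exact (h0.rpow_const_of_ne (hs q hq).ne').add
      (contDiffAt_const.mul (h0.rpow_const_of_ne (hs q hq).ne'))
  set N : ℝ → ℝ := fun q => b q * χ (q / ρ ^ 2) with hN
  have hNd : ∀ q, 0 ≤ q → deriv N q = b' q * χ (q / ρ ^ 2)
      + b q * (deriv χ (q / ρ ^ 2) / ρ ^ 2) := fun q hq => by
    have h1 : HasDerivAt (fun q : ℝ => q / ρ ^ 2) (1 / ρ ^ 2) q := (hasDerivAt_id q).div_const _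
    have h2 : HasDerivAt (fun q => χ (q / ρ ^ 2)) (deriv χ (q / ρ ^ 2) * (1 / ρ ^ 2)) q :=
      ((hχc.differentiable (by norm_num)).differentiableAt.hasDerivAt).comp q h1
    have h3 : HasDerivAt N _ q := (hbd q hq).mul h2
    rw [h3.deriv]; ring
  have hρ2 : 0 < ρ ^ 2 := by positivity
  have hcore : ∀ q, 0 ≤ q → q ≤ ρ ^ 2 → 0 ≤ b q ∧ b' q ≤ 0 ∧
      -2 * p * σ ^ 2 * (σ ^ 2 + q) ^ (p - 1) ≤
        (-2 * p * b q + 2 * q * b' q) - C₁ * Real.sqrt q * (b q + q * |b' q|) := fun q hq hqρ => by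
    have hsq := hs q hq
    have hr : Real.sqrt (σ ^ 2 + q) = (σ ^ 2 + q) ^ (1 / 2 : ℝ) := Real.sqrt_eq_rpow _
    have e1 : (σ ^ 2 + q) ^ p = (σ ^ 2 + q) * (σ ^ 2 + q) ^ (p - 1) := by
      rw [Real.rpow_sub_one hsq.ne']; field_simp
    have e2 : (σ ^ 2 + q) ^ (p + 1 / 2 - 1) =
        Real.sqrt (σ ^ 2 + q) * (σ ^ 2 + q) ^ (p - 1) := by
      rw [hr, ← Real.rpow_add hsq]; congr 1; ring
    have e3 : (σ ^ 2 + q) ^ (p + 1 / 2) =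
        (σ ^ 2 + q) * Real.sqrt (σ ^ 2 + q) * (σ ^ 2 + q) ^ (p - 1) := by
      rw [mul_assoc, ← e2, Real.rpow_sub_one hsq.ne']; field_simp
    refine weight_core (s := σ ^ 2 + q) (r := Real.sqrt (σ ^ 2 + q)) hp hq rfl
      (Real.sqrt_nonneg _) (by positivity) hρ hC₁ hsmall (Real.sqrt_nonneg _)
      (Real.sqrt_le_sqrt (by nlinarith)) (Real.sqrt_le_iff.2 ⟨hρ.le, hqρ⟩) ?_ ?_
    · simp only [hb, e1, e3]
    · simp only [hb', e2]
  have hb0 : ∀ q, 0 ≤ q → 0 ≤ b q := fun q hq => by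
    have := hs q hq
    simp only [hb]; positivity
  have hb'0 : ∀ q, 0 ≤ q → b' q ≤ 0 := fun q hq => by
    have hsq := hs q hq
    have h1 : 0 ≤ (σ ^ 2 + q) ^ (p - 1) := by positivity
    have h2 : 0 ≤ ρ⁻¹ * (σ ^ 2 + q) ^ (p + 1 / 2 - 1) := by positivity
    simp only [hb']
    nlinarith
  have hN'0 : ∀ q, 0 ≤ q → deriv N q ≤ 0 := fun q hq => by
    rw [hNd q hq]
    have h1 := mul_nonpos_of_nonpos_of_nonneg (hb'0 q hq) (hχ0 (q / ρ ^ 2))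
    have h2 := mul_nonpos_of_nonneg_of_nonpos (hb0 q hq)
      (div_nonpos_of_nonpos_of_nonneg (hχ' (q / ρ ^ 2)).1 hρ2.le)
    linarith
  have hnear : ∀ q, 0 ≤ q → q ≤ ρ ^ 2 / 4 → N q = b q ∧ deriv N q = b' q := fun q hq hqρ => by
    have h1 := hχ1 (q / ρ ^ 2) (by rw [div_le_iff₀ hρ2]; linarith)
    rw [hNd q hq, h1.2]
    simp only [hN, h1.1]
    constructor <;> ring
  have hzero : ∀ q, ρ ^ 2 ≤ q → N q = 0 ∧ deriv N q = 0 := fun q hqρ => by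
    have h1 := hχz (q / ρ ^ 2) (by rw [le_div_iff₀ hρ2]; linarith)
    rw [hNd q (hρ2.le.trans hqρ), h1.2, h1.1]
    simp only [hN, h1.1]
    constructor <;> ring
  refine ⟨N, fun q hq => ?_, fun q hq => mul_nonneg (hb0 q hq) (hχ0 _), hN'0,
    fun q hq => (hzero q hq).1, fun q hq hqρ => ?_, fun q hq hqρ => ?_, fun q hq => ?_⟩
  · exact (hbc q hq).mul (hχc.contDiffAt.comp q (contDiffAt_id.div_const _))
  · obtain ⟨h1, h2⟩ := hnear q hq hqρ
    rw [h1, h2]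
    refine ⟨?_, (hcore q hq (by linarith)).2.2⟩
    have := hs q hq
    simp only [hb]
    exact le_add_of_nonneg_right (by positivity)
  · obtain ⟨h1, h2, h3⟩ := hcore q hq hqρ
    have hG : 0 ≤ (-2 * p * b q + 2 * q * b' q) - C₁ * Real.sqrt q * (b q + q * |b' q|) := by
      refine h3.trans' ?_
      have := hs q hq
      have : 0 ≤ -2 * p := by linarith
      positivity
    rcases le_total q (ρ ^ 2 / 4) with hq4 | hq4
    · obtain ⟨h5, h6⟩ := hnear q hq hq4
      rw [h5, h6]
      refine hG.trans' ?_
      have : 0 ≤ 3 * M * (2 * 2 ^ (-2 * p)) * ρ ^ (2 * p) := by positivity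
      linarith
    · have hbq := rpow_weight_le (s := σ ^ 2 + q) hp hρ (by nlinarith)
      change b q ≤ _ at hbq
      rw [abs_of_nonpos (hN'0 q hq)]
      rw [abs_of_nonpos h2] at hG
      have hNq : N q = b q * χ (q / ρ ^ 2) := rfl
      rw [hNq, hNd q hq]
      obtain ⟨h7, h8⟩ := hχ' (q / ρ ^ 2)
      rw [abs_of_nonpos h7] at h8
      have h9 := hχ0 (q / ρ ^ 2)
      set k := χ (q / ρ ^ 2)
      set k' := deriv χ (q / ρ ^ 2)
      set z := q / ρ ^ 2 with hz
      have hz0 : 0 ≤ z := by positivity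
      have hz1 : z ≤ 1 := by rw [hz, div_le_one hρ2]; exact hqρ
      have e1 : q * (k' / ρ ^ 2) = z * k' := by rw [hz]; field_simp
      have hCe : C₁ * Real.sqrt q ≤ 1 := by
        have : Real.sqrt q ≤ ρ := Real.sqrt_le_iff.2 ⟨hρ.le, hqρ⟩
        have : C₁ * Real.sqrt q ≤ C₁ * ρ := by gcongr
        nlinarith [mul_nonneg hC₁ hρ.le]
      have hCe0 : 0 ≤ C₁ * Real.sqrt q := by positivity
      have e2 : (2 + C₁ * Real.sqrt q) * (z * -k') * b q ≤ 3 * (1 * M) * b q := by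
        have : 0 ≤ -k' := by linarith
        gcongr
        linarith
      have e3 := mul_le_mul_of_nonneg_left hbq (show 0 ≤ 3 * (1 * M) by positivity)
      have e4 := mul_nonneg h9 hG
      have e5 : (-2 * p * (b q * k) + 2 * q * (b' q * k + b q * (k' / ρ ^ 2))) -
          C₁ * Real.sqrt q * (b q * k + q * -(b' q * k + b q * (k' / ρ ^ 2))) =
          k * ((-2 * p * b q + 2 * q * b' q) - C₁ * Real.sqrt q * (b q + q * -b' q))
          + (2 + C₁ * Real.sqrt q) * (q * (k' / ρ ^ 2)) * b q := by ring
      rw [e5, e1]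
      linarith
  · rw [(hzero q hq).1, (hzero q hq).2]; simp

section
variable {n : ℕ} {c κ L ε β ρ σ : ℝ} {a : Euc n → (Euc n →L[ℝ] Euc n)} {w : Euc n → ℝ}
  {A : Euc n →L[ℝ] Euc n} {x₀ : Euc n} {u : Euc n → ℂ}

/-- The weighted potential density. -/
def pot {n : ℕ} (ε : ℝ) (w : Euc n → ℝ) (u : Euc n → ℂ) (y : Euc n) : ℝ :=
  w y * ((1 - ‖u y‖ ^ 2) ^ 2 / (4 * ε ^ 2))

theorem Coeffs.pot_nonneg (ha : Coeffs n c κ L a w) {y : Euc n} (hy : y ∈ ball (0 : Euc n) 1) :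
    0 ≤ pot ε w u y := mul_nonneg (ha.w_nonneg y hy) (by positivity)

theorem WeakSol.integrableOn_wpot (ha : Coeffs n c κ L a w) (hu : WeakSol n ε a w u) :
    IntegrableOn (pot ε w u) (ball 0 1) := by
  refine Integrable.mono' (hu.integrableOn_pot.const_mul κ)
    (ha.aesm_w.mul hu.integrableOn_pot.aestronglyMeasurable) ?_
  filter_upwards [ae_restrict_mem measurableSet_ball] with y hy
  rw [Real.norm_of_nonneg (ha.pot_nonneg hy)]
  exact mul_le_mul_of_nonneg_right (ha.w_bdd y hy) (by positivity)

theorem integrableOn_rpow_quad_mul (hA : AdaptedAt n c β a w A x₀) {p : ℝ} (hp : p ≤ 0)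
    (hσ : 0 < σ) {f : Euc n → ℝ} (hf : IntegrableOn f (ball 0 1)) :
    IntegrableOn (fun y => (σ ^ 2 + quad A x₀ y) ^ p * f y) (ball 0 1) := by
  have hQc : Continuous (quad A x₀) := (contDiff_quad A x₀).continuous
  have hs : ∀ y, 0 < σ ^ 2 + quad A x₀ y := fun y => by
    have := hA.quad_nonneg y
    positivity
  have hc : Continuous fun y => (σ ^ 2 + quad A x₀ y) ^ p :=
    (continuous_const.add hQc).rpow_const fun y => Or.inl (hs y).ne'
  refine Integrable.mono' (hf.norm.const_mul ((σ ^ 2) ^ p))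
    (hc.aestronglyMeasurable.mul hf.aestronglyMeasurable) (ae_of_all _ fun y => ?_)
  rw [norm_mul, Real.norm_of_nonneg (Real.rpow_nonneg (hs y).le _)]
  refine mul_le_mul_of_nonneg_right ?_ (norm_nonneg _)
  exact Real.rpow_le_rpow_of_nonpos (by positivity)
    (le_add_of_nonneg_right (hA.quad_nonneg y)) hp

/-- Weighted energy bounds on ellipsoids. -/
theorem exists_weighted_bound (n : ℕ) (hn : 3 ≤ n) : ∃ C₂ > 0, ∀ {c κ L ε β ρ σ : ℝ}
    {a : Euc n → (Euc n →L[ℝ] Euc n)} {w : Euc n → ℝ} {A : Euc n →L[ℝ] Euc n} {x₀ : Euc n}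
    {u : Euc n → ℂ}, 0 < ε → Coeffs n c κ L a w → AdaptedAt n c β a w A x₀ → WeakSol n ε a w u →
    0 < ρ → 0 < σ → β * ρ < 1 - ‖x₀‖ → 8 * L * β ^ 4 / c * (n * ρ) ≤ 1 →
    ∫ y in ball 0 1 ∩ {y | quad A x₀ y ≤ ρ ^ 2 / 4},
      ((n - 2) * σ ^ 2 * ((σ ^ 2 + quad A x₀ y) ^ ((2 - n) / 2 - 1 : ℝ) *
        en ε (a y) (w y) (fderiv ℝ u y) (u y))
      + 2 * ((σ ^ 2 + quad A x₀ y) ^ ((2 - n) / 2 : ℝ) * pot ε w u y))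
    ≤ C₂ * ρ ^ (2 - n : ℝ) * ∫ y in ball 0 1 ∩ {y | quad A x₀ y ≤ ρ ^ 2},
        en ε (a y) (w y) (fderiv ℝ u y) (u y) := by
  have hn' : (3 : ℝ) ≤ n := by exact_mod_cast hn
  set p : ℝ := (2 - n) / 2 with hp
  have hp2 : p ≤ -1 / 2 := by rw [hp]; linarith
  obtain ⟨C₂, hC₂, hw⟩ := exists_weight hp2
  refine ⟨C₂, hC₂, fun {c κ L ε β ρ σ a w A x₀ u} hε ha hA hu hρ hσ hρB hsmall => ?_⟩
  have hL := ha.L_nonneg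
  have hc := ha.c_pos
  have hβ := hA.one_le
  have hQc : Continuous (quad A x₀) := (contDiff_quad A x₀).continuous
  obtain ⟨N, hNc, hN0, hN', hNz, hnear, hmid, hfar⟩ := hw (8 * L * β ^ 4 / c) ρ σ
    (by positivity) hρ hσ (by
      have e : 2 * (1 - p) = n := by rw [hp]; ring
      calc _ = 8 * L * β ^ 4 / c * (2 * (1 - p) * ρ) := by ring
        _ ≤ 1 := by rw [e]; exact hsmall)
  have e2p : -2 * p = n - 2 := by rw [hp]; ring
  have e2p' : 2 * p = 2 - n := by rw [hp]; ring
  rw [e2p] at hnear hmid hfar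
  rw [e2p'] at hmid
  set E : Euc n → ℝ := fun y => en ε (a y) (w y) (fderiv ℝ u y) (u y) with hE
  have hEi : IntegrableOn E (ball 0 1) := ha.integrableOn_en hu.diff hu.le_one hu.grad
  have hE0 : ∀ y ∈ ball (0 : Euc n) 1, 0 ≤ E y := fun y hy => ha.en_nonneg hy _ _
  set f : Euc n → ℝ := fun y => (n - 2) * σ ^ 2 * ((σ ^ 2 + quad A x₀ y) ^ (p - 1) * E y)
      + 2 * ((σ ^ 2 + quad A x₀ y) ^ p * pot ε w u y) with hf
  have hfi : IntegrableOn f (ball 0 1) :=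
    ((integrableOn_rpow_quad_mul hA (by linarith) hσ hEi).const_mul _).add
      ((integrableOn_rpow_quad_mul hA (by linarith) hσ (hu.integrableOn_wpot ha)).const_mul _)
  have hS₁ : MeasurableSet {y | quad A x₀ y ≤ ρ ^ 2 / 4} :=
    (isClosed_le hQc continuous_const).measurableSet
  have hS₂ : MeasurableSet {y | quad A x₀ y ≤ ρ ^ 2} :=
    (isClosed_le hQc continuous_const).measurableSet
  have hi1 := hfi.indicator hS₁
  have hi2 := (hEi.indicator hS₂).const_mul (C₂ * ρ ^ (2 - n : ℝ))
  have key := hu.radial_inequality hε ha hA hNc hN0 hN' hNz hρ.le hρB (hi1.sub hi2)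
    fun y hy => by
      have hq := hA.quad_nonneg y
      have hEy := hE0 y hy
      have hPy := ha.pot_nonneg (ε := ε) (u := u) hy
      have hCρ : 0 ≤ C₂ * ρ ^ (2 - n : ℝ) := by positivity
      change Set.indicator _ f y - C₂ * ρ ^ (2 - n : ℝ) * Set.indicator _ E y ≤ _ * E y +
        2 * N (quad A x₀ y) * pot ε w u y
      have hNP := mul_nonneg (hN0 _ hq) hPy
      by_cases h2 : quad A x₀ y ≤ ρ ^ 2
      · rw [Set.indicator_of_mem (s := {y | quad A x₀ y ≤ ρ ^ 2}) h2]
        have h3 := mul_le_mul_of_nonneg_right (hmid _ hq h2) hEy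
        by_cases h1 : quad A x₀ y ≤ ρ ^ 2 / 4
        · rw [Set.indicator_of_mem (s := {y | quad A x₀ y ≤ ρ ^ 2 / 4}) h1]
          obtain ⟨h4, h5⟩ := hnear _ hq h1
          have h6 := mul_le_mul_of_nonneg_right h5 hEy
          have h7 := mul_le_mul_of_nonneg_right h4 hPy
          have h8 := mul_nonneg hCρ hEy
          simp only [hf]
          linarith
        · rw [Set.indicator_of_notMem (s := {y | quad A x₀ y ≤ ρ ^ 2 / 4}) h1]
          linarith
      · have h1 : ¬ quad A x₀ y ≤ ρ ^ 2 / 4 := fun h => h2 (h.trans (by nlinarith))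
        rw [Set.indicator_of_notMem (s := {y | quad A x₀ y ≤ ρ ^ 2 / 4}) h1,
          Set.indicator_of_notMem (s := {y | quad A x₀ y ≤ ρ ^ 2}) h2, hfar _ (not_le.1 h2).le]
        linarith
  have e1 := integral_sub hi1 hi2
  rw [integral_const_mul, setIntegral_indicator hS₁, setIntegral_indicator hS₂] at e1
  have e2 := e1.symm.trans_le key
  linarith

/-- Energy monotonicity on ellipsoids. -/
theorem exists_energy_bound (n : ℕ) (hn : 3 ≤ n) : ∃ C₃ > 0, ∀ {c κ L ε β ρ σ : ℝ}
    {a : Euc n → (Euc n →L[ℝ] Euc n)} {w : Euc n → ℝ} {A : Euc n →L[ℝ] Euc n} {x₀ : Euc n}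
    {u : Euc n → ℂ}, 0 < ε → Coeffs n c κ L a w → AdaptedAt n c β a w A x₀ → WeakSol n ε a w u →
    0 < ρ → 0 < σ → σ ≤ ρ / 2 → β * ρ < 1 - ‖x₀‖ → 8 * L * β ^ 4 / c * (n * ρ) ≤ 1 →
    σ ^ (2 - n : ℝ) * ∫ y in ball 0 1 ∩ {y | quad A x₀ y ≤ σ ^ 2},
        en ε (a y) (w y) (fderiv ℝ u y) (u y)
    ≤ C₃ * ρ ^ (2 - n : ℝ) * ∫ y in ball 0 1 ∩ {y | quad A x₀ y ≤ ρ ^ 2},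
        en ε (a y) (w y) (fderiv ℝ u y) (u y) := by
  obtain ⟨C₂, hC₂, h⟩ := exists_weighted_bound n hn
  have hn' : (3 : ℝ) ≤ n := by exact_mod_cast hn
  set p : ℝ := (2 - n) / 2 with hp
  have e2p' : 2 * p = 2 - n := by rw [hp]; ring
  refine ⟨C₂ * 2 ^ (1 - p), by positivity,
    fun {c κ L ε β ρ σ a w A x₀ u} hε ha hA hu hρ hσ hσρ hρB hsmall => ?_⟩
  have h1 := h hε ha hA hu hρ hσ hρB hsmall
  set E : Euc n → ℝ := fun y => en ε (a y) (w y) (fderiv ℝ u y) (u y) with hE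
  have hEi : IntegrableOn E (ball 0 1) := ha.integrableOn_en hu.diff hu.le_one hu.grad
  have hE0 : ∀ y ∈ ball (0 : Euc n) 1, 0 ≤ E y := fun y hy => ha.en_nonneg hy _ _
  have hQc : Continuous (quad A x₀) := (contDiff_quad A x₀).continuous
  have hS : ∀ r, MeasurableSet (ball (0 : Euc n) 1 ∩ {y | quad A x₀ y ≤ r}) := fun r =>
    measurableSet_ball.inter (isClosed_le hQc continuous_const).measurableSet
  have hfi : IntegrableOn (fun y => (n - 2) * σ ^ 2 * ((σ ^ 2 + quad A x₀ y) ^ (p - 1) * E y)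
      + 2 * ((σ ^ 2 + quad A x₀ y) ^ p * pot ε w u y)) (ball 0 1) :=
    ((integrableOn_rpow_quad_mul hA (by linarith) hσ hEi).const_mul _).add
      ((integrableOn_rpow_quad_mul hA (by linarith) hσ (hu.integrableOn_wpot ha)).const_mul _)
  have h2 : 2 ^ (p - 1) * σ ^ (2 - n : ℝ) * ∫ y in ball 0 1 ∩ {y | quad A x₀ y ≤ σ ^ 2}, E y ≤
      ∫ y in ball 0 1 ∩ {y | quad A x₀ y ≤ ρ ^ 2 / 4},
        ((n - 2) * σ ^ 2 * ((σ ^ 2 + quad A x₀ y) ^ (p - 1) * E y)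
      + 2 * ((σ ^ 2 + quad A x₀ y) ^ p * pot ε w u y)) := by
    rw [← integral_const_mul]
    refine (setIntegral_mono_on ((hEi.mono_set Set.inter_subset_left).const_mul _)
      (hfi.mono_set Set.inter_subset_left) (hS _) fun y hy => ?_).trans
      (setIntegral_mono_set (hfi.mono_set Set.inter_subset_left) ?_ ?_)
    · have hq := hA.quad_nonneg y
      have h3 : (2 * σ ^ 2) ^ (p - 1) ≤ (σ ^ 2 + quad A x₀ y) ^ (p - 1) :=
        Real.rpow_le_rpow_of_nonpos (by positivity)
          (by have : quad A x₀ y ≤ σ ^ 2 := hy.2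
              linarith) (by linarith)
      have h4 : (2 * σ ^ 2) ^ (p - 1) * σ ^ 2 = 2 ^ (p - 1) * σ ^ (2 - n : ℝ) := by
        rw [Real.mul_rpow (by norm_num) (by positivity), mul_assoc,
          Real.rpow_sub_one (x := σ ^ 2) (by positivity), div_mul_cancel₀ _ (by positivity),
          ← Real.rpow_two, ← Real.rpow_mul hσ.le, e2p']
      have h5 := hE0 y hy.1
      have h6 := ha.pot_nonneg (ε := ε) (u := u) hy.1
      have h7 : 0 ≤ (σ ^ 2 + quad A x₀ y) ^ p * pot ε w u y := by positivity
      rw [← h4]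
      have h8 : (2 * σ ^ 2) ^ (p - 1) * σ ^ 2 * E y ≤
        1 * σ ^ 2 * ((σ ^ 2 + quad A x₀ y) ^ (p - 1) * E y) := by
        have := mul_le_mul_of_nonneg_right h3 (mul_nonneg (sq_nonneg σ) h5)
        linarith
      have h9 : 1 * σ ^ 2 * ((σ ^ 2 + quad A x₀ y) ^ (p - 1) * E y) ≤
        (n - 2) * σ ^ 2 * ((σ ^ 2 + quad A x₀ y) ^ (p - 1) * E y) := by
        gcongr; linarith
      linarith
    · filter_upwards [ae_restrict_mem (hS _)] with y hy
      have hq := hA.quad_nonneg y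
      have h5 := hE0 y hy.1
      have h6 := ha.pot_nonneg (ε := ε) (u := u) hy.1
      have : (0 : ℝ) ≤ n - 2 := by linarith
      positivity
    · refine (Set.inter_subset_inter_right _ fun y hy => ?_).eventuallyLE
      exact (show quad A x₀ y ≤ σ ^ 2 from hy).trans (by nlinarith)
  have h3 := h2.trans h1
  have h4 := mul_le_mul_of_nonneg_left h3 (show (0 : ℝ) ≤ 2 ^ (1 - p) by positivity)
  have h5 : (2 : ℝ) ^ (1 - p) * 2 ^ (p - 1) = 1 := by
    rw [← Real.rpow_add (by norm_num)]; norm_num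
  rw [← mul_assoc, ← mul_assoc, h5, one_mul] at h4
  linarith

/-- Weighted bound for the potential on ellipsoids. -/
theorem exists_pot_bound (n : ℕ) (hn : 3 ≤ n) : ∃ C₃ > 0, ∀ {c κ L ε β ρ : ℝ}
    {a : Euc n → (Euc n →L[ℝ] Euc n)} {w : Euc n → ℝ} {A : Euc n →L[ℝ] Euc n} {x₀ : Euc n}
    {u : Euc n → ℂ}, 0 < ε → Coeffs n c κ L a w → AdaptedAt n c β a w A x₀ → WeakSol n ε a w u →
    0 < ρ → β * ρ < 1 - ‖x₀‖ → 8 * L * β ^ 4 / c * (n * ρ) ≤ 1 →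
    IntegrableOn (fun y => ‖y - x₀‖ ^ (2 - n : ℝ) * pot ε w u y)
      (ball 0 1 ∩ {y | quad A x₀ y ≤ ρ ^ 2 / 4}) →
    ∫ y in ball 0 1 ∩ {y | quad A x₀ y ≤ ρ ^ 2 / 4}, ‖y - x₀‖ ^ (2 - n : ℝ) * pot ε w u y
    ≤ C₃ * β ^ ((n - 2) / 2 : ℝ) * ρ ^ (2 - n : ℝ) * ∫ y in ball 0 1 ∩ {y | quad A x₀ y ≤ ρ ^ 2},
        en ε (a y) (w y) (fderiv ℝ u y) (u y) := by
  obtain ⟨C₂, hC₂, h⟩ := exists_weighted_bound n hn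
  have hn' : (3 : ℝ) ≤ n := by exact_mod_cast hn
  set p : ℝ := (2 - n) / 2 with hp
  have e2p' : 2 * p = 2 - n := by rw [hp]; ring
  have ep : (n - 2) / 2 = -p := by rw [hp]; ring
  refine ⟨C₂, hC₂, fun {c κ L ε β ρ a w A x₀ u} hε ha hA hu hρ hρB hsmall hint => ?_⟩
  rw [ep]
  set E : Euc n → ℝ := fun y => en ε (a y) (w y) (fderiv ℝ u y) (u y) with hE
  have hEi : IntegrableOn E (ball 0 1) := ha.integrableOn_en hu.diff hu.le_one hu.grad
  have hE0 : ∀ y ∈ ball (0 : Euc n) 1, 0 ≤ E y := fun y hy => ha.en_nonneg hy _ _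
  have hβ := hA.one_le
  have hQc : Continuous (quad A x₀) := (contDiff_quad A x₀).continuous
  set S := ball (0 : Euc n) 1 ∩ {y | quad A x₀ y ≤ ρ ^ 2 / 4} with hSdef
  have hS : MeasurableSet S :=
    measurableSet_ball.inter (isClosed_le hQc continuous_const).measurableSet
  set R := C₂ * ρ ^ (2 - n : ℝ) * ∫ y in ball 0 1 ∩ {y | quad A x₀ y ≤ ρ ^ 2}, E y with hR
  have hPi := (hu.integrableOn_wpot ha).mono_set (Set.inter_subset_left : S ⊆ _)
  have hs : ∀ σ : ℝ, 0 < σ → ∀ y, 0 < σ ^ 2 + β * ‖y - x₀‖ ^ 2 := fun σ hσ y => by positivity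
  have hcw : ∀ σ : ℝ, 0 < σ → Continuous fun y => (σ ^ 2 + β * ‖y - x₀‖ ^ 2) ^ p := fun σ hσ =>
    (by fun_prop : Continuous fun y => σ ^ 2 + β * ‖y - x₀‖ ^ 2).rpow_const
      fun y => Or.inl (hs σ hσ y).ne'
  have hbound : ∀ σ : ℝ, 0 < σ →
      ∫ y in S, (σ ^ 2 + β * ‖y - x₀‖ ^ 2) ^ p * pot ε w u y ≤ R := fun σ hσ => by
    have h1 := h hε ha hA hu hρ hσ hρB hsmall
    refine le_trans ?_ h1
    have hfi : IntegrableOn (fun y => (n - 2) * σ ^ 2 * ((σ ^ 2 + quad A x₀ y) ^ (p - 1) * E y)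
        + 2 * ((σ ^ 2 + quad A x₀ y) ^ p * pot ε w u y)) (ball 0 1) :=
      ((integrableOn_rpow_quad_mul hA (by linarith) hσ hEi).const_mul _).add
        ((integrableOn_rpow_quad_mul hA (by linarith) hσ (hu.integrableOn_wpot ha)).const_mul _)
    refine setIntegral_mono_on ?_ (hfi.mono_set Set.inter_subset_left) hS fun y hy => ?_
    · refine Integrable.mono' (hPi.norm.const_mul ((σ ^ 2) ^ p))
        ((hcw σ hσ).aestronglyMeasurable.mul hPi.aestronglyMeasurable) (ae_of_all _ fun y => ?_)
      rw [norm_mul, Real.norm_of_nonneg (Real.rpow_nonneg (hs σ hσ y).le _)]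
      refine mul_le_mul_of_nonneg_right ?_ (norm_nonneg _)
      exact Real.rpow_le_rpow_of_nonpos (by positivity)
        (le_add_of_nonneg_right (by positivity)) (by linarith)
    · have hq := hA.quad_nonneg y
      have h5 := hE0 y hy.1
      have h6 := ha.pot_nonneg (ε := ε) (u := u) hy.1
      have h7 : (σ ^ 2 + β * ‖y - x₀‖ ^ 2) ^ p ≤ (σ ^ 2 + quad A x₀ y) ^ p := by
        refine Real.rpow_le_rpow_of_nonpos (by positivity) ?_ (by linarith)
        have h8 := real_inner_le_norm (A (y - x₀)) (y - x₀)
        have h9 : ‖A (y - x₀)‖ ≤ β * ‖y - x₀‖ := by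
          have := hA.bdd
          exact (A.le_opNorm _).trans (by gcongr)
        have h10 := mul_le_mul_of_nonneg_right h9 (norm_nonneg (y - x₀))
        unfold quad
        nlinarith
      have h8 := mul_le_mul_of_nonneg_right h7 h6
      have h9 : 0 ≤ (σ ^ 2 + quad A x₀ y) ^ p * pot ε w u y := by positivity
      have h10 : (0 : ℝ) ≤ n - 2 := by linarith
      have h11 : 0 ≤ (n - 2) * σ ^ 2 * ((σ ^ 2 + quad A x₀ y) ^ (p - 1) * E y) := by positivity
      linarith
  have hne : ∀ᵐ y ∂(volume.restrict S), y ≠ x₀ := by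
    have : Nonempty (Fin n) := ⟨⟨0, by omega⟩⟩
    refine ae_restrict_of_ae ?_
    exact Measure.ae_ne volume x₀
  have hrp : ∀ y, y ≠ x₀ → (β * ‖y - x₀‖ ^ 2) ^ p = β ^ p * ‖y - x₀‖ ^ (2 - n : ℝ) := fun y _ => by
    rw [Real.mul_rpow (by linarith) (by positivity), ← Real.rpow_two,
      ← Real.rpow_mul (norm_nonneg _), e2p']
  have hlim : Tendsto (fun j : ℕ => ∫ y in S, ((1 / ((j : ℝ) + 1)) ^ 2 + β * ‖y - x₀‖ ^ 2) ^ p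
      * pot ε w u y) atTop (𝓝 (∫ y in S, β ^ p * (‖y - x₀‖ ^ (2 - n : ℝ) * pot ε w u y))) := by
    refine tendsto_integral_of_dominated_convergence
      (fun y => β ^ p * (‖y - x₀‖ ^ (2 - n : ℝ) * pot ε w u y))
      (fun j => ((hcw _ (by positivity)).aestronglyMeasurable.mul hPi.aestronglyMeasurable))
      (hint.const_mul _) (fun j => ?_) ?_
    · filter_upwards [hne, ae_restrict_mem hS] with y hy hyS
      have h6 := ha.pot_nonneg (ε := ε) (u := u) hyS.1
      have h0 : 0 < ‖y - x₀‖ := norm_pos_iff.2 (sub_ne_zero.2 hy)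
      rw [Real.norm_of_nonneg (mul_nonneg (Real.rpow_nonneg (by positivity) _) h6), ← mul_assoc,
        ← hrp y hy]
      refine mul_le_mul_of_nonneg_right ?_ h6
      exact Real.rpow_le_rpow_of_nonpos (by positivity)
        (le_add_of_nonneg_left (by positivity)) (by linarith)
    · filter_upwards [hne] with y hy
      have h0 : 0 < ‖y - x₀‖ := norm_pos_iff.2 (sub_ne_zero.2 hy)
      rw [← mul_assoc, ← hrp y hy]
      refine Tendsto.mul_const _ ?_
      have h1 : Tendsto (fun j : ℕ => (1 / ((j : ℝ) + 1)) ^ 2 + β * ‖y - x₀‖ ^ 2) atTop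
          (𝓝 (0 ^ 2 + β * ‖y - x₀‖ ^ 2)) :=
        (tendsto_one_div_add_atTop_nhds_zero_nat.pow 2).add_const _
      rw [zero_pow two_ne_zero, zero_add] at h1
      exact h1.rpow_const (Or.inl (by positivity))
  have h1 := le_of_tendsto' hlim fun j => hbound _ (by positivity)
  rw [integral_const_mul] at h1
  have h2 := mul_le_mul_of_nonneg_left h1 (show 0 ≤ β ^ (-p) by positivity)
  rw [← mul_assoc, ← Real.rpow_add (by linarith), neg_add_cancel, Real.rpow_zero, one_mul] at h2
  refine h2.trans_eq ?_
  rw [hR]; ring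

end

section
variable {n : ℕ} {c κ L ε β ρ σ : ℝ} {a : Euc n → (Euc n →L[ℝ] Euc n)} {w : Euc n → ℝ}
  {A : Euc n →L[ℝ] Euc n} {x₀ : Euc n} {u : Euc n → ℂ}

theorem AdaptedAt.quad_le (hA : AdaptedAt n c β a w A x₀) (x : Euc n) :
    quad A x₀ x ≤ β * ‖x - x₀‖ ^ 2 := by
  refine (real_inner_le_norm _ _).trans ?_
  calc ‖A (x - x₀)‖ * ‖x - x₀‖ ≤ (β * ‖x - x₀‖) * ‖x - x₀‖ := by
        gcongr
        exact A.le_of_opNorm_le hA.bdd _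
    _ = β * ‖x - x₀‖ ^ 2 := by ring

theorem AdaptedAt.norm_le_of_quad_le (hA : AdaptedAt n c β a w A x₀) {x : Euc n} {r : ℝ}
    (hr : 0 ≤ r) (h : quad A x₀ x ≤ r ^ 2) : ‖x - x₀‖ ≤ β * r := by
  have hβ := hA.one_le
  refine (hA.norm_le x).trans ?_
  gcongr
  exact (Real.sqrt_le_sqrt h).trans (Real.sqrt_sq hr).le

theorem AdaptedAt.quad_le_of_norm_le (hA : AdaptedAt n c β a w A x₀) {x : Euc n} {r : ℝ}
    (hr : ‖x - x₀‖ ≤ r) : quad A x₀ x ≤ (β * r) ^ 2 := by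
  have hβ := hA.one_le
  have h0 := norm_nonneg (x - x₀)
  calc quad A x₀ x ≤ β * ‖x - x₀‖ ^ 2 := hA.quad_le x
    _ ≤ β * r ^ 2 := by gcongr
    _ ≤ (β * r) ^ 2 := by rw [mul_pow]; gcongr; nlinarith

theorem Coeffs.pot_le_en (ha : Coeffs n c κ L a w) {y : Euc n} (hy : y ∈ ball (0 : Euc n) 1) :
    pot ε w u y ≤ en ε (a y) (w y) (fderiv ℝ u y) (u y) := by
  have h1 := ha.qform_nonneg hy (fderiv ℝ u y)
  have h2 := mul_nonneg ha.c_pos.le (sq_nonneg ‖fderiv ℝ u y‖)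
  unfold pot en
  linarith

end

theorem ball_subset_unitBall {n : ℕ} {x₀ : Euc n} {r : ℝ} (hr : r ≤ 1 - ‖x₀‖) :
    ball x₀ r ⊆ ball (0 : Euc n) 1 :=
  ball_subset_ball' (by rw [dist_zero_right]; linarith)

theorem exists_scale (n : ℕ) {c L β : ℝ} (hc : 0 < c) (hL : 0 ≤ L) (hβ : 0 < β) :
    ∃ θ > 0, β * θ ≤ 1 / 2 ∧ 8 * L * β ^ 4 / c * (n * θ) ≤ 1 := by
  set M := 8 * L * β ^ 4 / c * n with hM
  have hM0 : 0 ≤ M := by positivity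
  refine ⟨1 / (2 * β + M), by positivity, ?_, ?_⟩
  · rw [mul_one_div, div_le_div_iff₀ (by positivity) (by norm_num)]; linarith
  · rw [← mul_assoc, ← hM, mul_one_div, div_le_one (by positivity)]; linarith

/-- Energy monotonicity on balls, up to a constant. -/
theorem exists_energy_ball_bound (n : ℕ) (hn : 3 ≤ n) {c L β : ℝ} (hc : 0 < c) (hL : 0 ≤ L)
    (hβ : 1 ≤ β) : ∃ C > 0, ∀ {κ ε σ ρ : ℝ}
    {a : Euc n → (Euc n →L[ℝ] Euc n)} {w : Euc n → ℝ} {A : Euc n →L[ℝ] Euc n} {x₀ : Euc n}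
    {u : Euc n → ℂ}, 0 < ε → Coeffs n c κ L a w → AdaptedAt n c β a w A x₀ → WeakSol n ε a w u →
    0 < σ → σ ≤ ρ → ρ < 1 - ‖x₀‖ →
    σ ^ (2 - n : ℝ) * ∫ y in ball x₀ σ, en ε (a y) (w y) (fderiv ℝ u y) (u y)
    ≤ C * ρ ^ (2 - n : ℝ) * ∫ y in ball x₀ ρ, en ε (a y) (w y) (fderiv ℝ u y) (u y) := by
  obtain ⟨C₃, hC₃, h⟩ := exists_energy_bound n hn
  have hn' : (3 : ℝ) ≤ n := by exact_mod_cast hn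
  have hβ0 : 0 < β := by linarith
  obtain ⟨θ, hθ, hθ1, hθ2⟩ := exists_scale n hc hL hβ0
  refine ⟨β ^ (n - 2 : ℝ) * C₃ * θ ^ (2 - n : ℝ) + (θ / (2 * β)) ^ (2 - n : ℝ), by positivity,
    fun {κ ε σ ρ a w A x₀ u} hε ha hA hu hσ hσρ hρB => ?_⟩
  have hρ : 0 < ρ := hσ.trans_le hσρ
  set E : Euc n → ℝ := fun y => en ε (a y) (w y) (fderiv ℝ u y) (u y) with hE
  have hEi : IntegrableOn E (ball 0 1) := ha.integrableOn_en hu.diff hu.le_one hu.grad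
  have hE0 : ∀ y ∈ ball (0 : Euc n) 1, 0 ≤ E y := fun y hy => ha.en_nonneg hy _ _
  have hsubρ := ball_subset_unitBall hρB.le
  have hmono : ∀ {S T : Set (Euc n)}, MeasurableSet T → S ⊆ T → T ⊆ ball 0 1 →
      ∫ y in S, E y ≤ ∫ y in T, E y := fun {S T} hT hST hTB =>
    setIntegral_mono_set (hEi.mono_set hTB)
      ((ae_restrict_mem hT).mono fun y hy => hE0 y (hTB hy)) hST.eventuallyLE
  have hIρ : 0 ≤ ∫ y in ball x₀ ρ, E y :=
    setIntegral_nonneg measurableSet_ball fun y hy => hE0 y (hsubρ hy)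
  have hQc : Continuous (quad A x₀) := (contDiff_quad A x₀).continuous
  have hS : ∀ r, MeasurableSet (ball (0 : Euc n) 1 ∩ {y | quad A x₀ y ≤ r}) := fun r =>
    measurableSet_ball.inter (isClosed_le hQc continuous_const).measurableSet
  have hc1 : 0 ≤ (θ / (2 * β)) ^ (2 - n : ℝ) * ρ ^ (2 - n : ℝ) * ∫ y in ball x₀ ρ, E y :=
    mul_nonneg (by positivity) hIρ
  have hc2 : 0 ≤ β ^ (n - 2 : ℝ) * C₃ * θ ^ (2 - n : ℝ) * ρ ^ (2 - n : ℝ) *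
    ∫ y in ball x₀ ρ, E y := mul_nonneg (by positivity) hIρ
  rw [add_mul, add_mul]
  by_cases hcase : β * σ ≤ θ * ρ / 2
  · refine le_trans ?_ (le_add_of_nonneg_right hc1)
    have h1 := h (ρ := θ * ρ) (σ := β * σ) hε ha hA hu (by positivity) (by positivity) hcase
      (by nlinarith) (by
        have : 8 * L * β ^ 4 / c * (n * (θ * ρ)) = 8 * L * β ^ 4 / c * (n * θ) * ρ := by ring
        rw [this]
        have := norm_nonneg x₀
        exact mul_le_one₀ hθ2 hρ.le (by linarith))
    have h2 : ∫ y in ball x₀ σ, E y ≤ ∫ y in ball 0 1 ∩ {y | quad A x₀ y ≤ (β * σ) ^ 2}, E y :=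
      hmono (hS _) (fun y hy => ⟨hsubρ (ball_subset_ball hσρ hy), hA.quad_le_of_norm_le
        (by rw [mem_ball, dist_eq_norm] at hy; exact hy.le)⟩) Set.inter_subset_left
    have h3 : ∫ y in ball 0 1 ∩ {y | quad A x₀ y ≤ (θ * ρ) ^ 2}, E y ≤ ∫ y in ball x₀ ρ, E y :=
      hmono measurableSet_ball (fun y hy => by
        rw [mem_ball, dist_eq_norm]
        refine (hA.norm_le_of_quad_le (by positivity) hy.2).trans_lt ?_
        nlinarith) hsubρ
    have e1 : σ ^ (2 - n : ℝ) = β ^ (n - 2 : ℝ) * (β * σ) ^ (2 - n : ℝ) := by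
      rw [Real.mul_rpow hβ0.le hσ.le, ← mul_assoc, ← Real.rpow_add hβ0]; simp
    calc σ ^ (2 - n : ℝ) * ∫ y in ball x₀ σ, E y
        ≤ σ ^ (2 - n : ℝ) * ∫ y in ball 0 1 ∩ {y | quad A x₀ y ≤ (β * σ) ^ 2}, E y := by gcongr
      _ ≤ β ^ (n - 2 : ℝ) * (C₃ * (θ * ρ) ^ (2 - n : ℝ) *
          ∫ y in ball 0 1 ∩ {y | quad A x₀ y ≤ (θ * ρ) ^ 2}, E y) := by
        rw [e1, mul_assoc]; gcongr
      _ ≤ β ^ (n - 2 : ℝ) * (C₃ * (θ * ρ) ^ (2 - n : ℝ) * ∫ y in ball x₀ ρ, E y) := by gcongr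
      _ = _ := by rw [Real.mul_rpow hθ.le hρ.le]; ring
  · refine le_trans ?_ (le_add_of_nonneg_left hc2)
    have h1 : θ / (2 * β) * ρ ≤ σ := by
      rw [div_mul_eq_mul_div, div_le_iff₀ (by positivity)]; linarith
    rw [← Real.mul_rpow (by positivity) hρ.le]
    have h2 : σ ^ (2 - n : ℝ) ≤ (θ / (2 * β) * ρ) ^ (2 - n : ℝ) :=
      Real.rpow_le_rpow_of_nonpos (by positivity) h1 (by linarith)
    have h3 : ∫ y in ball x₀ σ, E y ≤ ∫ y in ball x₀ ρ, E y :=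
      hmono measurableSet_ball (ball_subset_ball hσρ) hsubρ
    have h4 : 0 ≤ ∫ y in ball x₀ σ, E y :=
      setIntegral_nonneg measurableSet_ball fun y hy => hE0 y (hsubρ (ball_subset_ball hσρ hy))
    gcongr

/-- The weighted potential bound on balls. -/
theorem exists_pot_ball_bound (n : ℕ) (hn : 3 ≤ n) {c L β : ℝ} (hc : 0 < c) (hL : 0 ≤ L)
    (hβ : 1 ≤ β) : ∃ C > 0, ∀ {κ ε ρ : ℝ}
    {a : Euc n → (Euc n →L[ℝ] Euc n)} {w : Euc n → ℝ} {A : Euc n →L[ℝ] Euc n} {x₀ : Euc n}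
    {u : Euc n → ℂ}, 0 < ε → Coeffs n c κ L a w → AdaptedAt n c β a w A x₀ → WeakSol n ε a w u →
    0 < ρ → ρ < 1 - ‖x₀‖ →
    ∫ y in ball x₀ ρ, ‖y - x₀‖ ^ (2 - n : ℝ) * pot ε w u y
    ≤ C * (1 - ‖x₀‖) ^ (2 - n : ℝ) *
      ∫ y in ball 0 1, en ε (a y) (w y) (fderiv ℝ u y) (u y) := by
  obtain ⟨C₃, hC₃, h⟩ := exists_pot_bound n hn
  have hn' : (3 : ℝ) ≤ n := by exact_mod_cast hn
  have hβ0 : 0 < β := by linarith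
  obtain ⟨θ, hθ, hθ1, hθ2⟩ := exists_scale n hc hL hβ0
  refine ⟨C₃ * β ^ ((n - 2) / 2 : ℝ) * θ ^ (2 - n : ℝ) + (θ / (2 * β)) ^ (2 - n : ℝ),
    by positivity, fun {κ ε ρ a w A x₀ u} hε ha hA hu hρ hρB => ?_⟩
  set R := 1 - ‖x₀‖ with hR
  have hR0 : 0 < R := hρ.trans hρB
  set E : Euc n → ℝ := fun y => en ε (a y) (w y) (fderiv ℝ u y) (u y) with hE
  have hEi : IntegrableOn E (ball 0 1) := ha.integrableOn_en hu.diff hu.le_one hu.grad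
  have hE0 : ∀ y ∈ ball (0 : Euc n) 1, 0 ≤ E y := fun y hy => ha.en_nonneg hy _ _
  have hP0 : ∀ y ∈ ball (0 : Euc n) 1, 0 ≤ pot ε w u y := fun y hy => ha.pot_nonneg hy
  have hPi : IntegrableOn (pot ε w u) (ball 0 1) := hu.integrableOn_wpot ha
  have hI : 0 ≤ ∫ y in ball 0 1, E y := setIntegral_nonneg measurableSet_ball hE0
  set F : Euc n → ℝ := fun y => ‖y - x₀‖ ^ (2 - n : ℝ) * pot ε w u y with hF
  have hF0 : ∀ y ∈ ball (0 : Euc n) 1, 0 ≤ F y := fun y hy =>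
    mul_nonneg (by positivity) (hP0 y hy)
  by_cases hint : IntegrableOn F (ball x₀ ρ)
  swap
  · rw [integral_undef hint]; positivity
  have hsubρ : ball x₀ ρ ⊆ ball 0 1 := ball_subset_unitBall hρB.le
  have hfar : ∀ r > 0, ∀ y ∈ ball (0 : Euc n) 1, r ≤ ‖y - x₀‖ → F y ≤ r ^ (2 - n : ℝ) *
      pot ε w u y := fun r hr y hy h => by
    have := Real.rpow_le_rpow_of_nonpos hr h (show (2 - n : ℝ) ≤ 0 by linarith)
    have := hP0 y hy
    simp only [hF]; gcongr
  have hFm : AEStronglyMeasurable F (volume.restrict (ball 0 1)) := by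
    refine AEStronglyMeasurable.mul ?_ hPi.aestronglyMeasurable
    exact (Measurable.pow_const (by fun_prop) _).aestronglyMeasurable
  have hFi : IntegrableOn F (ball 0 1) := by
    have h1 : IntegrableOn F (ball 0 1 \ ball x₀ ρ) := by
      refine Integrable.mono' ((hPi.mono_set Set.sdiff_subset).const_mul (ρ ^ (2 - n : ℝ)))
        (hFm.mono_set Set.sdiff_subset) ?_
      filter_upwards [ae_restrict_mem (measurableSet_ball.diff measurableSet_ball)] with y hy
      rw [Real.norm_of_nonneg (hF0 y hy.1)]
      refine hfar ρ hρ y hy.1 ?_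
      have := hy.2
      rwa [mem_ball, dist_eq_norm, not_lt] at this
    exact (hint.union h1).mono_set fun y hy => by
      by_cases h : y ∈ ball x₀ ρ
      · exact Or.inl h
      · exact Or.inr ⟨hy, h⟩
  have hQc : Continuous (quad A x₀) := (contDiff_quad A x₀).continuous
  set Q := {y | quad A x₀ y ≤ (θ * R) ^ 2 / 4} with hQ
  have hQm : MeasurableSet Q := (isClosed_le hQc continuous_const).measurableSet
  have h1 := h (ρ := θ * R) hε ha hA hu (by positivity) (by nlinarith) (by
        have : 8 * L * β ^ 4 / c * (n * (θ * R)) = 8 * L * β ^ 4 / c * (n * θ) * R := by ring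
        rw [this]
        have := norm_nonneg x₀
        exact mul_le_one₀ hθ2 hR0.le (by linarith)) (hFi.mono_set Set.inter_subset_left)
  have h2 : ∫ y in ball 0 1 ∩ {y | quad A x₀ y ≤ (θ * R) ^ 2}, E y ≤ ∫ y in ball 0 1, E y :=
    setIntegral_mono_set hEi ((ae_restrict_mem measurableSet_ball).mono fun y hy => hE0 y hy)
      Set.inter_subset_left.eventuallyLE
  have h3 : ∫ y in ball 0 1 \ Q, F y ≤ (θ / (2 * β) * R) ^ (2 - n : ℝ) * ∫ y in ball 0 1, E y := by
    rw [← integral_const_mul]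
    refine (setIntegral_mono_on (hFi.mono_set Set.sdiff_subset)
      ((hEi.mono_set Set.sdiff_subset).const_mul _) (measurableSet_ball.diff hQm)
      fun y hy => ?_).trans (setIntegral_mono_set (hEi.const_mul _)
        ((ae_restrict_mem measurableSet_ball).mono fun y hy => ?_) Set.sdiff_subset.eventuallyLE)
    · refine (hfar _ (by positivity) y hy.1 ?_).trans
        (mul_le_mul_of_nonneg_left (ha.pot_le_en hy.1) (by positivity))
      by_contra hlt
      refine hy.2 ((hA.quad_le_of_norm_le (not_le.1 hlt).le).trans_eq ?_)
      field_simp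
      ring
    · exact mul_nonneg (by positivity) (hE0 y hy)
  have h4 : ∫ y in ball x₀ ρ, F y ≤ ∫ y in ball 0 1, F y :=
    setIntegral_mono_set hFi ((ae_restrict_mem measurableSet_ball).mono fun y hy => hF0 y hy)
      hsubρ.eventuallyLE
  have h5 := integral_inter_add_sdiff hQm hFi
  calc ∫ y in ball x₀ ρ, F y
      ≤ (∫ y in ball 0 1 ∩ Q, F y) + ∫ y in ball 0 1 \ Q, F y := h4.trans h5.ge
    _ ≤ C₃ * β ^ ((n - 2) / 2 : ℝ) * (θ * R) ^ (2 - n : ℝ) * (∫ y in ball 0 1, E y) +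
        (θ / (2 * β) * R) ^ (2 - n : ℝ) * ∫ y in ball 0 1, E y :=
      add_le_add (h1.trans (by gcongr)) h3
    _ = _ := by rw [Real.mul_rpow hθ.le hR0.le, Real.mul_rpow (by positivity) hR0.le]; ring

/-- The operator on Euclidean space with matrix `M`. -/
abbrev mop {n : ℕ} (M : Matrix (Fin n) (Fin n) ℝ) : Euc n →L[ℝ] Euc n :=
  Matrix.toEuclideanCLM (n := Fin n) (𝕜 := ℝ) M

section
variable {n : ℕ} {M N : Matrix (Fin n) (Fin n) ℝ} {b : ℝ}

theorem mop_apply (M : Matrix (Fin n) (Fin n) ℝ) (p : Euc n) (i : Fin n) :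
    mop M p i = ∑ j, M i j * p j := rfl

theorem inner_mop (M : Matrix (Fin n) (Fin n) ℝ) (p q : Euc n) :
    ⟪p, mop M q⟫ = ∑ i, ∑ j, M i j * p i * q j := by
  rw [Matrix.inner_toEuclideanCLM]
  simp only [dotProduct, Matrix.mulVec, Finset.mul_sum]
  exact Finset.sum_congr rfl fun i _ => Finset.sum_congr rfl fun j _ => by ring

theorem inner_mop_symm (hM : M.IsSymm) (p q : Euc n) : ⟪mop M p, q⟫ = ⟪p, mop M q⟫ := by
  rw [real_inner_comm, inner_mop, inner_mop, Finset.sum_comm]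
  exact Finset.sum_congr rfl fun i _ => Finset.sum_congr rfl fun j _ => by
    rw [hM.apply]; ring

theorem norm_mop_le (hb : 0 ≤ b) (h : ∀ i j, |M i j| ≤ b) : ‖mop M‖ ≤ n * b := by
  refine ContinuousLinearMap.opNorm_le_bound _ (by positivity) fun p => ?_
  refine abs_le_of_sq_le_sq' ?_ (by positivity) |>.2
  have h1 : ∀ i, (mop M p i) ^ 2 ≤ n * b ^ 2 * ‖p‖ ^ 2 := fun i => by
    rw [mop_apply, EuclideanSpace.real_norm_sq_eq]
    refine (Finset.sum_mul_sq_le_sq_mul_sq _ _ _).trans ?_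
    gcongr
    calc ∑ j, M i j ^ 2 ≤ ∑ _j : Fin n, b ^ 2 :=
          Finset.sum_le_sum fun j _ => sq_le_sq' (abs_le.1 (h i j)).1 (abs_le.1 (h i j)).2
      _ = n * b ^ 2 := by simp
  rw [EuclideanSpace.real_norm_sq_eq]
  calc ∑ i, (mop M p i) ^ 2 ≤ ∑ _i : Fin n, n * b ^ 2 * ‖p‖ ^ 2 :=
        Finset.sum_le_sum fun i _ => h1 i
    _ = _ := by simp; ring

theorem abs_apply_le_norm_mop (M : Matrix (Fin n) (Fin n) ℝ) (i j : Fin n) :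
    |M i j| ≤ ‖mop M‖ := by
  have h : ⟪(EuclideanSpace.single i 1 : Euc n), mop M (EuclideanSpace.single j 1)⟫ = M i j := by
    rw [inner_mop]
    simp [PiLp.single_apply]
  rw [← h]
  refine (abs_real_inner_le_norm _ _).trans ?_
  have := (mop M).le_opNorm (EuclideanSpace.single j 1)
  simpa using this

theorem qform_mop (hM : M.IsSymm) (D D' : Euc n →L[ℝ] ℂ) :
    qform (mop M) D D' = ∑ i, ∑ j, M i j *
      rdot (D (EuclideanSpace.single i 1)) (D' (EuclideanSpace.single j 1)) := by
  have h1 : ∀ (D : Euc n →L[ℝ] ℂ) i, gvec D 1 i = (D (EuclideanSpace.single i 1)).re :=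
    fun D i => by
      rw [← inner_gvec_one, EuclideanSpace.inner_single_left]; simp
  have h2 : ∀ (D : Euc n →L[ℝ] ℂ) i, gvec D Complex.I i = (D (EuclideanSpace.single i 1)).im :=
    fun D i => by
      rw [← inner_gvec_I, EuclideanSpace.inner_single_left]; simp
  rw [qform, inner_mop_symm hM, inner_mop_symm hM, inner_mop, inner_mop, ← Finset.sum_add_distrib]
  refine Finset.sum_congr rfl fun i _ => ?_
  rw [← Finset.sum_add_distrib]
  refine Finset.sum_congr rfl fun j _ => ?_
  rw [h1, h1, h2, h2, rdot]; ring

theorem qform_smul {t : ℝ} (S : Euc n →L[ℝ] Euc n) (D D' : Euc n →L[ℝ] ℂ) :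
    qform (t • S) D D' = t * qform S D D' := by
  simp [qform, inner_smul_left]; ring

theorem rdot_eq_inner (v w : ℂ) : rdot v w = ⟪v, w⟫ := by
  rw [Complex.inner, rdot]; simp; ring

theorem abs_det_le (h : ∀ i j, |M i j| ≤ b) : |M.det| ≤ n.factorial * b ^ n := by
  have := Matrix.det_le (abv := AbsoluteValue.abs) (A := M) (x := b) h
  simpa using this

theorem exists_abs_det_sub_le (n : ℕ) (b : ℝ) : ∃ K : ℝ, 0 ≤ K ∧
    ∀ {M N : Matrix (Fin n) (Fin n) ℝ} {d : ℝ}, (∀ i j, |M i j| ≤ b) → (∀ i j, |N i j| ≤ b) →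
      0 ≤ d → (∀ i j, |M i j - N i j| ≤ d) → |M.det - N.det| ≤ K * d := by
  let f : (Fin n → Fin n → ℝ) → ℝ := fun M => (Matrix.of M).det
  have hf : ContDiff ℝ 1 f := by
    simp only [f, Matrix.det_apply, Matrix.of_apply]
    refine ContDiff.sum fun s _ => ContDiff.const_smul _ (contDiff_prod fun i _ => ?_)
    fun_prop
  obtain ⟨K, hK⟩ := (hf.locallyLipschitz.locallyLipschitzOn
    (s := closedBall 0 |b|)).exists_lipschitzOnWith_of_compact (isCompact_closedBall _ _)
  refine ⟨K, K.2, fun {M N d} hM hN hd h => ?_⟩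
  have hmem : ∀ {M : Matrix (Fin n) (Fin n) ℝ}, (∀ i j, |M i j| ≤ b) →
      (fun i j => M i j) ∈ closedBall (0 : Fin n → Fin n → ℝ) |b| := fun {M} hM => by
    rw [mem_closedBall_zero_iff, pi_norm_le_iff_of_nonneg (abs_nonneg _)]
    refine fun i => (pi_norm_le_iff_of_nonneg (abs_nonneg _)).2 fun j => ?_
    exact (hM i j).trans (le_abs_self b)
  have h1 := hK.dist_le_mul _ (hmem hM) _ (hmem hN)
  have h2 : dist (fun i j => M i j) (fun i j => N i j) ≤ d :=
    (dist_pi_le_iff hd).2 fun i => (dist_pi_le_iff hd).2 fun j => h i j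
  exact h1.trans (by gcongr)

end

section
variable {n : ℕ} {lam B : ℝ} {M N : Matrix (Fin n) (Fin n) ℝ}

theorem norm_mop_inv_le (hlam : 0 < lam) (hM : IsUnit M.det)
    (h : ∀ p, lam * ‖p‖ ^ 2 ≤ ⟪p, mop M p⟫) : ‖mop M⁻¹‖ ≤ lam⁻¹ := by
  refine ContinuousLinearMap.opNorm_le_bound _ (by positivity) fun p => ?_
  have h1 : mop M (mop M⁻¹ p) = p := by
    rw [← mul_apply_eq_comp, ← map_mul, Matrix.mul_nonsing_inv _ hM, map_one]
    rfl
  have h2 := h (mop M⁻¹ p)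
  rw [h1] at h2
  have h3 := h2.trans (real_inner_le_norm _ _)
  rw [inv_mul_eq_div, le_div_iff₀ hlam]
  rcases (norm_nonneg (mop M⁻¹ p)).eq_or_lt with h4 | h4
  · rw [← h4]; simp
  · nlinarith

theorem mop_inv_coer (hlam : 0 < lam) (hB : 0 < B) (hM : IsUnit M.det) (hMB : ‖mop M‖ ≤ B)
    (h : ∀ p, lam * ‖p‖ ^ 2 ≤ ⟪p, mop M p⟫) (p : Euc n) :
    lam / B ^ 2 * ‖p‖ ^ 2 ≤ ⟪mop M⁻¹ p, p⟫ := by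
  have h1 : mop M (mop M⁻¹ p) = p := by
    rw [← mul_apply_eq_comp, ← map_mul, Matrix.mul_nonsing_inv _ hM, map_one]
    rfl
  have h2 := h (mop M⁻¹ p)
  rw [h1] at h2
  have h3 := (mop M).le_of_opNorm_le hMB (mop M⁻¹ p)
  rw [h1] at h3
  refine le_trans ?_ h2
  rw [div_mul_eq_mul_div, div_le_iff₀ (by positivity)]
  calc lam * ‖p‖ ^ 2 ≤ lam * (B * ‖mop M⁻¹ p‖) ^ 2 := by gcongr
    _ = _ := by ring

theorem norm_mop_inv_sub_le (hlam : 0 < lam) (hM : IsUnit M.det) (hN : IsUnit N.det)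
    (h : ∀ p, lam * ‖p‖ ^ 2 ≤ ⟪p, mop M p⟫) (h' : ∀ p, lam * ‖p‖ ^ 2 ≤ ⟪p, mop N p⟫) :
    ‖mop M⁻¹ - mop N⁻¹‖ ≤ lam⁻¹ ^ 2 * ‖mop (M - N)‖ := by
  have e : M⁻¹ - N⁻¹ = -(M⁻¹ * (M - N) * N⁻¹) := by
    rw [mul_sub, sub_mul, Matrix.nonsing_inv_mul _ hM, Matrix.mul_assoc,
      Matrix.mul_nonsing_inv _ hN]
    simp
  rw [← map_sub, e, map_neg, norm_neg, map_mul, map_mul]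
  have h1 := norm_mop_inv_le hlam hM h
  have h2 := norm_mop_inv_le hlam hN h'
  calc _ ≤ ‖mop M⁻¹‖ * ‖mop (M - N)‖ * ‖mop N⁻¹‖ :=
        (norm_mul_le _ _).trans (by gcongr; exact norm_mul_le _ _)
    _ ≤ lam⁻¹ * ‖mop (M - N)‖ * lam⁻¹ := by gcongr
    _ = _ := by ring

theorem le_det (hlam : 0 < lam) (hM : 0 < M.det)
    (h : ∀ p, lam * ‖p‖ ^ 2 ≤ ⟪p, mop M p⟫) : lam ^ n / n.factorial ≤ M.det := by
  have hu : IsUnit M.det := hM.ne'.isUnit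
  have h1 := abs_det_le (M := M⁻¹) fun i j =>
    (abs_apply_le_norm_mop M⁻¹ i j).trans (norm_mop_inv_le hlam hu h)
  rw [Matrix.det_nonsing_inv, Ring.inverse_eq_inv', abs_of_pos (by positivity)] at h1
  have h2 := mul_le_mul_of_nonneg_right h1 hM.le
  rw [inv_mul_cancel₀ hM.ne'] at h2
  rw [div_le_iff₀ (by positivity)]
  have h3 := mul_le_mul_of_nonneg_left h2 (show 0 ≤ lam ^ n by positivity)
  have h4 : lam ^ n * lam⁻¹ ^ n = 1 := by rw [← mul_pow, mul_inv_cancel₀ hlam.ne', one_pow]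
  calc lam ^ n = lam ^ n * 1 := (mul_one _).symm
    _ ≤ _ := h3
    _ = M.det * n.factorial * (lam ^ n * lam⁻¹ ^ n) := by ring
    _ = _ := by rw [h4, mul_one]

theorem abs_sqrt_sub_sqrt_le {m s t : ℝ} (hm : 0 < m) (hs : m ^ 2 ≤ s) (ht : m ^ 2 ≤ t) :
    |Real.sqrt s - Real.sqrt t| ≤ m⁻¹ * |s - t| := by
  have h1 : m ≤ Real.sqrt s := Real.le_sqrt_of_sq_le hs
  have h2 : m ≤ Real.sqrt t := Real.le_sqrt_of_sq_le ht
  have e : s - t = (Real.sqrt s - Real.sqrt t) * (Real.sqrt s + Real.sqrt t) := by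
    have h3 := Real.mul_self_sqrt ((sq_nonneg m).trans hs)
    have h4 := Real.mul_self_sqrt ((sq_nonneg m).trans ht)
    linear_combination h4 - h3
  rw [inv_mul_eq_div, le_div_iff₀ hm, e, abs_mul]
  gcongr
  rw [abs_of_nonneg (by linarith)]
  linarith

end

section
variable {n : ℕ} {lam Lam ε : ℝ} {g : Euc n → Matrix (Fin n) (Fin n) ℝ} {u : Euc n → ℂ}
  {x y : Euc n}

theorem MemM.abs_sub_le (hg : MemM n lam Lam g) (hLam : 0 ≤ Lam) (hx : x ∈ ball (0 : Euc n) 1)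
    (hy : y ∈ ball (0 : Euc n) 1) (i j : Fin n) : |g x i j - g y i j| ≤ Lam * ‖x - y‖ := by
  have := (hg.2.2.1 i j).dist_le_mul x hx y hy
  rwa [Real.dist_eq, Real.coe_toNNReal _ hLam, dist_eq_norm] at this

theorem MemM.abs_le (hg : MemM n lam Lam g) (hLam : 0 ≤ Lam) (hx : x ∈ ball (0 : Euc n) 1)
    (i j : Fin n) : |g x i j| ≤ 1 + Lam := by
  have h1 := hg.abs_sub_le hLam hx (mem_ball_self one_pos) i j
  rw [hg.1, sub_zero] at h1
  have h2 : |(1 : Matrix (Fin n) (Fin n) ℝ) i j| ≤ 1 := by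
    rw [Matrix.one_apply]; split_ifs <;> simp
  have h3 : ‖x‖ ≤ 1 := (mem_ball_zero_iff.1 hx).le
  have h4 := abs_sub_abs_le_abs_sub (g x i j) ((1 : Matrix (Fin n) (Fin n) ℝ) i j)
  nlinarith

theorem MemM.coer (hg : MemM n lam Lam g) (hx : x ∈ ball (0 : Euc n) 1) (p : Euc n) :
    lam * ‖p‖ ^ 2 ≤ ⟪p, mop (g x) p⟫ := by
  rw [inner_mop, EuclideanSpace.real_norm_sq_eq]
  exact (hg.2.2.2 x hx p.ofLp).1

theorem MemM.det_pos (hg : MemM n lam Lam g) (hx : x ∈ ball (0 : Euc n) 1) : 0 < (g x).det :=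
  (hg.2.1 x hx).2.det_pos

theorem MemM.isUnit_det (hg : MemM n lam Lam g) (hx : x ∈ ball (0 : Euc n) 1) :
    IsUnit (g x).det := (hg.det_pos hx).ne'.isUnit

theorem MemM.inv_isSymm (hg : MemM n lam Lam g) (hx : x ∈ ball (0 : Euc n) 1) :
    (g x)⁻¹.IsSymm := by
  rw [Matrix.IsSymm, Matrix.transpose_nonsing_inv, (hg.2.1 x hx).1]

theorem norm_smul_sub_smul_le {V : Type*} [NormedAddCommGroup V] [NormedSpace ℝ V] (s t : ℝ)
    (v v' : V) : ‖s • v - t • v'‖ ≤ |s - t| * ‖v‖ + |t| * ‖v - v'‖ := by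
  have e : s • v - t • v' = (s - t) • v + t • (v - v') := by rw [sub_smul, smul_sub]; abel
  rw [e]
  refine (norm_add_le _ _).trans ?_
  rw [norm_smul, norm_smul, Real.norm_eq_abs, Real.norm_eq_abs]

/-- The coefficient operator `√(det g) g⁻¹` of the Laplacian of the metric `g`. -/
def cof {n : ℕ} (g : Euc n → Matrix (Fin n) (Fin n) ℝ) (x : Euc n) : Euc n →L[ℝ] Euc n :=
  sqrtDet g x • mop (g x)⁻¹

/-- Structural constants for the class of metrics. -/
theorem exists_coeffs (n : ℕ) (hn : 0 < n) (hlam : 0 < lam) (hLam : 0 < Lam) :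
    ∃ c κ L β : ℝ, 0 < c ∧ 0 ≤ L ∧ 1 ≤ β ∧ ∀ g, MemM n lam Lam g →
      Coeffs n c κ L (cof g) (sqrtDet g) ∧
      ∀ x₀ ∈ ball (0 : Euc n) 1, AdaptedAt n c β (cof g) (sqrtDet g) (mop (g x₀)) x₀ := by
  obtain ⟨K, hK, hdet⟩ := exists_abs_det_sub_le n (1 + Lam)
  obtain ⟨B, hB⟩ : ∃ B, B = n * (1 + Lam) := ⟨_, rfl⟩
  obtain ⟨m, hm⟩ : ∃ m, m = Real.sqrt (lam ^ n / n.factorial) := ⟨_, rfl⟩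
  obtain ⟨W, hW⟩ : ∃ W, W = Real.sqrt (n.factorial * (1 + Lam) ^ n) := ⟨_, rfl⟩
  have hn0 : (0 : ℝ) < n := by exact_mod_cast hn
  have hB0 : 0 < B := by rw [hB]; positivity
  have hm0 : 0 < m := by rw [hm]; positivity
  have hm2 : m ^ 2 = lam ^ n / n.factorial := by rw [hm, Real.sq_sqrt (by positivity)]
  have hW0 : 0 ≤ W := by rw [hW]; positivity
  have hL1 : 0 ≤ m⁻¹ * K * Lam := by positivity
  have hL2 : 0 ≤ m⁻¹ * K * Lam * lam⁻¹ + W * (lam⁻¹ ^ 2 * (n * Lam)) := by positivity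
  refine ⟨min (m * (lam / B ^ 2)) m, W * lam⁻¹ + W,
    m⁻¹ * K * Lam + (m⁻¹ * K * Lam * lam⁻¹ + W * (lam⁻¹ ^ 2 * (n * Lam))), 1 + B + lam⁻¹,
    lt_min (by positivity) hm0, by positivity, by linarith [inv_pos.2 hlam], fun g hg => ?_⟩
  have hdl : ∀ x ∈ ball (0 : Euc n) 1, m ^ 2 ≤ (g x).det := fun x hx => by
    rw [hm2]; exact le_det hlam (hg.det_pos hx) (hg.coer hx)
  have hwl : ∀ x ∈ ball (0 : Euc n) 1, m ≤ sqrtDet g x := fun x hx =>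
    Real.le_sqrt_of_sq_le (hdl x hx)
  have hwu : ∀ x ∈ ball (0 : Euc n) 1, sqrtDet g x ≤ W := fun x hx => by
    rw [hW]
    exact Real.sqrt_le_sqrt ((le_abs_self _).trans (abs_det_le (hg.abs_le hLam.le hx)))
  have hGB : ∀ x ∈ ball (0 : Euc n) 1, ‖mop (g x)‖ ≤ B := fun x hx => by
    rw [hB]; exact norm_mop_le (by positivity) (hg.abs_le hLam.le hx)
  have hwlip : ∀ x ∈ ball (0 : Euc n) 1, ∀ y ∈ ball (0 : Euc n) 1,
      |sqrtDet g x - sqrtDet g y| ≤ m⁻¹ * K * Lam * ‖x - y‖ := fun x hx y hy => by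
    refine (abs_sqrt_sub_sqrt_le hm0 (hdl x hx) (hdl y hy)).trans ?_
    have := hdet (hg.abs_le hLam.le hx) (hg.abs_le hLam.le hy) (by positivity)
      (hg.abs_sub_le hLam.le hx hy)
    calc _ ≤ m⁻¹ * (K * (Lam * ‖x - y‖)) := by gcongr
      _ = _ := by ring
  refine ⟨⟨lt_min (by positivity) hm0, by positivity, by positivity, fun x hx p q => ?_,
    fun x hx p => ?_, fun x hx => ?_, fun x hx y hy => ?_, fun x _ => Real.sqrt_nonneg _,
    fun x hx => ?_, fun x hx y hy => ?_⟩, fun x₀ hx₀ => ⟨hx₀, fun x hx => ?_,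
    inner_mop_symm (hg.2.1 x₀ hx₀).1, fun h => ?_, ?_, ?_, fun h => ?_⟩⟩
  · simp only [cof, smul_apply, inner_smul_left, inner_smul_right]
    rw [inner_mop_symm (hg.inv_isSymm hx)]; simp
  · simp only [cof, smul_apply, inner_smul_left]
    have h1 := mop_inv_coer hlam hB0 (hg.isUnit_det hx) (hGB x hx) (hg.coer hx) p
    have h2 := hwl x hx
    calc _ ≤ m * (lam / B ^ 2) * ‖p‖ ^ 2 := by gcongr; exact min_le_left _ _
      _ = m * (lam / B ^ 2 * ‖p‖ ^ 2) := by ring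
      _ ≤ _ := mul_le_mul h2 h1 (by positivity) (hm0.le.trans h2)
  · rw [cof, norm_smul, Real.norm_of_nonneg (show 0 ≤ sqrtDet g x from Real.sqrt_nonneg _)]
    have h1 := norm_mop_inv_le hlam (hg.isUnit_det hx) (hg.coer hx)
    have h2 := hwu x hx
    have := mul_le_mul h2 h1 (norm_nonneg _) hW0
    exact this.trans (le_add_of_nonneg_right hW0)
  · have h1 := norm_mop_inv_le hlam (hg.isUnit_det hx) (hg.coer hx)
    have h2 := norm_mop_inv_sub_le hlam (hg.isUnit_det hx) (hg.isUnit_det hy) (hg.coer hx)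
      (hg.coer hy)
    have h3 : ‖mop (g x - g y)‖ ≤ n * (Lam * ‖x - y‖) :=
      norm_mop_le (by positivity) (hg.abs_sub_le hLam.le hx hy)
    have h4 := hwlip x hx y hy
    have h5 := hwu y hy
    refine (norm_smul_sub_smul_le _ _ _ _).trans ?_
    rw [abs_of_nonneg (show 0 ≤ sqrtDet g y from Real.sqrt_nonneg _)]
    calc _ ≤ (m⁻¹ * K * Lam * ‖x - y‖) * lam⁻¹ +
          W * (lam⁻¹ ^ 2 * (n * (Lam * ‖x - y‖))) := by
          gcongr
          exact h2.trans (by gcongr)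
      _ = (m⁻¹ * K * Lam * lam⁻¹ + W * (lam⁻¹ ^ 2 * (n * Lam))) * ‖x - y‖ := by ring
      _ ≤ _ := mul_le_mul_of_nonneg_right (le_add_of_nonneg_left hL1) (norm_nonneg _)
  · exact (hwu x hx).trans (le_add_of_nonneg_left (by positivity))
  · refine (hwlip x hx y hy).trans ?_
    gcongr
    exact le_add_of_nonneg_right hL2
  · exact (min_le_right _ _).trans (hwl x hx)
  · rw [cof, smul_apply, ← mul_apply_eq_comp, ← map_mul,
      Matrix.nonsing_inv_mul _ (hg.isUnit_det hx₀), map_one]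
    rfl
  · linarith [inv_pos.2 hlam]
  · exact (hGB x₀ hx₀).trans (by linarith [inv_pos.2 hlam])
  · have h1 := hg.coer hx₀ h
    rw [inner_mop_symm (hg.2.1 x₀ hx₀).1]
    have h2 : lam⁻¹ ≤ (1 + B + lam⁻¹) ^ 2 := by
      have := inv_pos.2 hlam
      nlinarith
    calc ‖h‖ ^ 2 = lam⁻¹ * (lam * ‖h‖ ^ 2) := by field_simp
      _ ≤ _ := mul_le_mul h2 h1 (by positivity) (by positivity)

theorem MemM.qform_cof (hg : MemM n lam Lam g) (hx : x ∈ ball (0 : Euc n) 1)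
    (v : Euc n → ℂ) :
    qform (cof g x) (fderiv ℝ u x) (fderiv ℝ v x) =
      (∑ i, ∑ j, (g x)⁻¹ i j * rdot (pd u i x) (pd v j x)) * sqrtDet g x := by
  rw [cof, qform_smul, qform_mop (hg.inv_isSymm hx), mul_comm]; rfl

theorem MemM.en_eq (hg : MemM n lam Lam g) (hx : x ∈ ball (0 : Euc n) 1) :
    en ε (cof g x) (sqrtDet g x) (fderiv ℝ u x) (u x) = eDen g ε u x * sqrtDet g x := by
  rw [en, hg.qform_cof hx, eDen, gradSq]; ring

theorem IsGLSol.weakSol {c κ L : ℝ} (hu : IsGLSol n g ε u) (hg : MemM n lam Lam g)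
    (ha : Coeffs n c κ L (cof g) (sqrtDet g)) : WeakSol n ε (cof g) (sqrtDet g) u := by
  refine ⟨hu.1, hu.2.1, ?_, fun ζ hζ hζB => ?_⟩
  · refine Integrable.mono' (hu.2.2.1.const_mul (2 / c))
      ((aesm_fderiv u _).norm.pow 2) ?_
    filter_upwards [ae_restrict_mem measurableSet_ball] with x hx
    rw [Real.norm_of_nonneg (by positivity), ← hg.en_eq hx]
    have h1 := ha.qform_nonneg hx (fderiv ℝ u x)
    have h2 := ha.w_nonneg x hx
    have h3 := ha.c_pos
    have h4 : 0 ≤ sqrtDet g x * ((1 - ‖u x‖ ^ 2) ^ 2 / (4 * ε ^ 2)) := by positivity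
    rw [div_mul_eq_mul_div, le_div_iff₀ h3, en]
    linarith
  · rw [← hu.2.2.2 ζ hζ hζB]
    refine setIntegral_congr_fun measurableSet_ball fun x hx => ?_
    rw [hg.qform_cof hx, ← rdot_eq_inner, sub_mul]; ring

end

/-- monotonicity of the energy on balls not centered at the origin, and a
weighted bound for the potential term. -/
theorem stmt4 (n : ℕ) (hn : 3 ≤ n) (lam Lam : ℝ) (hlam : 0 < lam) (hLam : 0 < Lam) :
    ∃ C : ℝ, 0 < C ∧
      ∀ (g : Euc n → Matrix (Fin n) (Fin n) ℝ) (ε : ℝ) (u : Euc n → ℂ),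
        0 < ε → MemM n lam Lam g → IsGLSol n g ε u →
        ∀ x₀ ∈ ball (0 : Euc n) 1, ∀ σ ρ : ℝ, 0 < σ → σ ≤ ρ → ρ < 1 - ‖x₀‖ →
          σ ^ ((2 : ℝ) - n) * (∫ x in ball x₀ σ, eDen g ε u x * sqrtDet g x)
              ≤ C * ρ ^ ((2 : ℝ) - n) * (∫ x in ball x₀ ρ, eDen g ε u x * sqrtDet g x) ∧
          (∫ x in ball x₀ ρ,
              ‖x - x₀‖ ^ ((2 : ℝ) - n) * ((1 - ‖u x‖ ^ 2) ^ 2 / ε ^ 2) * sqrtDet g x)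
            ≤ C * (1 - ‖x₀‖) ^ ((2 : ℝ) - n) *
              ∫ x in ball (0 : Euc n) 1, eDen g ε u x * sqrtDet g x := by
  obtain ⟨c, κ, L, β, hc, hL, hβ, hco⟩ := exists_coeffs n (by omega) hlam hLam
  obtain ⟨C₁, hC₁, h₁⟩ := exists_energy_ball_bound n hn hc hL hβ
  obtain ⟨C₂, hC₂, h₂⟩ := exists_pot_ball_bound n hn hc hL hβ
  refine ⟨C₁ + 4 * C₂, by positivity, fun g ε u hε hg hu x₀ hx₀ σ ρ hσ hσρ hρ => ?_⟩
  obtain ⟨ha, hA⟩ := hco g hg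
  have hw := hu.weakSol hg ha
  have hρ0 := hσ.trans_le hσρ
  have hx₀' : 0 < 1 - ‖x₀‖ := hρ0.trans hρ
  have e : ∀ {S : Set (Euc n)}, MeasurableSet S → S ⊆ ball 0 1 →
      ∫ x in S, eDen g ε u x * sqrtDet g x =
        ∫ x in S, en ε (cof g x) (sqrtDet g x) (fderiv ℝ u x) (u x) := fun hS hSB =>
    setIntegral_congr_fun hS fun x hx => (hg.en_eq (hSB hx)).symm
  have hnn : ∀ {S : Set (Euc n)}, MeasurableSet S → S ⊆ ball 0 1 →
      0 ≤ ∫ x in S, en ε (cof g x) (sqrtDet g x) (fderiv ℝ u x) (u x) := fun hS hSB =>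
    setIntegral_nonneg hS fun x hx => ha.en_nonneg (hSB hx) _ _
  have hρB := ball_subset_unitBall hρ.le
  constructor
  · rw [e measurableSet_ball ((ball_subset_ball hσρ).trans hρB), e measurableSet_ball hρB]
    refine (h₁ hε ha (hA x₀ hx₀) hw hσ hσρ hρ).trans ?_
    have := hnn measurableSet_ball hρB
    gcongr
    linarith
  · rw [e measurableSet_ball subset_rfl]
    have h := h₂ hε ha (hA x₀ hx₀) hw hρ0 hρ
    have h0 := hnn (S := ball 0 1) measurableSet_ball subset_rfl
    have e2 : ∀ x, ‖x - x₀‖ ^ ((2 : ℝ) - n) * ((1 - ‖u x‖ ^ 2) ^ 2 / ε ^ 2) * sqrtDet g x =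
        4 * (‖x - x₀‖ ^ ((2 : ℝ) - n) * pot ε (sqrtDet g) u x) := fun x => by
      rw [pot]; field_simp
    simp only [e2]
    rw [integral_const_mul]
    calc _ ≤ 4 * (C₂ * (1 - ‖x₀‖) ^ ((2 : ℝ) - n) *
          ∫ x in ball 0 1, en ε (cof g x) (sqrtDet g x) (fderiv ℝ u x) (u x)) := by gcongr
      _ = 4 * C₂ * (1 - ‖x₀‖) ^ ((2 : ℝ) - n) *
          ∫ x in ball 0 1, en ε (cof g x) (sqrtDet g x) (fderiv ℝ u x) (u x) := by ring
      _ ≤ _ := by gcongr; linarith
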